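/- arXiv:2010.15744 — 4 statements merged into one kernel-verified Lean document; each statement's English description precedes it below -/
import Mathlib

section
/- There is an absolute constant C > 0 such that every cubic field K contains an element α ∈ O_K whose image in O_K/ℤ is primitive and for which the index [O_K : ℤ[α]] is at most C·|Δ(K)|^{1/4}. In other words, every cubic field K is n-monogenized for some n ≤ C·|Δ(K)|^{1/4}. -/
/-!
Statement 6: there is an absolute constant `C > 0` such that every cubic field `K`
contains a primitive-mod-ℤ element `α ∈ 𝓞 K` with `[𝓞 K : ℤ[α]] ≤ C·|Δ(K)|^{1/4}`.
-/

open NumberField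

noncomputable section

/-- `α` has primitive image in the additive quotient `R/ℤ`:
its image is not `m·β` for any integer `m ≥ 2`. -/
def PrimitiveModZ {R : Type*} [CommRing R] (α : R) : Prop :=
  ¬ ∃ (m : ℕ) (β : R) (c : ℤ), 2 ≤ m ∧ α = m • β + (c : R)

/-- The index `[𝓞 K : ℤ[α]]` (as the index of the additive subgroup `ℤ[α]`;
this is `0` if the index is infinite). -/
def monoIndex {K : Type*} [Field K] [NumberField K] (α : 𝓞 K) : ℕ :=
  ((Algebra.adjoin ℤ ({α} : Set (𝓞 K))).toSubring.toAddSubgroup).index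

open Module MeasureTheory

/-- Minkowski's theorem on linear forms. -/
theorem Matrix.exists_int_abs_mulVec_lt {ι : Type*} [Fintype ι] [DecidableEq ι]
    (A : Matrix ι ι ℝ) (f : ι → ℝ) (hA : A.det ≠ 0) (hf : ∀ i, 0 < f i)
    (hlt : |A.det| < ∏ i, f i) :
    ∃ x : ι → ℤ, x ≠ 0 ∧ ∀ i, |(A.mulVec fun j => (x j : ℝ)) i| < f i := by
  classical
  have hli : LinearIndependent ℝ A.transpose.row :=
    Matrix.linearIndependent_rows_iff_isUnit.2
      ((Matrix.isUnit_iff_isUnit_det _).2 (by simpa using hA))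
  let B : Basis ι ℝ (ι → ℝ) :=
    basisOfPiSpaceOfLinearIndependent hli
  have hB : ⇑B = A.transpose.row := coe_basisOfPiSpaceOfLinearIndependent hli
  let s : Set (ι → ℝ) := Set.univ.pi fun i => Set.Ioo (-f i) (f i)
  have hdet : (Matrix.of B).det = A.det := by
    rw [hB, ← Matrix.det_transpose A]; rfl
  have hvol : volume (ZSpan.fundamentalDomain B) * 2 ^ finrank ℝ (ι → ℝ) < volume s := by
    rw [ZSpan.volume_fundamentalDomain, hdet, Real.volume_pi_Ioo, finrank_fintype_fun_eq_card,
      ← ENNReal.ofReal_prod_of_nonneg fun i _ => by linarith [hf i],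
      ← ENNReal.ofReal_ofNat, ← ENNReal.ofReal_pow (by norm_num),
      ← ENNReal.ofReal_mul (abs_nonneg _)]
    have hprod : ∏ i, (f i - -f i) = (∏ i, f i) * 2 ^ Fintype.card ι := by
      simp_rw [sub_neg_eq_add, ← mul_two, Finset.prod_mul_distrib]
      simp
    rw [hprod]
    have hpos : 0 < ∏ i, f i := Finset.prod_pos fun i _ => hf i
    exact (ENNReal.ofReal_lt_ofReal_iff (by positivity)).2 (by gcongr)
  have : Countable (Submodule.span ℤ (Set.range B)).toAddSubgroup :=
    inferInstanceAs (Countable (Submodule.span ℤ (Set.range B)))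
  obtain ⟨⟨y, hy⟩, hy0, hys⟩ := exists_ne_zero_mem_lattice_of_measure_mul_two_pow_lt_measure
    (ZSpan.isAddFundamentalDomain' B volume) (s := s)
    (fun x hx i _ => by
      have := hx i trivial
      simp only [Set.mem_Ioo, Pi.neg_apply] at this ⊢
      constructor <;> linarith)
    (convex_pi fun i _ => convex_Ioo _ _) hvol
  obtain ⟨x, rfl⟩ := (Submodule.mem_span_range_iff_exists_fun ℤ).1 hy
  refine ⟨x, ?_, fun i => ?_⟩
  · rintro rfl
    exact hy0 (by simp)
  · have h := hys i trivial
    rw [abs_lt]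
    convert h using 2
    simp [hB, Matrix.mulVec, dotProduct, Matrix.row, mul_comm]

open ComplexConjugate in
/-- If conjugation acts on the rows of a `3 × 3` complex matrix trivially or by exchanging the
last two, then the sum and the differences of its rows are controlled by three real linear
forms. -/
theorem Matrix.exists_real_forms_of_conj (E : Matrix (Fin 3) (Fin 3) ℂ)
    (h : (∀ i j, conj (E i j) = E i j) ∨ ∀ j, conj (E 0 j) = E 0 j ∧ conj (E 1 j) = E 2 j) :
    ∃ A : Matrix (Fin 3) (Fin 3) ℝ, |A.det| = 3 * ‖E.det‖ ∧ ∀ x : Fin 3 → ℝ,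
      (((A.mulVec x) 0 : ℝ) : ℂ) = ∑ i, (E.mulVec fun j => (x j : ℂ)) i ∧
      ∀ r, |(A.mulVec x) 1| ≤ r → |(A.mulVec x) 2| ≤ r → ∀ i j,
        ‖(E.mulVec fun j => (x j : ℂ)) i - (E.mulVec fun j => (x j : ℂ)) j‖ ≤ 2 * r := by
  rcases h with h | h
  · choose R hR using fun i j => Complex.conj_eq_iff_real.1 (h i j)
    obtain rfl : E = Matrix.of fun i j => (R i j : ℂ) := by ext i j; exact hR i j
    have hmul (x : Fin 3 → ℝ) (i : Fin 3) :
        ((Matrix.of fun i j => (R i j : ℂ)).mulVec fun j => (x j : ℂ)) i =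
          (((Matrix.of R).mulVec x i : ℝ) : ℂ) := by
      simp [Matrix.mulVec, dotProduct]
    refine ⟨Matrix.of ![R 0 + R 1 + R 2, R 0 - R 1, R 1 - R 2], ?_, fun x => ⟨?_, ?_⟩⟩
    · have hdet : (Matrix.of fun i j => (R i j : ℂ)).det = ((Matrix.of R).det : ℂ) := by
        simp [Matrix.det_fin_three]
      rw [hdet, Complex.norm_real, Real.norm_eq_abs, ← abs_of_pos (zero_lt_three' ℝ), ← abs_mul]
      congr 1
      simp [Matrix.det_fin_three]
      ring
    · simp [Matrix.mulVec, dotProduct, Fin.sum_univ_three]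
      ring
    · intro r h1 h2 i j
      simp only [hmul, ← Complex.ofReal_sub, Complex.norm_real, Real.norm_eq_abs]
      have e1 : (Matrix.of ![R 0 + R 1 + R 2, R 0 - R 1, R 1 - R 2]).mulVec x 1 =
          (Matrix.of R).mulVec x 0 - (Matrix.of R).mulVec x 1 := by
        simp [Matrix.mulVec, dotProduct, Fin.sum_univ_three]; ring
      have e2 : (Matrix.of ![R 0 + R 1 + R 2, R 0 - R 1, R 1 - R 2]).mulVec x 2 =
          (Matrix.of R).mulVec x 1 - (Matrix.of R).mulVec x 2 := by
        simp [Matrix.mulVec, dotProduct, Fin.sum_univ_three]; ring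
      rw [e1, abs_le] at h1
      rw [e2, abs_le] at h2
      rw [abs_le]
      fin_cases i <;> fin_cases j <;> constructor <;> simp <;> linarith
  · choose R hR using fun j => Complex.conj_eq_iff_real.1 (h j).1
    obtain ⟨U, hU⟩ : ∃ U : Fin 3 → ℝ, ∀ j, U j = (E 1 j).re := ⟨_, fun _ => rfl⟩
    obtain ⟨V, hV⟩ : ∃ V : Fin 3 → ℝ, ∀ j, V j = (E 1 j).im := ⟨_, fun _ => rfl⟩
    obtain rfl : E = Matrix.of ![fun j => (R j : ℂ), fun j => U j + V j * Complex.I,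
        fun j => U j - V j * Complex.I] := by
      ext i j
      fin_cases i
      · exact hR j
      · simp [hU, hV]
      · refine (h j).2.symm.trans ?_
        apply Complex.ext <;> simp [hU, hV]
    clear h hR hU hV
    set E : Matrix (Fin 3) (Fin 3) ℂ := Matrix.of ![fun j => (R j : ℂ),
      fun j => U j + V j * Complex.I, fun j => U j - V j * Complex.I] with hE
    refine ⟨Matrix.of ![R + 2 • U, R - U, 2 • V], ?_, fun x => ⟨?_, ?_⟩⟩
    · have hdet : E.det = ((Matrix.of ![R, U, V]).det : ℂ) * (-2 * Complex.I) := by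
        simp [hE, Matrix.det_fin_three]
        ring
      rw [hdet]
      simp only [norm_mul, Complex.norm_real, Real.norm_eq_abs, norm_neg, Complex.norm_I,
        Complex.norm_ofNat, mul_one]
      rw [show (Matrix.of ![R + 2 • U, R - U, 2 • V]).det = -6 * (Matrix.of ![R, U, V]).det by
        simp [Matrix.det_fin_three]; ring, abs_mul]
      norm_num
      ring
    · simp [hE, Matrix.mulVec, dotProduct, Fin.sum_univ_three]
      ring
    · intro r h1 h2 i j
      set p := (Matrix.of ![R + 2 • U, R - U, 2 • V]).mulVec x 1 with hp
      set q := (Matrix.of ![R + 2 • U, R - U, 2 • V]).mulVec x 2 with hq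
      set m := E.mulVec fun j => (x j : ℂ) with hm
      have e01 : m 0 - m 1 = p - q / 2 * Complex.I := by
        simp [hm, hp, hq, hE, Matrix.mulVec, dotProduct, Fin.sum_univ_three]; ring
      have e02 : m 0 - m 2 = p + q / 2 * Complex.I := by
        simp [hm, hp, hq, hE, Matrix.mulVec, dotProduct, Fin.sum_univ_three]; ring
      have e12 : m 1 - m 2 = q * Complex.I := by
        simp [hm, hq, hE, Matrix.mulVec, dotProduct, Fin.sum_univ_three]; ring
      have hq2 : ‖(q / 2 * Complex.I : ℂ)‖ = |q| / 2 := by simp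
      have hp' : ‖(p : ℂ)‖ = |p| := by simp
      have hr : 0 ≤ r := (abs_nonneg _).trans h1
      have b01 : ‖m 0 - m 1‖ ≤ 2 * r := by
        rw [e01]; exact (norm_sub_le _ _).trans (by rw [hq2, hp']; linarith)
      have b02 : ‖m 0 - m 2‖ ≤ 2 * r := by
        rw [e02]; exact (norm_add_le _ _).trans (by rw [hq2, hp']; linarith)
      have b12 : ‖m 1 - m 2‖ ≤ 2 * r := by
        rw [e12]; simp; linarith
      fin_cases i <;> fin_cases j <;> simp [hr] <;>
        first | assumption | (rw [norm_sub_rev]; assumption)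

theorem Fin.exists_perm_of_involutive (τ : Fin 3 → Fin 3) (hτ : Function.Involutive τ) :
    (∀ i, τ i = i) ∨ ∃ π : Equiv.Perm (Fin 3), τ (π 0) = π 0 ∧ τ (π 1) = π 2 := by
  unfold Function.Involutive at hτ
  revert τ
  decide

section Cubic

variable {K : Type*} [Field K] [NumberField K]

/-- The embeddings of a cubic field can be enumerated so that complex conjugation fixes all of
them, or fixes the first one and exchanges the other two. -/
theorem exists_equiv_embeddings_conj (h3 : finrank ℚ K = 3) :
    ∃ σ : Fin 3 ≃ (K →ₐ[ℚ] ℂ), (∀ i x, star (σ i x) = σ i x) ∨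
      ∀ x, star (σ 0 x) = σ 0 x ∧ star (σ 1 x) = σ 2 x := by
  have hcard : Fintype.card (K →ₐ[ℚ] ℂ) = 3 := by rw [AlgHom.card, h3]
  let σ : Fin 3 ≃ (K →ₐ[ℚ] ℂ) := (Fintype.equivFinOfCardEq hcard).symm
  let c : ℂ →ₐ[ℚ] ℂ := (Complex.conjAe.toAlgHom).restrictScalars ℚ
  have hc (z : ℂ) : c z = star z := rfl
  let τ : Fin 3 → Fin 3 := fun i => σ.symm (c.comp (σ i))
  have hστ (i : Fin 3) (x : K) : σ (τ i) x = star (σ i x) := by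
    simp [τ, hc]
  have hτ : Function.Involutive τ := fun i => σ.injective <| AlgHom.ext fun x => by
    rw [hστ, hστ, star_star]
  obtain h | ⟨π, h0, h1⟩ := Fin.exists_perm_of_involutive τ hτ
  · exact ⟨σ, Or.inl fun i x => by rw [← hστ, h]⟩
  · refine ⟨π.trans σ, Or.inr fun x => ?_⟩
    simp only [Equiv.trans_apply, ← hστ, h0, h1, and_self]

/-- A cubic field has an integral basis indexed by `Fin 3`. -/
theorem exists_integral_basis_fin_three (h3 : finrank ℚ K = 3) :
    Nonempty (Basis (Fin 3) ℤ (𝓞 K)) :=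
  ⟨Module.finBasisOfFinrankEq ℤ (𝓞 K) (by rw [RingOfIntegers.rank, h3])⟩

theorem discr_eq_det_sq_of_basis {ι : Type*} [Fintype ι] [DecidableEq ι] (b : Basis ι ℤ (𝓞 K))
    (σ : ι ≃ (K →ₐ[ℚ] ℂ)) :
    (discr K : ℂ) = (Matrix.of fun i j => σ i (b j : K)).det ^ 2 := by
  have h1 : Algebra.discr ℚ (b.localizationLocalization ℚ (nonZeroDivisors ℤ) K) =
      algebraMap ℤ ℚ (discr K) := by
    rw [Algebra.discr_localizationLocalization, discr_eq_discr]
  have h2 := Algebra.discr_eq_det_embeddingsMatrixReindex_pow_two ℚ ℂ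
    (b.localizationLocalization ℚ (nonZeroDivisors ℤ) K) σ
  rw [h1] at h2
  rw [← Matrix.det_transpose]
  refine (by simp : (discr K : ℂ) = _).trans (h2.trans ?_)
  congr 2
  ext i j
  simp [Algebra.embeddingsMatrixReindex, Algebra.embeddingsMatrix]

/-- A non-rational integer of a cubic field has degree three. -/
theorem natDegree_minpoly_rat_eq_three (h3 : finrank ℚ K = 3) {α : 𝓞 K}
    (hα : ∀ n : ℤ, α ≠ n) : (minpoly ℚ (α : K)).natDegree = 3 := by
  have hdvd : (minpoly ℚ (α : K)).natDegree ∣ 3 := h3 ▸ minpoly.degree_dvd (.of_finite ℚ _)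
  refine ((Nat.dvd_prime Nat.prime_three).1 hdvd).resolve_left fun h => ?_
  obtain ⟨q, hq⟩ := minpoly.natDegree_eq_one_iff.1 h
  have hq' : IsIntegral ℤ q :=
    (isIntegral_algebraMap_iff (algebraMap ℚ K).injective).1
      (hq ▸ RingOfIntegers.isIntegral_coe α)
  obtain ⟨n, rfl⟩ := IsIntegrallyClosed.isIntegral_iff.1 hq'
  exact hα n (RingOfIntegers.ext (by simpa using hq.symm))

theorem natDegree_minpoly_int_eq_three (h3 : finrank ℚ K = 3) {α : 𝓞 K}
    (hα : ∀ n : ℤ, α ≠ n) : (minpoly ℤ α).natDegree = 3 := by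
  have hint : IsIntegral ℤ (α : K) := RingOfIntegers.isIntegral_coe α
  rw [← natDegree_minpoly_rat_eq_three h3 hα,
    minpoly.isIntegrallyClosed_eq_field_fractions' ℚ hint,
    (minpoly.monic hint).natDegree_map, RingOfIntegers.minpoly_coe]

/-- The square of the index of `ℤ[α]` times the discriminant of the field is the discriminant
of `α`. -/
theorem monoIndex_sq_mul_discr (h3 : finrank ℚ K = 3) (σ : Fin 3 ≃ (K →ₐ[ℚ] ℂ)) {α : 𝓞 K}
    (hα : ∀ n : ℤ, α ≠ n) :
    (monoIndex α : ℂ) ^ 2 * discr K =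
      ((σ 1 α - σ 0 α) * (σ 2 α - σ 0 α) * (σ 2 α - σ 1 α)) ^ 2 := by
  obtain ⟨b⟩ := exists_integral_basis_fin_three h3
  let pb := Algebra.adjoin.powerBasis' (RingOfIntegers.isIntegral α)
  have hdim : pb.dim = 3 := by
    rw [Algebra.adjoin.powerBasis'_dim, natDegree_minpoly_int_eq_three h3 hα]
  let bN := pb.basis.reindex (finCongr hdim)
  have hbN (i : Fin 3) : ((bN i : Algebra.adjoin ℤ {α}) : 𝓞 K) = α ^ (i : ℕ) := by
    simp only [bN, Basis.reindex_apply, pb.basis_eq_pow]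
    simp only [pb, SubmonoidClass.coe_pow, Algebra.adjoin.powerBasis'_gen]
    rfl
  let v : Fin 3 → 𝓞 K := fun i => α ^ (i : ℕ)
  have hidx : monoIndex α = (b.det v).natAbs := by
    have := AddSubgroup.index_eq_natAbs_det b
      (Algebra.adjoin ℤ ({α} : Set (𝓞 K))).toSubring.toAddSubgroup bN
    rw [monoIndex, this]
    congr 2
    ext1 i
    exact hbN i
  have hsq : (monoIndex α : ℂ) ^ 2 = ((b.toMatrix v).det : ℂ) ^ 2 := by
    rw [hidx, b.det_apply]
    rw [← Int.cast_natCast, ← Int.cast_pow, Int.natAbs_sq, Int.cast_pow]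
  have hvan : Matrix.vandermonde (fun i => σ i α) =
      (Matrix.of fun i j => σ i (b j : K)) * (b.toMatrix v).map (Int.castRingHom ℂ) := by
    ext i k
    have hk : α ^ (k : ℕ) = ∑ j, b.repr (α ^ (k : ℕ)) j • b j := (b.sum_repr _).symm
    rw [Matrix.vandermonde_apply, ← map_pow, ← map_pow, hk]
    simp [Matrix.mul_apply, Basis.toMatrix_apply, v, mul_comm]
  have hdet := congrArg Matrix.det hvan
  rw [Matrix.det_mul, ← RingHom.mapMatrix_apply, ← RingHom.map_det, Matrix.det_vandermonde] at hdet
  rw [hsq, discr_eq_det_sq_of_basis b σ, ← mul_pow, mul_comm]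
  rw [eq_intCast] at hdet
  rw [← hdet]
  congr 1
  simp [Fin.prod_univ_succ, Fin.Ioi_zero_eq_map, mul_assoc]

theorem monoIndex_pos (h3 : finrank ℚ K = 3) {α : 𝓞 K} (hα : ∀ n : ℤ, α ≠ n) :
    0 < monoIndex α := by
  obtain ⟨σ, -⟩ := exists_equiv_embeddings_conj h3
  have hinj := (Field.primitive_element_iff_algHom_eq_of_eval' ℚ ℂ
    (fun x => IsAlgClosed.splits _) (α : K)).1
    ((Field.primitive_element_iff_minpoly_natDegree_eq ℚ (α : K)).2
      ((natDegree_minpoly_rat_eq_three h3 hα).trans h3.symm))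
  have hne (i j : Fin 3) (hij : i ≠ j) : σ i α - σ j α ≠ 0 :=
    sub_ne_zero.2 fun h => hij (σ.injective (hinj h))
  refine Nat.pos_of_ne_zero fun h0 => ?_
  have h := monoIndex_sq_mul_discr h3 σ hα
  rw [h0, Nat.cast_zero, zero_pow two_ne_zero, zero_mul] at h
  exact pow_ne_zero 2 (mul_ne_zero (mul_ne_zero (hne 1 0 (by decide)) (hne 2 0 (by decide)))
    (hne 2 1 (by decide))) h.symm

theorem monoIndex_smul_add_int (h3 : finrank ℚ K = 3) {β : 𝓞 K} {m : ℕ} {c : ℤ}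
    (hα : ∀ n : ℤ, m • β + (c : 𝓞 K) ≠ n) :
    monoIndex (m • β + (c : 𝓞 K)) = m ^ 3 * monoIndex β := by
  have hβ (n : ℤ) : β ≠ n := by
    rintro rfl
    exact hα (m * n + c) (by simp)
  obtain ⟨σ, -⟩ := exists_equiv_embeddings_conj h3
  have hΔ : (discr K : ℂ) ≠ 0 := Int.cast_ne_zero.2 (discr_ne_zero K)
  have h : (monoIndex (m • β + (c : 𝓞 K)) : ℂ) ^ 2 = ((m ^ 3 * monoIndex β : ℕ) : ℂ) ^ 2 := by
    refine mul_right_cancel₀ hΔ ?_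
    rw [monoIndex_sq_mul_discr h3 σ hα]
    push_cast
    rw [mul_pow (_ ^ 3), mul_assoc (_ ^ 2), monoIndex_sq_mul_discr h3 σ hβ]
    simp
    ring
  exact (pow_left_inj₀ (Nat.zero_le _) (Nat.zero_le _) two_ne_zero).1 (by exact_mod_cast h)

/-- A cubic field contains a non-rational integer whose conjugates are close to each other. -/
theorem exists_norm_embedding_sub_le (h3 : finrank ℚ K = 3) :
    ∃ (σ : Fin 3 ≃ (K →ₐ[ℚ] ℂ)) (α : 𝓞 K), (∀ n : ℤ, α ≠ n) ∧ ∀ i j,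
      ‖σ i α - σ j α‖ ≤ 4 * |(discr K : ℝ)| ^ ((1 : ℝ) / 4) := by
  obtain ⟨σ, hσ⟩ := exists_equiv_embeddings_conj h3
  obtain ⟨b⟩ := exists_integral_basis_fin_three h3
  set t := |(discr K : ℝ)| ^ ((1 : ℝ) / 4) with ht
  have hΔ : 0 < |(discr K : ℝ)| := abs_pos.2 (Int.cast_ne_zero.2 (discr_ne_zero K))
  have htpos : 0 < t := Real.rpow_pos_of_pos hΔ _
  have ht4 : t ^ 4 = |(discr K : ℝ)| := by
    rw [ht, ← Real.rpow_natCast, ← Real.rpow_mul hΔ.le]; norm_num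
  set E : Matrix (Fin 3) (Fin 3) ℂ := Matrix.of fun i j => σ i (b j : K) with hE
  have hEdet : ‖E.det‖ = t ^ 2 := by
    have h := congrArg norm (discr_eq_det_sq_of_basis b σ)
    rw [norm_pow, Complex.norm_intCast, ← ht4, show t ^ 4 = (t ^ 2) ^ 2 by ring] at h
    exact ((pow_left_inj₀ (by positivity) (norm_nonneg _) two_ne_zero).1 h).symm
  obtain ⟨A, hAdet, hA⟩ := E.exists_real_forms_of_conj
    (hσ.imp (fun h i j => h i _) fun h j => h _)
  obtain ⟨x, hx0, hx⟩ := A.exists_int_abs_mulVec_lt ![3, 2 * t, 2 * t]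
    (abs_pos.1 (by rw [hAdet, hEdet]; positivity))
    (by intro i; fin_cases i <;> simp [htpos])
    (by
      rw [hAdet, hEdet]
      simp only [Fin.prod_univ_three, Matrix.cons_val]
      nlinarith [sq_pos_of_pos htpos])
  let α : 𝓞 K := ∑ j, x j • b j
  have hα (i : Fin 3) : (E.mulVec fun j => (((x j : ℤ) : ℝ) : ℂ)) i = σ i α := by
    simp [α, hE, Matrix.mulVec, dotProduct, mul_comm]
  obtain ⟨hsum, hdiff⟩ := hA fun j => (x j : ℝ)
  refine ⟨σ, α, fun n hn => ?_, fun i j => ?_⟩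
  · have h0 : |3 * (n : ℝ)| < 3 := by
      have h := hx 0
      rwa [show A.mulVec (fun j => (x j : ℝ)) 0 = 3 * (n : ℝ) by
        rw [← Complex.ofReal_inj, hsum]
        simp only [hα, hn]
        simp] at h
    have hn0 : n = 0 := by
      rw [← Int.abs_lt_one_iff]
      rw [abs_mul, abs_of_pos (zero_lt_three' ℝ)] at h0
      exact_mod_cast (by linarith : |(n : ℝ)| < 1)
    subst hn0
    refine hx0 (funext ?_)
    exact Fintype.linearIndependent_iff.1 b.linearIndependent x (hn.trans Int.cast_zero)
  · have := hdiff (2 * t) (hx 1).le (hx 2).le i j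
    rw [hα, hα] at this
    linarith

end Cubic

/-- Remark 12 of the paper: there is an absolute constant `C > 0`
such that every cubic field `K` is `n`-monogenized for some
`n ≤ C·|Δ(K)|^{1/4}`: there exists `α ∈ 𝓞 K`, primitive in `𝓞 K/ℤ`, with finite
index `[𝓞 K : ℤ[α]] ≤ C·|Δ(K)|^{1/4}`. -/
theorem exists_small_monogenizer :
    ∃ C : ℝ, 0 < C ∧
      ∀ (K : Type) [Field K] [NumberField K], Module.finrank ℚ K = 3 →
        ∃ α : 𝓞 K, PrimitiveModZ α ∧ 0 < monoIndex α ∧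
          (monoIndex α : ℝ) ≤ C * |(NumberField.discr K : ℝ)| ^ ((1 : ℝ) / 4) := by
  refine ⟨64, by norm_num, fun K _ _ h3 => ?_⟩
  obtain ⟨σ, α₀, hα₀, hdiff⟩ := exists_norm_embedding_sub_le (K := K) h3
  obtain ⟨α, hα, hmin⟩ := exists_minimalFor_of_wellFoundedLT
    (fun α : 𝓞 K => ∀ n : ℤ, α ≠ n) monoIndex ⟨α₀, hα₀⟩
  have hle : monoIndex α ≤ monoIndex α₀ := (le_total _ _).elim id fun h => hmin hα₀ h
  refine ⟨α, ?_, monoIndex_pos h3 hα, ?_⟩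
  · rintro ⟨m, β, c, hm, rfl⟩
    have hβ (n : ℤ) : β ≠ n := by
      rintro rfl
      exact hα (m * n + c) (by simp)
    have hpos := monoIndex_pos h3 hβ
    have hidx := monoIndex_smul_add_int h3 hα
    have hm3 : 2 ^ 3 ≤ m ^ 3 := Nat.pow_le_pow_left hm 3
    have := hmin hβ (by simp only [hidx]; nlinarith)
    simp only [hidx] at this
    nlinarith
  · refine (Nat.cast_le.2 hle).trans ?_
    set t := |(discr K : ℝ)| ^ ((1 : ℝ) / 4) with ht
    have hΔ : 0 < |(discr K : ℝ)| := abs_pos.2 (Int.cast_ne_zero.2 (discr_ne_zero K))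
    have htpos : 0 < t := Real.rpow_pos_of_pos hΔ _
    have ht4 : t ^ 4 = |(discr K : ℝ)| := by
      rw [ht, ← Real.rpow_natCast, ← Real.rpow_mul hΔ.le]; norm_num
    have h := congrArg norm (monoIndex_sq_mul_discr h3 σ hα₀)
    simp only [norm_mul, norm_pow, Complex.norm_natCast, Complex.norm_intCast] at h
    rw [← ht4] at h
    have hb : (monoIndex α₀ : ℝ) ^ 2 * t ^ 4 ≤ (4 * t * (4 * t) * (4 * t)) ^ 2 := by
      rw [h]
      gcongr <;> exact hdiff _ _
    have hb' : (monoIndex α₀ : ℝ) ^ 2 ≤ (64 * t) ^ 2 := by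
      refine le_of_mul_le_mul_right (hb.trans_eq ?_) (pow_pos htpos 4)
      ring
    exact (pow_le_pow_iff_left₀ (Nat.cast_nonneg _) (by positivity) two_ne_zero).1 hb'
end
end

section
/- For all real X, Y ≥ 1 and every ε > 0, the number of integer binary cubic forms f = ax³ + bx²y + cxy² + dy³ that lie in F_U^±(Y; X) and are not generic is O_ε(X^{1/2+ε}·Y), where the implied constant depends only on ε (and not on X, Y). -/
/-!
Statement 10: the number of non-generic integer binary cubic forms in the box
`F_U^±(Y; X)` is `O_ε(X^{1/2+ε}·Y)`.
-/

open Polynomial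

noncomputable section

/-- The discriminant of the binary cubic form `ax³ + bx²y + cxy² + dy³`. -/
def discForm (a b c d : ℤ) : ℤ :=
  b ^ 2 * c ^ 2 - 4 * a * c ^ 3 - 4 * b ^ 3 * d - 27 * a ^ 2 * d ^ 2
    + 18 * a * b * c * d

/-- The invariant `I(f) = b² - 3ac`. -/
def Iform (a b c d : ℤ) : ℤ := b ^ 2 - 3 * a * c

/-- The invariant `J(f) = -2b³ + 9abc - 27a²d`. -/
def Jform (a b c d : ℤ) : ℤ :=
  -2 * b ^ 3 + 9 * a * b * c - 27 * a ^ 2 * d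

/-- The height `H(f) = a⁻²·max{|I(f)|³, J(f)²/4}`. -/
def htForm (a b c d : ℤ) : ℝ :=
  ((a : ℝ) ^ 2)⁻¹ * max (|(Iform a b c d : ℝ)| ^ 3) ((Jform a b c d : ℝ) ^ 2 / 4)

/-- The dehomogenization `f(x, 1)` of the form, as a polynomial over `ℚ`. -/
def cubicPoly (a b c d : ℤ) : ℚ[X] :=
  C (a : ℚ) * X ^ 3 + C (b : ℚ) * X ^ 2 + C (c : ℚ) * X + C (d : ℚ)

/-- A form is generic if it is irreducible over `ℚ` and the Galois group of its
splitting field is `S₃`, i.e. its splitting field has degree 6. -/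
def GenericForm (a b c d : ℤ) : Prop :=
  Irreducible (cubicPoly a b c d) ∧
    Module.finrank ℚ (cubicPoly a b c d).SplittingField = 6

/-- The syzygy between the covariant leading coefficients and the discriminant. -/
theorem four_mul_Iform_cube_sub (a b c d : ℤ) :
    4 * Iform a b c d ^ 3 - Jform a b c d ^ 2 = 27 * a ^ 2 * discForm a b c d := by
  unfold Iform Jform discForm
  ring

theorem cubicPoly_eq_toPoly (a b c d : ℤ) :
    cubicPoly a b c d = (⟨a, b, c, d⟩ : Cubic ℚ).toPoly := rfl

theorem natDegree_cubicPoly {a : ℤ} (ha : a ≠ 0) (b c d : ℤ) :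
    (cubicPoly a b c d).natDegree = 3 := by
  rw [cubicPoly_eq_toPoly]
  exact Cubic.natDegree_of_a_ne_zero' (by exact_mod_cast ha)

/-- A cubic over `ℚ` that is not irreducible has a rational root, in lowest terms. -/
theorem exists_coprime_root_of_not_irreducible {a b c d : ℤ} (ha : a ≠ 0)
    (h : ¬ Irreducible (cubicPoly a b c d)) :
    ∃ p r : ℤ, 0 < r ∧ IsCoprime p r ∧
      a * p ^ 3 + b * p ^ 2 * r + c * p * r ^ 2 + d * r ^ 3 = 0 := by
  have hdeg := natDegree_cubicPoly ha b c d
  rw [Polynomial.irreducible_iff_roots_eq_zero_of_degree_le_three (by omega) (by omega)] at h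
  obtain ⟨x, hx⟩ := Multiset.exists_mem_of_ne_zero h
  have hroot := (Polynomial.mem_roots'.1 hx).2
  refine ⟨x.num, x.den, by exact_mod_cast x.den_pos, ?_, ?_⟩
  · rw [Int.isCoprime_iff_gcd_eq_one]
    simpa [Int.gcd] using x.reduced
  · have hd : (x.den : ℚ) ≠ 0 := by exact_mod_cast x.den_ne_zero
    have hxe : x = x.num / x.den := (Rat.num_div_den x).symm
    simp only [cubicPoly, Polynomial.IsRoot, Polynomial.eval_add, Polynomial.eval_mul,
      Polynomial.eval_C, Polynomial.eval_pow, Polynomial.eval_X] at hroot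
    generalize x.num = p at *
    generalize x.den = r at *
    subst hxe
    field_simp at hroot
    have : ((a * p ^ 3 + b * p ^ 2 * r + c * p * r ^ 2 + d * r ^ 3 : ℤ) : ℚ) = 0 := by
      push_cast
      linarith
    exact_mod_cast this

/-- The splitting field of an irreducible rational cubic with nonsquare discriminant
has degree `6`. -/
theorem finrank_splittingField_eq_six {a b c d : ℤ} (ha : a ≠ 0)
    (h : Irreducible (cubicPoly a b c d)) (hsq : ¬ IsSquare (discForm a b c d)) :
    Module.finrank ℚ (cubicPoly a b c d).SplittingField = 6 := by
  set f := cubicPoly a b c d with hf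
  have hdeg : f.natDegree = 3 := natDegree_cubicPoly ha b c d
  have hcard := Polynomial.Gal.card_of_separable h.separable
  have h3 : 3 ∣ Module.finrank ℚ f.SplittingField := by
    rw [← hcard, ← hdeg]
    exact Polynomial.Gal.prime_degree_dvd_card h (by rw [hdeg]; exact Nat.prime_three)
  have hle : Module.finrank ℚ f.SplittingField ≤ 6 := by
    classical
    rw [← hcard]
    have : Fact ((f.map (algebraMap ℚ f.SplittingField)).Splits) :=
      ⟨Polynomial.SplittingField.splits f⟩
    have hinj := Polynomial.Gal.galActionHom_injective f f.SplittingField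
    have h1 := Nat.card_le_card_of_injective _ hinj
    refine h1.trans ?_
    have h2 : Nat.card (f.rootSet f.SplittingField) = 3 := by
      rw [← hdeg, ← Polynomial.card_rootSet_eq_natDegree h.separable
        (Polynomial.SplittingField.splits f)]
      exact Nat.card_eq_fintype_card
    rw [Nat.card_perm, h2]
    decide
  have h2 : 2 ∣ Module.finrank ℚ f.SplittingField := by
    let P : Cubic ℚ := ⟨a, b, c, d⟩
    have hPa : P.a ≠ 0 := by change (a : ℚ) ≠ 0; exact_mod_cast ha
    obtain ⟨x, y, z, hxyz⟩ := (Cubic.splits_iff_roots_eq_three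
      (φ := algebraMap ℚ f.SplittingField) hPa).1 (Polynomial.SplittingField.splits f)
    have hdisc := Cubic.discr_eq_prod_three_roots hPa hxyz
    set δ := (algebraMap ℚ f.SplittingField) P.a * (algebraMap ℚ f.SplittingField) P.a *
      (x - y) * (x - z) * (y - z)
    have hP : P.discr = (discForm a b c d : ℚ) := by
      simp only [Cubic.discr, discForm, P]
      push_cast
      ring
    have hirr : Irreducible (Polynomial.X ^ 2 - Polynomial.C P.discr) := by
      apply X_pow_sub_C_irreducible_of_prime Nat.prime_two
      intro q hq
      apply hsq
      rw [hP] at hq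
      exact Rat.isSquare_intCast_iff.1 ⟨q, by rw [← hq]; ring⟩
    have hmin : minpoly ℚ δ = Polynomial.X ^ 2 - Polynomial.C P.discr := by
      refine (minpoly.eq_of_irreducible_of_monic hirr ?_
        (Polynomial.monic_X_pow_sub_C _ two_ne_zero)).symm
      simp [hdisc]
    have := minpoly.degree_dvd (K := ℚ) (x := δ) (Algebra.IsIntegral.isIntegral δ)
    rw [hmin, Polynomial.natDegree_X_pow_sub_C] at this
    exact this
  have hpos : 0 < Module.finrank ℚ f.SplittingField := Module.finrank_pos
  omega

/-- A nongeneric form has a rational root or a square discriminant. -/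
theorem root_or_isSquare_of_not_genericForm {a b c d : ℤ} (ha : a ≠ 0)
    (h : ¬ GenericForm a b c d) :
    (∃ p r : ℤ, 0 < r ∧ IsCoprime p r ∧
      a * p ^ 3 + b * p ^ 2 * r + c * p * r ^ 2 + d * r ^ 3 = 0) ∨
    IsSquare (discForm a b c d) := by
  by_cases hirr : Irreducible (cubicPoly a b c d)
  · right
    by_contra hsq
    exact h ⟨hirr, finrank_splittingField_eq_six ha hirr hsq⟩
  · exact Or.inl (exists_coprime_root_of_not_irreducible ha hirr)

/-- If `-s / r` is a root in lowest terms, the form factors over `ℤ`. -/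
theorem exists_factor_of_root {a b c d p r : ℤ} (hr : 0 < r) (hpr : IsCoprime p r)
    (h : a * p ^ 3 + b * p ^ 2 * r + c * p * r ^ 2 + d * r ^ 3 = 0) :
    ∃ s u v w : ℤ, a = r * u ∧ b = r * v + s * u ∧ c = r * w + s * v ∧ d = s * w := by
  obtain ⟨u, rfl⟩ : r ∣ a := by
    have : r ∣ p ^ 3 * a := ⟨-(b * p ^ 2 + c * p * r + d * r ^ 2), by linear_combination h⟩
    exact (hpr.symm.pow_right (n := 3)).dvd_of_dvd_mul_left this
  have h1 : u * p ^ 3 + b * p ^ 2 + c * p * r + d * r ^ 2 = 0 := by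
    apply mul_left_cancel₀ hr.ne'
    linear_combination h
  obtain ⟨v, hv⟩ : r ∣ b + p * u := by
    have : r ∣ p ^ 2 * (b + p * u) := ⟨-(c * p + d * r), by linear_combination h1⟩
    exact (hpr.symm.pow_right (n := 2)).dvd_of_dvd_mul_left this
  have h2 : v * p ^ 2 + c * p + d * r = 0 := by
    apply mul_left_cancel₀ hr.ne'
    linear_combination h1 - p ^ 2 * hv
  obtain ⟨w, hw⟩ : r ∣ c + p * v := by
    have : r ∣ p * (c + p * v) := ⟨-d, by linear_combination h2⟩
    exact hpr.symm.dvd_of_dvd_mul_left this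
  refine ⟨-p, u, v, w, rfl, by linear_combination hv, by linear_combination hw, ?_⟩
  apply mul_left_cancel₀ hr.ne'
  linear_combination h2 - p * hw

/-- The divisor bound `d(n) ≪ n ^ ε`. -/
theorem exists_card_divisors_le_rpow (ε : ℝ) (hε : 0 < ε) :
    ∃ C : ℝ, 1 ≤ C ∧ ∀ n : ℕ, n ≠ 0 → (n.divisors.card : ℝ) ≤ C * (n : ℝ) ^ ε := by
  obtain ⟨A, hA⟩ : ∃ A : ℕ, (2 : ℝ) ≤ (A : ℝ) ^ ε := by
    have h := (tendsto_rpow_atTop hε).comp tendsto_natCast_atTop_atTop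
    exact (h.eventually (Filter.eventually_ge_atTop 2)).exists
  -- `k + 1 ≤ B * 2 ^ (kε)`
  obtain ⟨B, hB1, hB⟩ : ∃ B : ℝ, 1 ≤ B ∧ ∀ k : ℕ, (k : ℝ) + 1 ≤ B * ((2 : ℝ) ^ ε) ^ k := by
    have hlog : 0 < Real.log 2 := Real.log_pos one_lt_two
    refine ⟨1 + 1 / (ε * Real.log 2), by
      have : 0 < 1 / (ε * Real.log 2) := by positivity
      linarith, fun k => ?_⟩
    have h1 : (1 : ℝ) + k * (ε * Real.log 2) ≤ ((2 : ℝ) ^ ε) ^ k := by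
      rw [Real.rpow_def_of_pos two_pos, ← Real.exp_nat_mul]
      have := Real.add_one_le_exp (k * (Real.log 2 * ε))
      linarith
    have hpos : 0 < ε * Real.log 2 := by positivity
    have h2 : (k : ℝ) + 1 ≤ (1 + 1 / (ε * Real.log 2)) * (1 + k * (ε * Real.log 2)) := by
      have e : (1 + 1 / (ε * Real.log 2)) * (1 + k * (ε * Real.log 2))
          = k + 1 + (k * (ε * Real.log 2) + 1 / (ε * Real.log 2)) := by
        field_simp
        ring
      rw [e]
      have : 0 ≤ (k * (ε * Real.log 2) + 1 / (ε * Real.log 2)) := by positivity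
      linarith
    exact h2.trans (mul_le_mul_of_nonneg_left h1 (by positivity))
  refine ⟨B ^ A, one_le_pow₀ hB1, fun n hn => ?_⟩
  have hterm : ∀ p ∈ n.primeFactors, ((n.factorization p : ℝ) + 1) ≤
      (if p < A then B else 1) * ((p : ℝ) ^ ε) ^ n.factorization p := by
    intro p hp
    have hp2 : (2 : ℝ) ≤ p := by exact_mod_cast (Nat.prime_of_mem_primeFactors hp).two_le
    split_ifs with h
    · refine (hB _).trans ?_
      gcongr
    · have h2 : (2 : ℝ) ≤ (p : ℝ) ^ ε := by
        refine hA.trans ?_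
        have : (A : ℝ) ≤ p := by exact_mod_cast not_lt.1 h
        gcongr
      rw [one_mul]
      refine le_trans ?_ (pow_le_pow_left₀ (by norm_num) h2 _)
      have := one_add_mul_le_pow (a := (1 : ℝ)) (by norm_num) (n.factorization p)
      norm_num at this
      linarith
  rw [Nat.card_divisors hn]
  push_cast
  calc ∏ p ∈ n.primeFactors, ((n.factorization p : ℝ) + 1)
      ≤ ∏ p ∈ n.primeFactors, ((if p < A then B else 1) *
          ((p : ℝ) ^ ε) ^ n.factorization p) :=
        Finset.prod_le_prod (fun _ _ => by positivity) hterm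
    _ = (∏ p ∈ n.primeFactors, (if p < A then B else 1)) *
          ∏ p ∈ n.primeFactors, ((p : ℝ) ^ ε) ^ n.factorization p := Finset.prod_mul_distrib
    _ ≤ B ^ A * (n : ℝ) ^ ε := by
        refine mul_le_mul ?_ (le_of_eq ?_) (by positivity) (by positivity)
        · rw [Finset.prod_ite, Finset.prod_const, Finset.prod_const_one, mul_one]
          refine pow_le_pow_right₀ hB1 ?_
          calc (n.primeFactors.filter (· < A)).card ≤ (Finset.range A).card :=
                Finset.card_le_card fun p hp => by
                  simpa using (Finset.mem_filter.1 hp).2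
            _ = A := Finset.card_range A
        · conv_rhs => rw [← Nat.prod_factorization_pow_eq_self hn]
          rw [Finsupp.prod, Nat.support_factorization]
          push_cast
          rw [← Real.finsetProd_rpow _ _ (fun _ _ => by positivity)]
          refine Finset.prod_congr rfl fun p _ => ?_
          rw [← Real.rpow_natCast, ← Real.rpow_mul (by positivity), mul_comm,
            Real.rpow_mul (by positivity), Real.rpow_natCast]

/-- Integers in `[0, g * m)` lying in one residue class modulo `m`. -/
theorem card_le_of_forall_dvd_sub {S : Finset ℤ} {g m : ℕ} (hm : 0 < m)
    (hS : ∀ z ∈ S, 0 ≤ z ∧ z < g * m) (hdvd : ∀ x ∈ S, ∀ y ∈ S, (m : ℤ) ∣ x - y) :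
    S.card ≤ g := by
  have hm' : (0 : ℤ) < m := by exact_mod_cast hm
  have : S.card ≤ (Finset.Ico (0 : ℤ) g).card := by
    refine Finset.card_le_card_of_injOn (fun z => z / m) ?_ ?_
    · intro z hz
      obtain ⟨h0, h1⟩ := hS z hz
      simp only [Finset.coe_Ico, Set.mem_Ico]
      exact ⟨Int.ediv_nonneg h0 hm'.le, Int.ediv_lt_of_lt_mul hm' h1⟩
    · intro x hx y hy hxy
      have hmod : x % m = y % m := ((Int.modEq_iff_dvd).2 (hdvd x hx y hy)).symm
      simp only at hxy
      rw [← Int.mul_ediv_add_emod x m, ← Int.mul_ediv_add_emod y m, hxy, hmod]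
  simpa using this

/-- The number of square roots of `A` modulo `n`. -/
theorem card_sq_roots_le {n : ℕ} (hn : 0 < n) (A : ℤ) (G : ℕ)
    (hG : ∀ g : ℕ, g ^ 2 ∣ n → ((g ^ 2 : ℕ) : ℤ) ∣ 4 * A → g ≤ G) :
    ((Finset.Ico (0 : ℤ) n).filter (fun z => (n : ℤ) ∣ z ^ 2 - A)).card
      ≤ n.divisors.card * G := by
  classical
  set S := (Finset.Ico (0 : ℤ) n).filter (fun z => (n : ℤ) ∣ z ^ 2 - A) with hSdef
  rcases S.eq_empty_or_nonempty with hS | ⟨x, hx⟩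
  · simp [hS]
  let T : ℕ → Finset ℤ := fun d => S.filter (fun z => (d : ℤ) ∣ z - x ∧ ((n / d : ℕ) : ℤ) ∣ z + x)
  have hcover : S ⊆ n.divisors.biUnion T := by
    intro z hz
    have hz' := (Finset.mem_filter.1 hz).2
    have hx' := (Finset.mem_filter.1 hx).2
    have hprod : (n : ℤ) ∣ (z - x) * (z + x) := by
      have e : (z - x) * (z + x) = (z ^ 2 - A) - (x ^ 2 - A) := by ring
      rw [e]
      exact dvd_sub hz' hx'
    rw [Finset.mem_biUnion]
    refine ⟨Int.gcd n (z - x), ?_, ?_⟩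
    · rw [Nat.mem_divisors]
      exact ⟨by exact_mod_cast Int.gcd_dvd_left (n : ℤ) (z - x), hn.ne'⟩
    · rw [Finset.mem_filter]
      refine ⟨hz, Int.gcd_dvd_right _ _, ?_⟩
      have hgpos : 0 < Int.gcd n (z - x) := Int.gcd_pos_of_ne_zero_left _ (by exact_mod_cast hn.ne')
      have hcop := Int.isCoprime_iff_gcd_eq_one.2 (Int.gcd_div_gcd_div_gcd hgpos)
      have hgn : ((Int.gcd n (z - x) : ℕ) : ℤ) ∣ n := Int.gcd_dvd_left _ _
      have hgz : ((Int.gcd n (z - x) : ℕ) : ℤ) ∣ z - x := Int.gcd_dvd_right _ _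
      rw [Int.natCast_div]
      refine hcop.dvd_of_dvd_mul_left ?_
      obtain ⟨k, hk⟩ := hprod
      refine ⟨k, ?_⟩
      have hg0 : ((Int.gcd n (z - x) : ℕ) : ℤ) ≠ 0 := by exact_mod_cast hgpos.ne'
      apply mul_left_cancel₀ hg0
      rw [← mul_assoc, ← mul_assoc, Int.mul_ediv_cancel' hgz, Int.mul_ediv_cancel' hgn, hk]
  have hT : ∀ d ∈ n.divisors, (T d).card ≤ G := by
    intro d hd
    have hdn : d ∣ n := (Nat.mem_divisors.1 hd).1
    obtain ⟨e, rfl⟩ := hdn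
    have hd0 : 0 < d := Nat.pos_of_mul_pos_right hn
    have hde : d * e / d = e := Nat.mul_div_cancel_left e hd0
    rcases (T d).eq_empty_or_nonempty with hTe | ⟨y, hy⟩
    · simp [hTe]
    simp only [T, hde, Finset.mem_filter] at hy
    obtain ⟨-, hy1, hy2⟩ := hy
    have hlg : Nat.gcd d e * Nat.lcm d e = d * e := Nat.gcd_mul_lcm d e
    have hlpos : 0 < Nat.lcm d e := Nat.pos_of_mul_pos_left (hlg ▸ hn)
    have h1 : (T d).card ≤ Nat.gcd d e := by
      refine card_le_of_forall_dvd_sub hlpos (fun z hz => ?_) (fun z hz z' hz' => ?_)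
      · have := (Finset.mem_filter.1 (Finset.mem_filter.1 hz).1).1
        rw [Finset.mem_Ico] at this
        have h3 : ((Nat.gcd d e : ℤ)) * (Nat.lcm d e : ℕ) = (d * e : ℕ) := by exact_mod_cast hlg
        rw [h3]
        exact this
      · simp only [T, hde, Finset.mem_filter] at hz hz'
        have a1 : (d : ℤ) ∣ z - z' := by
          have := dvd_sub hz.2.1 hz'.2.1
          simpa using this
        have a2 : (e : ℤ) ∣ z - z' := by
          have := dvd_sub hz.2.2 hz'.2.2
          simpa using this
        have := Nat.lcm_dvd (Int.natCast_dvd.1 a1) (Int.natCast_dvd.1 a2)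
        exact Int.natCast_dvd.2 this
    refine h1.trans (hG _ ?_ ?_)
    · rw [pow_two]
      exact mul_dvd_mul (Nat.gcd_dvd_left _ _) (Nat.gcd_dvd_right _ _)
    · have g1 : ((Nat.gcd d e : ℕ) : ℤ) ∣ d := by exact_mod_cast Nat.gcd_dvd_left d e
      have g2 : ((Nat.gcd d e : ℕ) : ℤ) ∣ e := by exact_mod_cast Nat.gcd_dvd_right d e
      have g3 : ((Nat.gcd d e : ℕ) : ℤ) ∣ 2 * x := by
        have e : 2 * x = (y + x) - (y - x) := by ring
        rw [e]
        exact dvd_sub (g2.trans hy2) (g1.trans hy1)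
      have g4 : (((Nat.gcd d e) ^ 2 : ℕ) : ℤ) ∣ (2 * x) ^ 2 := by
        push_cast
        exact pow_dvd_pow_of_dvd g3 2
      have g5 : (((Nat.gcd d e) ^ 2 : ℕ) : ℤ) ∣ x ^ 2 - A := by
        refine dvd_trans ?_ (Finset.mem_filter.1 hx).2
        push_cast
        rw [pow_two]
        exact mul_dvd_mul g1 g2
      have e : 4 * A = (2 * x) ^ 2 - 4 * (x ^ 2 - A) := by ring
      rw [e]
      exact dvd_sub g4 (dvd_mul_of_dvd_right g5 4)
  calc S.card ≤ (n.divisors.biUnion T).card := Finset.card_le_card hcover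
    _ ≤ n.divisors.card * G := Finset.card_biUnion_le_card_mul _ _ _ hT

/-- Primitive representations of `n` by `x² + 3y²`. -/
theorem card_primitive_reps_le {n : ℕ} (hn : 0 < n) (S : Finset (ℤ × ℤ))
    (hS : ∀ p ∈ S, p.1 ^ 2 + 3 * p.2 ^ 2 = n) (hcop : ∀ p ∈ S, IsCoprime p.1 p.2) :
    S.card ≤ 4 * n.divisors.card := by
  classical
  have hn' : (0 : ℤ) < n := by exact_mod_cast hn
  have hyn : ∀ p ∈ S, IsCoprime p.2 (n : ℤ) := by
    intro p hp
    rw [← hS p hp]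
    have h1 : IsCoprime p.2 (p.1 ^ 2) := (hcop p hp).symm.pow_right
    have h2 := h1.add_mul_left_right (3 * p.2)
    rwa [show p.2 * (3 * p.2) = 3 * p.2 ^ 2 by ring] at h2
  have hz : ∀ p : ℤ × ℤ, ∃ z : ℤ, p ∈ S →
      z ∈ Finset.Ico (0 : ℤ) n ∧ (n : ℤ) ∣ z * p.2 - p.1 := by
    intro p
    by_cases hp : p ∈ S
    · obtain ⟨u, v, huv⟩ := hyn p hp
      refine ⟨(p.1 * u) % n, fun _ => ⟨?_, ?_⟩⟩
      · rw [Finset.mem_Ico]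
        exact ⟨Int.emod_nonneg _ hn'.ne', Int.emod_lt_of_pos _ hn'⟩
      · refine ⟨-(p.1 * v) - p.1 * u / n * p.2, ?_⟩
        have := Int.mul_ediv_add_emod (p.1 * u) n
        linear_combination p.2 * this + p.1 * huv
    · exact ⟨0, fun h => absurd h hp⟩
  choose z hz using hz
  have hroots := card_sq_roots_le hn (-3) 2 (by
    intro g _ hg
    have h12 : g ^ 2 ∣ 12 := by
      have : ((g ^ 2 : ℕ) : ℤ) ∣ ((12 : ℕ) : ℤ) := by
        have := (dvd_neg (α := ℤ)).2 hg
        simpa using this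
      exact_mod_cast this
    have : g ≤ 3 := by
      have := Nat.le_of_dvd (by norm_num) h12
      nlinarith
    interval_cases g <;> revert h12 <;> decide)
  have himg : S.image z ⊆
      (Finset.Ico (0 : ℤ) n).filter (fun z => (n : ℤ) ∣ z ^ 2 - -3) := by
    intro w hw
    obtain ⟨p, hp, rfl⟩ := Finset.mem_image.1 hw
    obtain ⟨h1, k, hk⟩ := hz p hp
    refine Finset.mem_filter.2 ⟨h1, ?_⟩
    refine ((hyn p hp).symm.pow_right (n := 2)).dvd_of_dvd_mul_right ?_
    refine ⟨k * (z p * p.2 + p.1) + 1, ?_⟩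
    linear_combination (z p * p.2 + p.1) * hk + hS p hp
  have hfib : ∀ w ∈ S.image z, (S.filter (fun p => z p = w)).card ≤ 2 := by
    intro w hw
    obtain ⟨p, hp, rfl⟩ := Finset.mem_image.1 hw
    refine (Finset.card_le_card (t := {p, -p}) ?_).trans Finset.card_le_two
    intro q hq
    obtain ⟨hq, hqp⟩ := Finset.mem_filter.1 hq
    obtain ⟨-, k, hk⟩ := hz p hp
    obtain ⟨-, l, hl⟩ := hz q hq
    rw [hqp] at hl
    have ep := hS p hp
    have eq := hS q hq
    set w := z p
    obtain ⟨V, hV⟩ : (n : ℤ) ∣ p.1 * q.2 - q.1 * p.2 :=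
      ⟨l * p.2 - k * q.2, by linear_combination p.2 * hl - q.2 * hk⟩
    obtain ⟨m, hm⟩ : (n : ℤ) ∣ w ^ 2 + 3 := by
      have := (Finset.mem_filter.1 (himg hw)).2
      simpa using this
    obtain ⟨U, hU⟩ : (n : ℤ) ∣ p.1 * q.1 + 3 * p.2 * q.2 :=
      ⟨p.2 * q.2 * m - w * p.2 * l - q.1 * k,
        by linear_combination p.2 * q.2 * hm - w * p.2 * hl - q.1 * hk⟩
    have hUV : U ^ 2 + 3 * V ^ 2 = 1 := by
      have hn2 : (n : ℤ) ^ 2 ≠ 0 := by positivity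
      apply mul_left_cancel₀ hn2
      linear_combination -(p.1 * q.1 + 3 * p.2 * q.2 + n * U) * hU -
        3 * (p.1 * q.2 - q.1 * p.2 + n * V) * hV + (q.1 ^ 2 + 3 * q.2 ^ 2) * ep + n * eq
    have hV0 : V = 0 := by
      by_contra hne
      have : 0 < V ^ 2 := by positivity
      nlinarith [sq_nonneg U]
    subst hV0
    have hq1 : q.1 = U * p.1 := by
      apply mul_left_cancel₀ hn'.ne'
      linear_combination p.1 * hU - 3 * p.2 * hV - q.1 * ep
    have hq2 : q.2 = U * p.2 := by
      apply mul_left_cancel₀ hn'.ne'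
      linear_combination p.2 * hU + p.1 * hV - q.2 * ep
    have hU1 : U = 1 ∨ U = -1 :=
      (sq_eq_sq_iff_eq_or_eq_neg.1 (by simpa using hUV))
    rw [Finset.mem_insert, Finset.mem_singleton]
    rcases hU1 with rfl | rfl
    · left
      ext <;> simp [hq1, hq2]
    · right
      ext <;> simp [hq1, hq2]
  calc S.card ≤ 2 * (S.image z).card := Finset.card_le_mul_card_image S 2 hfib
    _ ≤ 2 * (n.divisors.card * 2) := by
        gcongr
        exact (Finset.card_le_card himg).trans hroots
    _ = 4 * n.divisors.card := by ring

/-- Representations of `n` by `x² + 3y²`. -/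
theorem card_reps_le {n : ℕ} (hn : 0 < n) (S : Finset (ℤ × ℤ))
    (hS : ∀ p ∈ S, p.1 ^ 2 + 3 * p.2 ^ 2 = n) :
    S.card ≤ 4 * n.divisors.card ^ 2 := by
  classical
  have hcover : S ⊆ n.divisors.biUnion (fun g => S.filter (fun p => Int.gcd p.1 p.2 = g)) := by
    intro p hp
    rw [Finset.mem_biUnion]
    refine ⟨Int.gcd p.1 p.2, ?_, Finset.mem_filter.2 ⟨hp, rfl⟩⟩
    rw [Nat.mem_divisors]
    refine ⟨?_, hn.ne'⟩
    have : ((Int.gcd p.1 p.2 : ℕ) : ℤ) ∣ n := by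
      rw [← hS p hp]
      exact dvd_add ((Int.gcd_dvd_left _ _).trans (dvd_pow_self _ two_ne_zero))
        (dvd_mul_of_dvd_right ((Int.gcd_dvd_right _ _).trans (dvd_pow_self _ two_ne_zero)) _)
    exact_mod_cast this
  have hfib : ∀ g ∈ n.divisors,
      (S.filter (fun p => Int.gcd p.1 p.2 = g)).card ≤ 4 * n.divisors.card := by
    intro g hg
    set T := S.filter (fun p => Int.gcd p.1 p.2 = g) with hT
    rcases T.eq_empty_or_nonempty with hTe | ⟨q, hq⟩
    · simp [hTe]
    have hgpos : 0 < g := Nat.pos_of_mem_divisors hg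
    have hg0 : (g : ℤ) ≠ 0 := by exact_mod_cast hgpos.ne'
    have hmul : ∀ p ∈ T, p.1 = g * (p.1 / g) ∧ p.2 = g * (p.2 / g) ∧
        IsCoprime (p.1 / (g : ℤ)) (p.2 / g) ∧ p.1 ^ 2 + 3 * p.2 ^ 2 = n := by
      intro p hp
      obtain ⟨hpS, hpg⟩ := Finset.mem_filter.1 hp
      refine ⟨?_, ?_, ?_, hS p hpS⟩
      · exact (Int.mul_ediv_cancel' (hpg ▸ Int.gcd_dvd_left _ _)).symm
      · exact (Int.mul_ediv_cancel' (hpg ▸ Int.gcd_dvd_right _ _)).symm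
      · rw [Int.isCoprime_iff_gcd_eq_one, ← hpg]
        exact Int.gcd_div_gcd_div_gcd (hpg ▸ hgpos)
    obtain ⟨m, rfl⟩ : g ^ 2 ∣ n := by
      obtain ⟨h1, h2, -, h3⟩ := hmul q hq
      have : ((g ^ 2 : ℕ) : ℤ) ∣ (n : ℤ) :=
        ⟨(q.1 / g) ^ 2 + 3 * (q.2 / g) ^ 2, by
          rw [← h3]
          push_cast
          nth_rewrite 1 [h1]
          nth_rewrite 1 [h2]
          ring⟩
      exact_mod_cast this
    have hm : 0 < m := Nat.pos_of_mul_pos_left hn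
    let φ : ℤ × ℤ → ℤ × ℤ := fun p => (p.1 / g, p.2 / g)
    have hinj : Set.InjOn φ T := by
      intro p hp q hq hpq
      simp only [φ, Prod.mk.injEq] at hpq
      ext
      · rw [(hmul p hp).1, (hmul q hq).1, hpq.1]
      · rw [(hmul p hp).2.1, (hmul q hq).2.1, hpq.2]
    rw [← Finset.card_image_of_injOn hinj]
    have := card_primitive_reps_le hm (T.image φ) (by
      intro p hp
      obtain ⟨q, hq, rfl⟩ := Finset.mem_image.1 hp
      obtain ⟨h1, h2, -, h3⟩ := hmul q hq
      simp only [φ]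
      have hg2 : (g : ℤ) ^ 2 ≠ 0 := pow_ne_zero _ hg0
      apply mul_left_cancel₀ hg2
      push_cast at h3
      linear_combination h3 - (q.1 + g * (q.1 / g)) * h1 - 3 * (q.2 + g * (q.2 / g)) * h2) (by
      intro p hp
      obtain ⟨q, hq, rfl⟩ := Finset.mem_image.1 hp
      exact (hmul q hq).2.2.1)
    refine this.trans ?_
    exact Nat.mul_le_mul_left 4
      (Finset.card_le_card (Nat.divisors_subset_of_dvd hn.ne' (dvd_mul_left m (g ^ 2))))
  calc S.card ≤ _ := Finset.card_le_card hcover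
    _ ≤ n.divisors.card * (4 * n.divisors.card) := Finset.card_biUnion_le_card_mul _ _ _ hfib
    _ = 4 * n.divisors.card ^ 2 := by ring

/-- Counting through a relation that is total and injective on `S`. -/
theorem finite_and_ncard_le_card_of_rel {α β : Type*} {S : Set α} {T : Finset β}
    (R : α → β → Prop) (htot : ∀ x ∈ S, ∃ t ∈ T, R x t)
    (hinj : ∀ x ∈ S, ∀ y ∈ S, ∀ t, R x t → R y t → x = y) :
    S.Finite ∧ S.ncard ≤ T.card := by
  rcases S.eq_empty_or_nonempty with rfl | ⟨x₀, hx₀⟩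
  · simp
  obtain ⟨t₀, -⟩ := htot x₀ hx₀
  have h : ∀ x, ∃ t, x ∈ S → t ∈ T ∧ R x t := by
    intro x
    by_cases hx : x ∈ S
    · obtain ⟨t, ht⟩ := htot x hx
      exact ⟨t, fun _ => ht⟩
    · exact ⟨t₀, fun h => absurd h hx⟩
  choose f hf using h
  have hmaps : ∀ x ∈ S, f x ∈ (T : Set β) := fun x hx => (hf x hx).1
  have hfi : Set.InjOn f S := fun x hx y hy hxy =>
    hinj x hx y hy (f x) (hf x hx).2 (hxy ▸ (hf y hy).2)
  refine ⟨Set.Finite.of_injOn hmaps hfi T.finite_toSet, ?_⟩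
  rw [← Set.ncard_coe_finset]
  exact Set.ncard_le_ncard_of_injOn f hmaps hfi T.finite_toSet

/-- A form with positive leading coefficient is determined by `a`, `b`, `I` and `J`. -/
theorem form_eq_of_invariants_eq {t t' : ℤ × ℤ × ℤ × ℤ} (ha : 0 < t.1)
    (h1 : t.1 = t'.1) (h2 : t.2.1 = t'.2.1)
    (hI : Iform t.1 t.2.1 t.2.2.1 t.2.2.2 = Iform t'.1 t'.2.1 t'.2.2.1 t'.2.2.2)
    (hJ : Jform t.1 t.2.1 t.2.2.1 t.2.2.2 = Jform t'.1 t'.2.1 t'.2.2.1 t'.2.2.2) :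
    t = t' := by
  obtain ⟨a, b, c, d⟩ := t
  obtain ⟨a', b', c', d'⟩ := t'
  simp only at *
  subst h1 h2
  unfold Iform at hI
  unfold Jform at hJ
  have hc : c = c' := by
    apply mul_left_cancel₀ ha.ne'
    linarith
  subst hc
  have hd : d = d' := by
    apply mul_left_cancel₀ (pow_ne_zero 2 ha.ne')
    linarith
  rw [hd]

/-- The shape of the forms to be counted, with all sizes measured by one parameter `K`. -/
structure InBox (K : ℕ) (t : ℤ × ℤ × ℤ × ℤ) : Prop where
  a_pos : 0 < t.1
  a_le : t.1 ≤ 2 * K ^ 3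
  b_nonneg : 0 ≤ t.2.1
  b_lt : t.2.1 < 3 * t.1
  I_le : |Iform t.1 t.2.1 t.2.2.1 t.2.2.2| ≤ 2 * K ^ 2
  J_le : |Jform t.1 t.2.1 t.2.2.1 t.2.2.2| ≤ 6 * K ^ 3
  disc_ne : discForm t.1 t.2.1 t.2.2.1 t.2.2.2 ≠ 0

/-- The square roots of `I` modulo `3a` in `[0, 3a)`. -/
def sqRoots (a : ℕ) (I : ℤ) : Finset ℤ :=
  (Finset.Ico (0 : ℤ) (3 * a : ℕ)).filter (fun b => ((3 * a : ℕ) : ℤ) ∣ b ^ 2 - I)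

/-- A bound for the `g` with `g² ∣ gcd(4I, 3a)` when `|I| ≤ 2K²` and `a ≤ 2K³`. -/
def sqDivisorBound (K : ℕ) (I : ℤ) : ℕ :=
  if I = 0 then 3 * K ^ 2
  else ∑ g ∈ (Finset.Icc 1 (3 * K)).filter (fun g => ((g ^ 2 : ℕ) : ℤ) ∣ 4 * I), g

theorem card_sqRoots_le {K a : ℕ} (ha : 0 < a) (haK : a ≤ 2 * K ^ 3) {I : ℤ}
    (hI : |I| ≤ 2 * K ^ 2) :
    (sqRoots a I).card ≤ (3 * a).divisors.card * sqDivisorBound K I := by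
  refine card_sq_roots_le (by positivity) I _ fun g hg hgI => ?_
  unfold sqDivisorBound
  have hK : 0 < K := by
    rcases Nat.eq_zero_or_pos K with rfl | h
    · simp at haK
      omega
    · exact h
  split_ifs with h0
  · have h1 : g ^ 2 ≤ 3 * a := Nat.le_of_dvd (by positivity) hg
    have h2 : K ^ 3 ≤ K ^ 4 := Nat.pow_le_pow_right hK (by norm_num)
    have h3 : g ^ 2 ≤ (3 * K ^ 2) ^ 2 := by
      nlinarith
    exact (Nat.pow_le_pow_iff_left two_ne_zero).1 h3
  · have hg0 : 0 < g := by
      rcases Nat.eq_zero_or_pos g with rfl | h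
      · simp at hgI
        exact absurd hgI h0
      · exact h
    have h1 : ((g ^ 2 : ℕ) : ℤ) ≤ |4 * I| :=
      Int.le_of_dvd (by positivity) ((dvd_abs _ _).2 hgI)
    have h2 : (g : ℤ) ^ 2 ≤ (3 * K : ℤ) ^ 2 := by
      rw [abs_mul] at h1
      push_cast at h1
      norm_num at h1
      nlinarith
    have h3 : (g : ℤ) ≤ 3 * K := by
      exact (pow_le_pow_iff_left₀ (by positivity) (by positivity) two_ne_zero).1 h2
    refine Finset.single_le_sum (f := fun g : ℕ => g) (fun _ _ => Nat.zero_le _) ?_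
    rw [Finset.mem_filter, Finset.mem_Icc]
    exact ⟨⟨hg0, by exact_mod_cast h3⟩, hgI⟩

/-- Nonzero `I` with `|I| ≤ N` and `m ∣ 4I`. -/
theorem card_dvd_four_mul_le (N m : ℕ) (hm : 0 < m) :
    ((((Finset.Icc (-(N : ℤ)) N).filter (· ≠ 0)).filter (fun I => (m : ℤ) ∣ 4 * I)).card : ℝ)
      ≤ 8 * N / m := by
  have h : (((Finset.Icc (-(N : ℤ)) N).filter (· ≠ 0)).filter
      (fun I => (m : ℤ) ∣ 4 * I)).card ≤
      ((Finset.Icc (-((4 * N / m : ℕ) : ℤ)) (4 * N / m : ℕ)).filter (· ≠ 0)).card := by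
    refine Finset.card_le_card_of_injOn (fun I => 4 * I / m) ?_ ?_
    · intro I hI
      simp only [Finset.coe_filter, Finset.mem_filter, Finset.mem_Icc, Set.mem_ofPred_eq] at hI ⊢
      obtain ⟨⟨⟨h1, h2⟩, h3⟩, k, hk⟩ := hI
      have hm' : (0 : ℤ) < m := by exact_mod_cast hm
      rw [hk, Int.mul_ediv_cancel_left _ hm'.ne']
      push_cast
      refine ⟨⟨?_, ?_⟩, ?_⟩
      · rw [neg_le, Int.le_ediv_iff_mul_le hm']
        linarith
      · rw [Int.le_ediv_iff_mul_le hm']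
        linarith
      · rintro rfl
        omega
    · intro I hI J hJ hIJ
      simp only [Finset.coe_filter, Finset.mem_filter, Set.mem_ofPred_eq] at hI hJ hIJ
      obtain ⟨k, hk⟩ := hI.2
      obtain ⟨l, hl⟩ := hJ.2
      have hm' : (0 : ℤ) < m := by exact_mod_cast hm
      rw [hk, hl, Int.mul_ediv_cancel_left _ hm'.ne', Int.mul_ediv_cancel_left _ hm'.ne'] at hIJ
      subst hIJ
      omega
  have h2 : ((Finset.Icc (-((4 * N / m : ℕ) : ℤ)) (4 * N / m : ℕ)).filter (· ≠ 0)).card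
      = 2 * (4 * N / m) := by
    rw [Finset.filter_ne', Finset.card_erase_of_mem
      (Finset.mem_Icc.2 ⟨neg_nonpos.2 (Int.natCast_nonneg _), Int.natCast_nonneg _⟩), Int.card_Icc]
    omega
  rw [h2] at h
  calc _ ≤ ((2 * (4 * N / m) : ℕ) : ℝ) := by exact_mod_cast h
    _ = 2 * ((4 * N / m : ℕ) : ℝ) := by push_cast; ring
    _ ≤ 2 * (((4 * N : ℕ) : ℝ) / m) := by
        gcongr
        exact Nat.cast_div_le
    _ = 8 * N / m := by push_cast; ring

theorem sum_sqDivisorBound_le (K : ℕ) :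
    ((∑ I ∈ Finset.Icc (-((2 * K ^ 2 : ℕ) : ℤ)) (2 * K ^ 2 : ℕ), sqDivisorBound K I : ℕ) : ℝ)
      ≤ 3 * K ^ 2 + 16 * K ^ 2 * (1 + Real.log (3 * K : ℕ)) := by
  set N := 2 * K ^ 2 with hN
  have hsplit : ∑ I ∈ Finset.Icc (-(N : ℤ)) N, sqDivisorBound K I =
      3 * K ^ 2 + ∑ I ∈ (Finset.Icc (-(N : ℤ)) N).filter (· ≠ 0),
        ∑ g ∈ (Finset.Icc 1 (3 * K)).filter (fun g => ((g ^ 2 : ℕ) : ℤ) ∣ 4 * I), g := by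
    rw [Finset.filter_ne', ← Finset.add_sum_erase _ _ (a := (0 : ℤ)) (by simp)]
    congr 1
    refine Finset.sum_congr rfl fun I hI => ?_
    rw [sqDivisorBound, if_neg (Finset.ne_of_mem_erase hI)]
  have hswap : ∑ I ∈ (Finset.Icc (-(N : ℤ)) N).filter (· ≠ 0),
        ∑ g ∈ (Finset.Icc 1 (3 * K)).filter (fun g => ((g ^ 2 : ℕ) : ℤ) ∣ 4 * I), g =
      ∑ g ∈ Finset.Icc 1 (3 * K), (((Finset.Icc (-(N : ℤ)) N).filter (· ≠ 0)).filter
        (fun I => ((g ^ 2 : ℕ) : ℤ) ∣ 4 * I)).card * g := by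
    simp_rw [Finset.sum_filter _ (fun g : ℕ => g)]
    rw [Finset.sum_comm]
    refine Finset.sum_congr rfl fun g _ => ?_
    rw [← Finset.sum_filter, Finset.sum_const, smul_eq_mul]
  rw [hsplit, hswap]
  push_cast
  gcongr
  have hterm : ∀ g ∈ Finset.Icc 1 (3 * K),
      ((((Finset.Icc (-(N : ℤ)) N).filter (· ≠ 0)).filter
        (fun I => ((g ^ 2 : ℕ) : ℤ) ∣ 4 * I)).card : ℝ) * g ≤ 16 * K ^ 2 * (g : ℝ)⁻¹ := by
    intro g hg
    have hg0 : 0 < g := (Finset.mem_Icc.1 hg).1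
    have := card_dvd_four_mul_le N (g ^ 2) (by positivity)
    calc _ ≤ (8 * (N : ℝ) / (g ^ 2 : ℕ)) * g := by gcongr
      _ = 16 * K ^ 2 * (g : ℝ)⁻¹ := by
        rw [hN]
        push_cast
        field_simp
        ring
  have hharm := harmonic_le_one_add_log (3 * K)
  rw [harmonic_eq_sum_Icc] at hharm
  push_cast at hterm hharm ⊢
  refine (Finset.sum_le_sum hterm).trans ?_
  rw [← Finset.mul_sum]
  gcongr

theorem sum_card_sqRoots_le {K B : ℕ}
    (hB : ∀ n : ℕ, n ≠ 0 → n ≤ 3000 * K ^ 6 → n.divisors.card ≤ B) {I : ℤ}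
    (hI : |I| ≤ 2 * K ^ 2) (n : ℕ) (hn : n ≤ 3000 * K ^ 6) :
    ∑ a ∈ n.divisors.filter (· ≤ 2 * K ^ 3), (sqRoots a I).card ≤ B ^ 2 * sqDivisorBound K I := by
  rcases eq_or_ne n 0 with rfl | hn0
  · simp
  have h : ∀ a ∈ n.divisors.filter (· ≤ 2 * K ^ 3),
      (sqRoots a I).card ≤ B * sqDivisorBound K I := by
    intro a ha
    rw [Finset.mem_filter, Nat.mem_divisors] at ha
    have ha0 : 0 < a := Nat.pos_of_dvd_of_pos ha.1.1 (Nat.pos_of_ne_zero hn0)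
    have hK : 0 < K := by
      rcases Nat.eq_zero_or_pos K with rfl | h
      · simp at ha
        omega
      · exact h
    have h36 : K ^ 3 ≤ K ^ 6 := Nat.pow_le_pow_right hK (by norm_num)
    refine (card_sqRoots_le ha0 ha.2 hI).trans (Nat.mul_le_mul_right _ (hB _ ?_ ?_)) <;> omega
  refine (Finset.sum_le_card_nsmul _ _ _ h).trans ?_
  have h2 : (n.divisors.filter (· ≤ 2 * K ^ 3)).card ≤ B :=
    (Finset.card_filter_le _ _).trans (hB n hn0 hn)
  calc _ ≤ B * (B * sqDivisorBound K I) := Nat.mul_le_mul_right _ h2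
    _ = _ := by ring

theorem InBox.pos {K : ℕ} {t : ℤ × ℤ × ℤ × ℤ} (h : InBox K t) : 0 < K := by
  rcases Nat.eq_zero_or_pos K with rfl | hK
  · have h1 := h.a_pos
    have h2 := h.a_le
    simp at h2
    omega
  · exact hK

theorem InBox.b_mem_sqRoots {K : ℕ} {t : ℤ × ℤ × ℤ × ℤ} (h : InBox K t) :
    t.2.1 ∈ sqRoots t.1.natAbs (Iform t.1 t.2.1 t.2.2.1 t.2.2.2) := by
  have h1 : ((3 * t.1.natAbs : ℕ) : ℤ) = 3 * t.1 := by
    push_cast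
    rw [abs_of_pos h.a_pos]
  rw [sqRoots, Finset.mem_filter, Finset.mem_Ico, h1]
  refine ⟨⟨h.b_nonneg, h.b_lt⟩, t.2.2.1, ?_⟩
  unfold Iform
  ring

theorem InBox.natAbs_a_le {K : ℕ} {t : ℤ × ℤ × ℤ × ℤ} (h : InBox K t) :
    t.1.natAbs ≤ 2 * K ^ 3 := by
  have := h.a_le
  zify
  rwa [abs_of_pos h.a_pos]

/-- A root of the resolvent cubic `z³ - 3Iz - J` is small. -/
theorem InBox.abs_root_le {K : ℕ} {t : ℤ × ℤ × ℤ × ℤ} (h : InBox K t) {z : ℤ}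
    (hz : z ^ 3 - 3 * Iform t.1 t.2.1 t.2.2.1 t.2.2.2 * z = Jform t.1 t.2.1 t.2.2.1 t.2.2.2) :
    |z| ≤ 3 * K := by
  by_contra! hlt
  have hI := h.I_le
  have hJ := h.J_le
  have hK : (0 : ℤ) < K := by exact_mod_cast h.pos
  set I := Iform t.1 t.2.1 t.2.2.1 t.2.2.2
  set J := Jform t.1 t.2.1 t.2.2.1 t.2.2.2
  have h1 : |z| ^ 3 ≤ 3 * |I| * |z| + |J| := by
    have : z ^ 3 = 3 * I * z + J := by linarith
    rw [← abs_pow, this]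
    refine (abs_add_le _ _).trans ?_
    rw [abs_mul, abs_mul]
    norm_num
  have h2 : 3 * |I| * |z| ≤ 6 * K ^ 2 * |z| := by
    have := abs_nonneg z
    nlinarith
  have h3 : 9 * (K : ℤ) ^ 2 ≤ |z| ^ 2 := by nlinarith
  have h4 : 9 * (K : ℤ) ^ 2 * |z| ≤ |z| ^ 3 := by
    have := mul_le_mul_of_nonneg_right h3 (abs_nonneg z)
    linarith [this]
  have h5 : 3 * (K : ℤ) ^ 2 * (3 * K) < 3 * K ^ 2 * |z| := by
    apply mul_lt_mul_of_pos_left hlt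
    positivity
  nlinarith [pow_pos hK 3]

theorem ncard_root_le {K B : ℕ}
    (hB : ∀ n : ℕ, n ≠ 0 → n ≤ 3000 * K ^ 6 → n.divisors.card ≤ B) :
    {t : ℤ × ℤ × ℤ × ℤ | InBox K t ∧ ∃ z : ℤ,
        z ^ 3 - 3 * Iform t.1 t.2.1 t.2.2.1 t.2.2.2 * z =
          Jform t.1 t.2.1 t.2.2.1 t.2.2.2}.Finite ∧
    {t : ℤ × ℤ × ℤ × ℤ | InBox K t ∧ ∃ z : ℤ,
        z ^ 3 - 3 * Iform t.1 t.2.1 t.2.2.1 t.2.2.2 * z =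
          Jform t.1 t.2.1 t.2.2.1 t.2.2.2}.ncard ≤ (6 * K + 1) * (B ^ 2 *
      ∑ I ∈ Finset.Icc (-((2 * K ^ 2 : ℕ) : ℤ)) (2 * K ^ 2 : ℕ), sqDivisorBound K I) := by
  set D : ℤ → ℤ → ℕ := fun z I => ((4 * I - z ^ 2) * (I - z ^ 2) ^ 2).natAbs with hD
  set T := (Finset.Icc (-((3 * K : ℕ) : ℤ)) (3 * K : ℕ) ×ˢ
      Finset.Icc (-((2 * K ^ 2 : ℕ) : ℤ)) (2 * K ^ 2 : ℕ)).sigma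
    (fun p => ((D p.1 p.2).divisors.filter (· ≤ 2 * K ^ 3)).sigma (fun a => sqRoots a p.2)) with hT
  have hDle : ∀ z I : ℤ, |z| ≤ 3 * K → |I| ≤ 2 * K ^ 2 → D z I ≤ 3000 * K ^ 6 := by
    intro z I hz hI
    have hz2 : z ^ 2 ≤ 9 * K ^ 2 := by
      rw [← sq_abs]
      have := abs_nonneg z
      nlinarith
    have hz0 := sq_nonneg z
    have hI' := abs_le.1 hI
    have h1 : |4 * I - z ^ 2| ≤ 17 * (K : ℤ) ^ 2 := abs_le.2 ⟨by linarith, by linarith⟩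
    have h2 : |I - z ^ 2| ≤ 11 * (K : ℤ) ^ 2 := abs_le.2 ⟨by linarith, by linarith⟩
    have h3 : |(4 * I - z ^ 2) * (I - z ^ 2) ^ 2| ≤ 17 * (K : ℤ) ^ 2 * (11 * K ^ 2) ^ 2 := by
      rw [abs_mul, abs_pow]
      gcongr
    zify
    rw [show (D z I : ℤ) = _ from Int.natCast_natAbs _]
    nlinarith [h3, pow_nonneg (Int.natCast_nonneg K) 6]
  have key := finite_and_ncard_le_card_of_rel (T := T)
    (S := {t : ℤ × ℤ × ℤ × ℤ | InBox K t ∧ ∃ z : ℤ,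
        z ^ 3 - 3 * Iform t.1 t.2.1 t.2.2.1 t.2.2.2 * z = Jform t.1 t.2.1 t.2.2.1 t.2.2.2})
    (fun t y => t.1 = y.2.1 ∧ t.2.1 = y.2.2 ∧ Iform t.1 t.2.1 t.2.2.1 t.2.2.2 = y.1.2 ∧
      Jform t.1 t.2.1 t.2.2.1 t.2.2.2 = y.1.1 ^ 3 - 3 * y.1.2 * y.1.1) ?_ ?_
  · refine ⟨key.1, key.2.trans ?_⟩
    rw [hT, Finset.card_sigma, Finset.sum_product]
    simp_rw [Finset.card_sigma]
    have hz : (Finset.Icc (-((3 * K : ℕ) : ℤ)) (3 * K : ℕ)).card = 6 * K + 1 := by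
      rw [Int.card_Icc]
      omega
    rw [← hz, ← smul_eq_mul]
    refine Finset.sum_le_card_nsmul _ _ _ fun z hz => ?_
    rw [Finset.mul_sum]
    refine Finset.sum_le_sum fun I hI => ?_
    rw [Finset.mem_Icc] at hz hI
    push_cast at hz hI
    exact sum_card_sqRoots_le hB (abs_le.2 hI) _ (hDle z I (abs_le.2 hz) (abs_le.2 hI))
  · rintro t ⟨ht, z, hz⟩
    have hzK := ht.abs_root_le hz
    refine ⟨⟨(z, Iform t.1 t.2.1 t.2.2.1 t.2.2.2), ⟨t.1.natAbs, t.2.1⟩⟩, ?_, ?_, rfl, rfl, hz.symm⟩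
    · rw [hT, Finset.mem_sigma, Finset.mem_product, Finset.mem_sigma, Finset.mem_filter,
        Finset.mem_Icc, Finset.mem_Icc, Nat.mem_divisors]
      have hdisc : (4 * Iform t.1 t.2.1 t.2.2.1 t.2.2.2 - z ^ 2) *
          (Iform t.1 t.2.1 t.2.2.1 t.2.2.2 - z ^ 2) ^ 2 =
          27 * t.1 ^ 2 * discForm t.1 t.2.1 t.2.2.1 t.2.2.2 := by
        rw [← four_mul_Iform_cube_sub, ← hz]
        ring
      refine ⟨⟨?_, ?_⟩, ⟨⟨?_, ?_⟩, ht.natAbs_a_le⟩, ht.b_mem_sqRoots⟩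
      · push_cast
        exact abs_le.1 hzK
      · push_cast
        exact abs_le.1 ht.I_le
      · simp only [hD]
        rw [Int.natAbs_dvd_natAbs, hdisc]
        exact ⟨27 * t.1 * discForm t.1 t.2.1 t.2.2.1 t.2.2.2, by ring⟩
      · simp only [hD]
        rw [Int.natAbs_ne_zero, hdisc]
        exact mul_ne_zero (mul_ne_zero (by norm_num) (pow_ne_zero 2 ht.a_pos.ne')) ht.disc_ne
    · simp [abs_of_pos ht.a_pos]
  · rintro t ⟨ht, -⟩ t' - y ⟨h1, h2, h3, h4⟩ ⟨h1', h2', h3', h4'⟩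
    exact form_eq_of_invariants_eq ht.a_pos (h1.trans h1'.symm) (h2.trans h2'.symm)
      (h3.trans h3'.symm) (h4.trans h4'.symm)

theorem ncard_isSquare_disc_le {K B : ℕ}
    (hB : ∀ n : ℕ, n ≠ 0 → n ≤ 3000 * K ^ 6 → n.divisors.card ≤ B) :
    {t : ℤ × ℤ × ℤ × ℤ | InBox K t ∧
      IsSquare (discForm t.1 t.2.1 t.2.2.1 t.2.2.2)}.Finite ∧
    {t : ℤ × ℤ × ℤ × ℤ | InBox K t ∧
      IsSquare (discForm t.1 t.2.1 t.2.2.1 t.2.2.2)}.ncard ≤ 4 * B ^ 2 * (B ^ 2 *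
      ∑ I ∈ Finset.Icc (-((2 * K ^ 2 : ℕ) : ℤ)) (2 * K ^ 2 : ℕ), sqDivisorBound K I) := by
  set M : ℤ := 32 * K ^ 6 with hM
  set P : ℤ → Finset (ℤ × ℤ) := fun I => (Finset.Icc (-M) M ×ˢ Finset.Icc (-M) M).filter
    (fun p => p.1 ^ 2 + 3 * p.2 ^ 2 = 4 * I ^ 3) with hP
  set T := (Finset.Icc (1 : ℤ) (2 * K ^ 2 : ℕ)).sigma (fun I => (P I).sigma
    (fun p => (p.2.natAbs.divisors.filter (· ≤ 2 * K ^ 3)).sigma (fun a => sqRoots a I))) with hT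
  have hI3 : ∀ I : ℤ, 0 < I → I ≤ 2 * K ^ 2 → 4 * I ^ 3 ≤ M := by
    intro I h0 hI
    have := pow_le_pow_left₀ h0.le hI 3
    rw [hM]
    nlinarith
  have key := finite_and_ncard_le_card_of_rel (T := T)
    (S := {t : ℤ × ℤ × ℤ × ℤ | InBox K t ∧ IsSquare (discForm t.1 t.2.1 t.2.2.1 t.2.2.2)})
    (fun t y => t.1 = y.2.2.1 ∧ t.2.1 = y.2.2.2 ∧ Iform t.1 t.2.1 t.2.2.1 t.2.2.2 = y.1 ∧
      Jform t.1 t.2.1 t.2.2.1 t.2.2.2 = y.2.1.1) ?_ ?_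
  · refine ⟨key.1, key.2.trans ?_⟩
    rw [hT, Finset.card_sigma]
    simp_rw [Finset.card_sigma]
    have h1 : ∀ I ∈ Finset.Icc (1 : ℤ) (2 * K ^ 2 : ℕ),
        ∑ p ∈ P I, ∑ a ∈ p.2.natAbs.divisors.filter (· ≤ 2 * K ^ 3), (sqRoots a I).card ≤
          4 * B ^ 2 * (B ^ 2 * sqDivisorBound K I) := by
      intro I hI
      rw [Finset.mem_Icc] at hI
      push_cast at hI
      have hI0 : 0 < I := by linarith
      have hIM := hI3 I hI0 hI.2
      obtain ⟨n, hn⟩ : ∃ n : ℕ, (n : ℤ) = 4 * I ^ 3 := ⟨(4 * I ^ 3).toNat,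
        Int.toNat_of_nonneg (by positivity)⟩
      have hn0 : 0 < n := by
        have : 0 < 4 * I ^ 3 := by positivity
        omega
      have hnM : n ≤ 3000 * K ^ 6 := by
        zify
        rw [hn]
        refine hIM.trans ?_
        rw [hM]
        gcongr
        norm_num
      have hcard : (P I).card ≤ 4 * B ^ 2 := by
        refine (card_reps_le hn0 (P I) fun p hp => ?_).trans ?_
        · rw [hn]
          exact (Finset.mem_filter.1 hp).2
        · gcongr
          exact hB n hn0.ne' hnM
      refine (Finset.sum_le_card_nsmul _ _ (B ^ 2 * sqDivisorBound K I) fun p hp => ?_).trans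
        (Nat.mul_le_mul_right _ hcard)
      refine sum_card_sqRoots_le hB (abs_le.2 ⟨?_, hI.2⟩) _ ?_
      · have : (0 : ℤ) ≤ 2 * K ^ 2 := by positivity
        linarith
      · have h2 := (Finset.mem_product.1 (Finset.mem_filter.1 hp).1).2
        rw [Finset.mem_Icc] at h2
        have h3 : |p.2| ≤ M := abs_le.2 h2
        zify
        refine h3.trans ?_
        rw [hM]
        gcongr
        norm_num
    refine (Finset.sum_le_sum h1).trans ?_
    rw [← Finset.mul_sum, ← Finset.mul_sum]
    refine Nat.mul_le_mul_left _ (Nat.mul_le_mul_left _ (Finset.sum_le_sum_of_subset ?_))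
    apply Finset.Icc_subset_Icc_left
    have : (0 : ℤ) ≤ (2 * K ^ 2 : ℕ) := Int.natCast_nonneg _
    linarith
  · rintro t ⟨ht, m, hm⟩
    have hrel := four_mul_Iform_cube_sub t.1 t.2.1 t.2.2.1 t.2.2.2
    have hI := ht.I_le
    set I := Iform t.1 t.2.1 t.2.2.1 t.2.2.2 with hIdef
    set J := Jform t.1 t.2.1 t.2.2.1 t.2.2.2 with hJdef
    have hm0 : m ≠ 0 := by
      rintro rfl
      exact ht.disc_ne (by simpa using hm)
    have hy0 : 3 * t.1 * m ≠ 0 :=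
      mul_ne_zero (mul_ne_zero (by norm_num) ht.a_pos.ne') hm0
    have hrep : J ^ 2 + 3 * (3 * t.1 * m) ^ 2 = 4 * I ^ 3 := by
      rw [hm] at hrel
      linarith
    have hI0 : 0 < I := by
      have h1 : 0 < (3 * t.1 * m) ^ 2 := by positivity
      have h2 : 0 < I ^ 3 := by nlinarith [sq_nonneg J]
      exact (Odd.pow_pos_iff (by decide)).1 h2
    have hIM := hI3 I hI0 (abs_le.1 hI).2
    have habs : ∀ x : ℤ, x ^ 2 ≤ M → -M ≤ x ∧ x ≤ M := by
      intro x hx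
      have h1 : |x| ≤ |x| ^ 2 := by
        rcases eq_or_ne x 0 with rfl | h
        · simp
        · have := Int.one_le_abs h
          nlinarith
      rw [sq_abs] at h1
      exact abs_le.1 (h1.trans hx)
    refine ⟨⟨I, ⟨(J, 3 * t.1 * m), ⟨t.1.natAbs, t.2.1⟩⟩⟩, ?_, ?_, rfl, rfl, rfl⟩
    · rw [hT, Finset.mem_sigma, Finset.mem_Icc, Finset.mem_sigma, Finset.mem_sigma,
        hP, Finset.mem_filter, Finset.mem_product, Finset.mem_Icc, Finset.mem_Icc,
        Finset.mem_filter, Nat.mem_divisors]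
      refine ⟨⟨hI0, ?_⟩, ⟨⟨habs J ?_, habs _ ?_⟩, hrep⟩, ⟨⟨?_, ?_⟩, ht.natAbs_a_le⟩,
        ht.b_mem_sqRoots⟩
      · push_cast
        exact (abs_le.1 hI).2
      · nlinarith [sq_nonneg (3 * t.1 * m)]
      · nlinarith [sq_nonneg (3 * t.1 * m), sq_nonneg J]
      · exact Int.natAbs_dvd_natAbs.2 ⟨3 * m, by ring⟩
      · exact Int.natAbs_ne_zero.2 hy0
    · simp [abs_of_pos ht.a_pos]
  · rintro t ⟨ht, -⟩ t' - y ⟨h1, h2, h3, h4⟩ ⟨h1', h2', h3', h4'⟩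
    exact form_eq_of_invariants_eq ht.a_pos (h1.trans h1'.symm) (h2.trans h2'.symm)
      (h3.trans h3'.symm) (h4.trans h4'.symm)

/-- Reducible forms of bounded discriminant. -/
theorem ncard_reducible_le {K Q : ℕ} :
    {t : ℤ × ℤ × ℤ × ℤ | InBox K t ∧ |discForm t.1 t.2.1 t.2.2.1 t.2.2.2| ≤ Q ∧
      ∃ p r : ℤ, 0 < r ∧ IsCoprime p r ∧ t.1 * p ^ 3 + t.2.1 * p ^ 2 * r +
        t.2.2.1 * p * r ^ 2 + t.2.2.2 * r ^ 3 = 0}.ncard ≤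
      (2 * Q + 1) * ((2 * Q + 1) * ((3 * K) * ((6 * K + 1) * (2 * Q)))) := by
  set T : Finset (ℤ × ℤ × ℤ × ℤ × ℤ) := Finset.Icc (-(Q : ℤ)) Q ×ˢ Finset.Icc (-(Q : ℤ)) Q ×ˢ
    Finset.Icc 1 ((3 * K : ℕ) : ℤ) ×ˢ Finset.Icc (-((3 * K : ℕ) : ℤ)) (3 * K : ℕ) ×ˢ
    Finset.Ico 0 ((2 * Q : ℕ) : ℤ) with hT
  have key := finite_and_ncard_le_card_of_rel (T := T)
    (S := {t : ℤ × ℤ × ℤ × ℤ | InBox K t ∧ |discForm t.1 t.2.1 t.2.2.1 t.2.2.2| ≤ Q ∧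
      ∃ p r : ℤ, 0 < r ∧ IsCoprime p r ∧ t.1 * p ^ 3 + t.2.1 * p ^ 2 * r +
        t.2.2.1 * p * r ^ 2 + t.2.2.2 * r ^ 3 = 0})
    (fun t y => ∃ s u v w : ℤ, 0 < y.2.2.1 ∧ t.1 = y.2.2.1 * u ∧ t.2.1 = y.2.2.1 * v + s * u ∧
      t.2.2.1 = y.2.2.1 * w + s * v ∧ t.2.2.2 = s * w ∧
      y.1 = u * s ^ 2 - v * y.2.2.1 * s + w * y.2.2.1 ^ 2 ∧ y.1 ≠ 0 ∧
      y.2.1 = v ^ 2 - 4 * u * w ∧ y.2.2.2.1 = y.2.2.1 * v - 2 * u * s ∧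
      y.2.2.2.2 = 2 * |y.1| * t.2.1 / (3 * t.1)) ?_ ?_
  · refine key.2.trans_eq ?_
    rw [hT]
    simp only [Finset.card_product, Int.card_Icc, Int.card_Ico]
    congr 1
    · omega
    · congr 1
      · omega
      · congr 1
        · omega
        · congr 1
          omega
  · rintro ⟨a, b, c, d⟩ ⟨ht, hQ, p, r, hr, hpr, h⟩
    obtain ⟨s, u, v, w, rfl, rfl, rfl, rfl⟩ := exists_factor_of_root hr hpr h
    have hz : (r * v - 2 * u * s) ^ 3 - 3 * Iform (r * u) (r * v + s * u) (r * w + s * v) (s * w) *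
        (r * v - 2 * u * s) = Jform (r * u) (r * v + s * u) (r * w + s * v) (s * w) := by
      unfold Iform Jform
      ring
    have hzK := ht.abs_root_le hz
    have ha := ht.a_pos
    have hb := ht.b_nonneg
    have hb3 := ht.b_lt
    have hI := ht.I_le
    have hne := ht.disc_ne
    simp only at hQ ha hb hb3 hI hne
    set N := u * s ^ 2 - v * r * s + w * r ^ 2 with hN
    set δ := v ^ 2 - 4 * u * w with hδ
    have hdisc : discForm (r * u) (r * v + s * u) (r * w + s * v) (s * w) = N ^ 2 * δ := by
      unfold discForm
      rw [hN, hδ]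
      ring
    have h4I : 4 * Iform (r * u) (r * v + s * u) (r * w + s * v) (s * w) -
        (r * v - 2 * u * s) ^ 2 = 3 * r ^ 2 * δ := by
      unfold Iform
      rw [hδ]
      ring
    rw [hdisc] at hQ hne
    have hN0 : N ≠ 0 := by
      rintro h0
      exact hne (by rw [h0]; ring)
    have hδ0 : δ ≠ 0 := by
      rintro h0
      exact hne (by rw [h0]; ring)
    have hN1 := Int.one_le_abs hN0
    have hδ1 := Int.one_le_abs hδ0
    rw [abs_mul, abs_pow] at hQ
    have hNQ : |N| ≤ Q := by nlinarith [mul_nonneg (abs_nonneg N) (abs_nonneg N)]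
    have hN2 : 1 ≤ |N| ^ 2 := one_le_pow₀ hN1
    have hδQ : |δ| ≤ Q := by nlinarith
    refine ⟨(N, δ, r, r * v - 2 * u * s, 2 * |N| * (r * v + s * u) / (3 * (r * u))), ?_,
      s, u, v, w, hr, rfl, rfl, rfl, rfl, hN, hN0, hδ, rfl, rfl⟩
    simp only [hT, Finset.mem_product, Finset.mem_Icc, Finset.mem_Ico]
    refine ⟨abs_le.1 hNQ, abs_le.1 hδQ, ⟨by omega, ?_⟩, ?_, ?_, ?_⟩
    · push_cast
      have h1 : 3 * r ^ 2 ≤ 17 * (K : ℤ) ^ 2 := by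
        have h2 : |3 * r ^ 2 * δ| ≤ 17 * (K : ℤ) ^ 2 := by
          rw [← h4I]
          have h3 : (r * v - 2 * u * s) ^ 2 ≤ 9 * (K : ℤ) ^ 2 := by
            rw [← sq_abs]
            have := abs_nonneg (r * v - 2 * u * s)
            nlinarith
          have h4 := sq_nonneg (r * v - 2 * u * s)
          have h5 := abs_le.1 hI
          exact abs_le.2 ⟨by linarith, by linarith⟩
        rw [abs_mul, abs_of_pos (by positivity : (0 : ℤ) < 3 * r ^ 2)] at h2
        have : 3 * r ^ 2 * 1 ≤ 3 * r ^ 2 * |δ| := by gcongr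
        linarith
      have h2 : r ^ 2 ≤ (3 * (K : ℤ)) ^ 2 := by nlinarith
      exact (pow_le_pow_iff_left₀ hr.le (by positivity) two_ne_zero).1 h2
    · push_cast
      exact abs_le.1 hzK
    · exact Int.ediv_nonneg (by positivity) (by linarith)
    · apply Int.ediv_lt_of_lt_mul (by linarith)
      push_cast
      have h1 : 2 * |N| * (r * v + s * u) < 2 * |N| * (3 * (r * u)) :=
        mul_lt_mul_of_pos_left hb3 (by linarith)
      have h2 : 2 * |N| * (3 * (r * u)) ≤ 2 * Q * (3 * (r * u)) := by gcongr
      linarith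
  · rintro ⟨a, b, c, d⟩ ⟨ht, -⟩ ⟨a', b', c', d'⟩ ⟨ht', -⟩ ⟨N, δ, r, z, q⟩
      ⟨s, u, v, w, hr, ha, hb, hc, hd, hN, hN0, hδ, hz, hq⟩
      ⟨s', u', v', w', -, ha', hb', hc', hd', hN', -, hδ', hz', hq'⟩
    simp only at *
    subst ha hb hc hd ha' hb' hc' hd'
    have hI : ∀ s u v w : ℤ, 4 * Iform (r * u) (r * v + s * u) (r * w + s * v) (s * w) =
        (r * v - 2 * u * s) ^ 2 + 3 * r ^ 2 * (v ^ 2 - 4 * u * w) := by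
      intros
      unfold Iform
      ring
    have hu : ∀ s u v w : ℤ, Iform (r * u) (r * v + s * u) (r * w + s * v) (s * w) =
        (r * v - 2 * u * s) ^ 2 - 3 * u * (u * s ^ 2 - v * r * s + w * r ^ 2) := by
      intros
      unfold Iform
      ring
    have hJ : ∀ s u v w : ℤ, Jform (r * u) (r * v + s * u) (r * w + s * v) (s * w) =
        (r * v - 2 * u * s) ^ 3 - 3 * Iform (r * u) (r * v + s * u) (r * w + s * v) (s * w) *
        (r * v - 2 * u * s) := by
      intros
      unfold Iform Jform
      ring
    have hII : Iform (r * u) (r * v + s * u) (r * w + s * v) (s * w) =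
        Iform (r * u') (r * v' + s' * u') (r * w' + s' * v') (s' * w') := by
      have h1 := hI s u v w
      have h2 := hI s' u' v' w'
      rw [← hz, ← hδ] at h1
      rw [← hz', ← hδ'] at h2
      linarith
    have hJJ : Jform (r * u) (r * v + s * u) (r * w + s * v) (s * w) =
        Jform (r * u') (r * v' + s' * u') (r * w' + s' * v') (s' * w') := by
      rw [hJ, hJ, hII, ← hz, ← hz']
    have huu : u = u' := by
      have h1 := hu s u v w
      have h2 := hu s' u' v' w'
      rw [← hz, ← hN] at h1
      rw [← hz', ← hN', ← hII] at h2
      apply mul_right_cancel₀ hN0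
      linarith
    subst huu
    have hdvd : r ∣ 2 * N * (s - s') := by
      have h1 : r ∣ 2 * N + s * z := ⟨2 * w * r - v * s, by rw [hN, hz]; ring⟩
      have h2 : r ∣ 2 * N + s' * z := ⟨2 * w' * r - v' * s', by rw [hN', hz']; ring⟩
      have h3 : r ∣ (s - s') * z := by
        have := dvd_sub h1 h2
        rwa [show 2 * N + s * z - (2 * N + s' * z) = (s - s') * z by ring] at this
      have h4 := dvd_sub (h1.mul_right (s - s')) (h3.mul_left s)
      rwa [show (2 * N + s * z) * (s - s') - s * ((s - s') * z) = 2 * N * (s - s') by ring] at h4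
    have hbb : r * v + s * u = r * v' + s' * u := by
      have h1 : 3 * (r * u) ∣ 2 * N * (r * v + s * u - (r * v' + s' * u)) := by
        obtain ⟨k, hk⟩ := hdvd
        refine ⟨k, ?_⟩
        have h2 : r * v + s * u - (r * v' + s' * u) = 3 * u * (s - s') := by
          linarith
        rw [h2]
        linear_combination 3 * u * hk
      have h2 : 3 * (r * u) ∣ 2 * |N| * (r * v + s * u) - 2 * |N| * (r * v' + s' * u) := by
        rcases abs_choice N with h | h <;> rw [h]
        · rwa [← mul_sub]
        · rw [← mul_sub, mul_neg, neg_mul]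
          exact h1.neg_right
      have h3 := Int.emod_eq_emod_iff_emod_sub_eq_zero.2 (Int.emod_eq_zero_of_dvd h2)
      have h4 := Int.mul_ediv_add_emod (2 * |N| * (r * v + s * u)) (3 * (r * u))
      have h5 := Int.mul_ediv_add_emod (2 * |N| * (r * v' + s' * u)) (3 * (r * u))
      rw [← hq, h3] at h4
      rw [← hq'] at h5
      have h6 : 2 * |N| ≠ 0 := mul_ne_zero two_ne_zero (abs_ne_zero.2 hN0)
      exact mul_left_cancel₀ h6 (h4.symm.trans h5)
    exact form_eq_of_invariants_eq ht.a_pos rfl hbb hII hJJ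

theorem exists_divisor_bound (η : ℝ) (hη : 0 < η) (hη1 : η ≤ 1) :
    ∃ C : ℝ, 0 < C ∧ ∀ K : ℕ, 1 ≤ K → ∃ B : ℕ,
      (∀ n : ℕ, n ≠ 0 → n ≤ 3000 * K ^ 6 → n.divisors.card ≤ B) ∧
      (B : ℝ) ≤ C * ((K : ℝ) ^ η) ^ 6 := by
  obtain ⟨C, hC, h⟩ := exists_card_divisors_le_rpow η hη
  refine ⟨C * 3000, by positivity, fun K hK => ⟨⌊C * (3000 * (K : ℝ) ^ 6) ^ η⌋₊, ?_, ?_⟩⟩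
  · intro n hn0 hn
    refine Nat.le_floor ((h n hn0).trans ?_)
    gcongr
    exact_mod_cast hn
  · refine (Nat.floor_le (by positivity)).trans ?_
    rw [Real.mul_rpow (by positivity) (by positivity), mul_assoc, ← Real.rpow_natCast,
      ← Real.rpow_natCast, ← Real.rpow_mul (by positivity), ← Real.rpow_mul (by positivity),
      mul_comm η]
    gcongr
    exact Real.rpow_le_self_of_one_le (by norm_num) hη1

theorem exists_sum_sqDivisorBound_le (η : ℝ) (hη : 0 < η) (hη1 : η ≤ 1) :
    ∃ C : ℝ, 0 < C ∧ ∀ K : ℕ, 1 ≤ K →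
      ((∑ I ∈ Finset.Icc (-((2 * K ^ 2 : ℕ) : ℤ)) (2 * K ^ 2 : ℕ), sqDivisorBound K I : ℕ) : ℝ)
        ≤ C * (K : ℝ) ^ 2 * (K : ℝ) ^ η := by
  refine ⟨19 + 48 / η, by positivity, fun K hK => (sum_sqDivisorBound_le K).trans ?_⟩
  have hK' : (1 : ℝ) ≤ K := by exact_mod_cast hK
  have h1 : 1 ≤ (K : ℝ) ^ η := Real.one_le_rpow hK' hη.le
  have h2 : Real.log (3 * K : ℕ) ≤ 3 * (K : ℝ) ^ η / η := by
    refine (Real.log_le_rpow_div (by positivity) hη).trans ?_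
    push_cast
    rw [Real.mul_rpow (by positivity) (by positivity)]
    gcongr
    exact Real.rpow_le_self_of_one_le (by norm_num) hη1
  calc 3 * (K : ℝ) ^ 2 + 16 * K ^ 2 * (1 + Real.log (3 * K : ℕ))
      ≤ 3 * K ^ 2 * (K : ℝ) ^ η + 16 * K ^ 2 * ((K : ℝ) ^ η + 3 * (K : ℝ) ^ η / η) := by
        have h3 : 3 * (K : ℝ) ^ 2 ≤ 3 * K ^ 2 * (K : ℝ) ^ η :=
          le_mul_of_one_le_right (by positivity) h1
        gcongr
    _ = _ := by
        field_simp
        ring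

theorem exists_ncard_bounds (η : ℝ) (hη : 0 < η) (hη1 : 25 * η ≤ 1) :
    ∃ C : ℝ, 0 < C ∧ ∀ K : ℕ, 1 ≤ K →
      ({t : ℤ × ℤ × ℤ × ℤ | InBox K t ∧ ∃ z : ℤ,
        z ^ 3 - 3 * Iform t.1 t.2.1 t.2.2.1 t.2.2.2 * z =
          Jform t.1 t.2.1 t.2.2.1 t.2.2.2}.Finite ∧
      ({t : ℤ × ℤ × ℤ × ℤ | InBox K t ∧ ∃ z : ℤ,
        z ^ 3 - 3 * Iform t.1 t.2.1 t.2.2.1 t.2.2.2 * z =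
          Jform t.1 t.2.1 t.2.2.1 t.2.2.2}.ncard : ℝ) ≤ C * (K : ℝ) ^ 3 * (K : ℝ) ^ (13 * η)) ∧
      ({t : ℤ × ℤ × ℤ × ℤ | InBox K t ∧
        IsSquare (discForm t.1 t.2.1 t.2.2.1 t.2.2.2)}.Finite ∧
      ({t : ℤ × ℤ × ℤ × ℤ | InBox K t ∧
        IsSquare (discForm t.1 t.2.1 t.2.2.1 t.2.2.2)}.ncard : ℝ) ≤ C * (K : ℝ) ^ 3) := by
  obtain ⟨C, hC, h⟩ := exists_divisor_bound η hη (by linarith)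
  obtain ⟨L, hL, hsum⟩ := exists_sum_sqDivisorBound_le η hη (by linarith)
  refine ⟨7 * C ^ 2 * L + 4 * C ^ 4 * L, by positivity, fun K hK => ?_⟩
  obtain ⟨B, hB, hBC⟩ := h K hK
  have hS := hsum K hK
  have hK' : (1 : ℝ) ≤ K := by exact_mod_cast hK
  obtain ⟨hf1, hc1⟩ := ncard_root_le hB
  obtain ⟨hf2, hc2⟩ := ncard_isSquare_disc_le hB
  set M := ∑ I ∈ Finset.Icc (-((2 * K ^ 2 : ℕ) : ℤ)) (2 * K ^ 2 : ℕ), sqDivisorBound K I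
  refine ⟨⟨hf1, (Nat.cast_le.2 hc1).trans ?_⟩, hf2, (Nat.cast_le.2 hc2).trans ?_⟩
  · push_cast
    calc (6 * (K : ℝ) + 1) * ((B : ℝ) ^ 2 * M)
        ≤ (7 * K) * ((C * ((K : ℝ) ^ η) ^ 6) ^ 2 * (L * (K : ℝ) ^ 2 * (K : ℝ) ^ η)) := by
          gcongr
          linarith
      _ = 7 * C ^ 2 * L * (K : ℝ) ^ 3 * ((K : ℝ) ^ η) ^ 13 := by ring
      _ = 7 * C ^ 2 * L * (K : ℝ) ^ 3 * (K : ℝ) ^ (13 * η) := by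
          rw [← Real.rpow_natCast ((K : ℝ) ^ η), ← Real.rpow_mul (by positivity), mul_comm η]
          norm_num
      _ ≤ _ := by
          gcongr
          exact le_add_of_nonneg_right (by positivity)
  · push_cast
    have h25 : ((K : ℝ) ^ η) ^ 25 ≤ K := by
      rw [← Real.rpow_natCast ((K : ℝ) ^ η), ← Real.rpow_mul (by positivity), mul_comm η]
      exact Real.rpow_le_self_of_one_le hK' (by exact_mod_cast hη1)
    calc 4 * (B : ℝ) ^ 2 * ((B : ℝ) ^ 2 * M)
        ≤ 4 * (C * ((K : ℝ) ^ η) ^ 6) ^ 2 *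
          ((C * ((K : ℝ) ^ η) ^ 6) ^ 2 * (L * (K : ℝ) ^ 2 * (K : ℝ) ^ η)) := by gcongr
      _ = 4 * C ^ 4 * L * (K : ℝ) ^ 2 * ((K : ℝ) ^ η) ^ 25 := by ring
      _ ≤ 4 * C ^ 4 * L * (K : ℝ) ^ 2 * K := by gcongr
      _ = 4 * C ^ 4 * L * (K : ℝ) ^ 3 := by ring
      _ ≤ _ := by
          gcongr
          exact le_add_of_nonneg_left (by positivity)

theorem exists_nat_pow_six_near {X Y : ℝ} (hX : 1 ≤ X) (hY : 1 ≤ Y) :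
    ∃ K : ℕ, 1 ≤ K ∧ X * Y ^ 2 ≤ (K : ℝ) ^ 6 ∧ (K : ℝ) ^ 3 ≤ 8 * (X ^ ((1 : ℝ) / 2) * Y) := by
  set W := (X * Y ^ 2) ^ ((1 : ℝ) / 6) with hW
  have hXY : 1 ≤ X * Y ^ 2 := one_le_mul_of_one_le_of_one_le hX (one_le_pow₀ hY)
  have hW1 : 1 ≤ W := Real.one_le_rpow hXY (by norm_num)
  have hK : W ≤ ⌈W⌉₊ := Nat.le_ceil W
  refine ⟨⌈W⌉₊, Nat.one_le_ceil_iff.2 (by linarith), ?_, ?_⟩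
  · have h6 : W ^ 6 = X * Y ^ 2 := by
      rw [hW, ← Real.rpow_natCast, ← Real.rpow_mul (by positivity)]
      norm_num
    rw [← h6]
    gcongr
  · have h3 : W ^ 3 = X ^ ((1 : ℝ) / 2) * Y := by
      rw [hW, ← Real.rpow_natCast, ← Real.rpow_mul (by positivity),
        Real.mul_rpow (by positivity) (by positivity), ← Real.rpow_natCast Y,
        ← Real.rpow_mul (by positivity)]
      norm_num
    have h2 : (⌈W⌉₊ : ℝ) ≤ 2 * W := by
      have := Nat.ceil_lt_add_one (by linarith : 0 ≤ W)
      linarith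
    calc (⌈W⌉₊ : ℝ) ^ 3 ≤ (2 * W) ^ 3 := by gcongr
      _ = 8 * W ^ 3 := by ring
      _ = _ := by rw [h3]

theorem invariants_lt_of_htForm_lt {a b c d : ℤ} (ha : 0 < a) {X : ℝ}
    (h : htForm a b c d < 2 * X) :
    |(Iform a b c d : ℝ)| ^ 3 < 2 * X * (a : ℝ) ^ 2 ∧
      (Jform a b c d : ℝ) ^ 2 < 8 * X * (a : ℝ) ^ 2 := by
  have ha' : (0 : ℝ) < (a : ℝ) ^ 2 := by
    have : (0 : ℝ) < a := by exact_mod_cast ha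
    positivity
  rw [htForm, inv_mul_lt_iff₀ ha', max_lt_iff] at h
  exact ⟨by linarith, by linarith⟩

theorem inBox_of_htForm_lt {X Y : ℝ} (hX : 1 ≤ X) (hY : 1 ≤ Y) {K : ℕ}
    (hK : X * Y ^ 2 ≤ (K : ℝ) ^ 6) {t : ℤ × ℤ × ℤ × ℤ}
    (hdisc : discForm t.1 t.2.1 t.2.2.1 t.2.2.2 ≠ 0) (ha : 0 < t.1) (hb : 0 ≤ t.2.1)
    (hb3 : t.2.1 < 3 * t.1) (haY : (t.1 : ℝ) < 2 * Y)
    (hht : htForm t.1 t.2.1 t.2.2.1 t.2.2.2 < 2 * X) : InBox K t := by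
  obtain ⟨hI, hJ⟩ := invariants_lt_of_htForm_lt ha hht
  have ha' : (0 : ℝ) < t.1 := by exact_mod_cast ha
  have hXa : X * (t.1 : ℝ) ^ 2 ≤ 4 * (K : ℝ) ^ 6 := by
    have h1 : (t.1 : ℝ) ^ 2 ≤ (2 * Y) ^ 2 := by gcongr
    have h2 : X * (t.1 : ℝ) ^ 2 ≤ X * (2 * Y) ^ 2 := by gcongr
    linarith
  refine ⟨ha, ?_, hb, hb3, ?_, ?_, hdisc⟩
  · have h1 : Y ^ 2 ≤ ((K : ℝ) ^ 3) ^ 2 := by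
      have : 1 * Y ^ 2 ≤ X * Y ^ 2 := by gcongr
      linarith
    have h2 : Y ≤ (K : ℝ) ^ 3 := (pow_le_pow_iff_left₀ (by linarith) (by positivity) two_ne_zero).1 h1
    have h3 : (t.1 : ℝ) ≤ 2 * (K : ℝ) ^ 3 := by linarith
    exact_mod_cast h3
  · have h1 : |(Iform t.1 t.2.1 t.2.2.1 t.2.2.2 : ℝ)| ^ 3 ≤ (2 * (K : ℝ) ^ 2) ^ 3 := by
      linarith
    have h2 := (pow_le_pow_iff_left₀ (abs_nonneg _) (by positivity) three_ne_zero).1 h1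
    exact_mod_cast h2
  · have h1 : |(Jform t.1 t.2.1 t.2.2.1 t.2.2.2 : ℝ)| ^ 2 ≤ (6 * (K : ℝ) ^ 3) ^ 2 := by
      rw [sq_abs]
      have : (0 : ℝ) ≤ (K : ℝ) ^ 6 := by positivity
      linarith
    have h2 := (pow_le_pow_iff_left₀ (abs_nonneg _) (by positivity) two_ne_zero).1 h1
    exact_mod_cast h2

theorem abs_discForm_le_of_htForm_lt {a b c d : ℤ} (ha : 0 < a) {X : ℝ}
    (h : htForm a b c d < 2 * X) : |discForm a b c d| ≤ (⌊X⌋₊ : ℤ) := by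
  obtain ⟨hI, hJ⟩ := invariants_lt_of_htForm_lt ha h
  have ha' : (0 : ℝ) < a := by exact_mod_cast ha
  have hrel : 4 * (Iform a b c d : ℝ) ^ 3 - (Jform a b c d : ℝ) ^ 2 =
      27 * (a : ℝ) ^ 2 * discForm a b c d := by
    exact_mod_cast four_mul_Iform_cube_sub a b c d
  have hle : 27 * (a : ℝ) ^ 2 * |(discForm a b c d : ℝ)| ≤
      4 * |(Iform a b c d : ℝ)| ^ 3 + (Jform a b c d : ℝ) ^ 2 := by
    rw [← abs_of_pos (by positivity : (0 : ℝ) < 27 * (a : ℝ) ^ 2), ← abs_mul, ← hrel, ← abs_pow]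
    refine (abs_sub _ _).trans_eq ?_
    rw [abs_mul, abs_of_nonneg (sq_nonneg (Jform a b c d : ℝ))]
    norm_num
  have hlt : |(discForm a b c d : ℝ)| < X := by
    by_contra! hge
    have : (a : ℝ) ^ 2 * X ≤ (a : ℝ) ^ 2 * |(discForm a b c d : ℝ)| := by gcongr
    have h0 : 0 ≤ (a : ℝ) ^ 2 * |(discForm a b c d : ℝ)| := by positivity
    linarith
  have h1 : (discForm a b c d).natAbs ≤ ⌊X⌋₊ := by
    apply Nat.le_floor
    rw [Nat.cast_natAbs]
    push_cast
    exact hlt.le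
  rw [Int.abs_eq_natAbs]
  exact_mod_cast h1

/-- A rational root of the form yields an integral root of the resolvent cubic. -/
theorem exists_resolvent_root {a b c d p r : ℤ} (hr : 0 < r) (hpr : IsCoprime p r)
    (h : a * p ^ 3 + b * p ^ 2 * r + c * p * r ^ 2 + d * r ^ 3 = 0) :
    ∃ z : ℤ, z ^ 3 - 3 * Iform a b c d * z = Jform a b c d := by
  obtain ⟨s, u, v, w, rfl, rfl, rfl, rfl⟩ := exists_factor_of_root hr hpr h
  refine ⟨r * v - 2 * u * s, ?_⟩
  unfold Iform Jform
  ring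

/-- Lemma 18 of the paper: for every `ε > 0` there is `κ > 0`
(depending only on `ε`) such that for all `X, Y ≥ 1` and either sign, the number of
non-generic integer binary cubic forms `f = ax³ + bx²y + cxy² + dy³` with
`±Δ(f) > 0`, `a > 0`, `0 ≤ b < 3a`, `Y ≤ a < 2Y`, `X ≤ H(f) < 2X` is at most
`κ·X^{1/2+ε}·Y`. -/
theorem count_nongeneric_forms_in_box (ε : ℝ) (hε : 0 < ε) :
    ∃ κ : ℝ, 0 < κ ∧ ∀ X Y : ℝ, 1 ≤ X → 1 ≤ Y → ∀ s : ℤ, s = 1 ∨ s = -1 →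
      (Set.ncard {t : ℤ × ℤ × ℤ × ℤ |
          0 < s * discForm t.1 t.2.1 t.2.2.1 t.2.2.2 ∧
          0 < t.1 ∧ 0 ≤ t.2.1 ∧ t.2.1 < 3 * t.1 ∧
          Y ≤ (t.1 : ℝ) ∧ (t.1 : ℝ) < 2 * Y ∧
          X ≤ htForm t.1 t.2.1 t.2.2.1 t.2.2.2 ∧
          htForm t.1 t.2.1 t.2.2.1 t.2.2.2 < 2 * X ∧
          ¬ GenericForm t.1 t.2.1 t.2.2.1 t.2.2.2} : ℝ) ≤
        κ * X ^ ((1 : ℝ) / 2 + ε) * Y := by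
  set η := min ε 1 / 40 with hηdef
  have hη : 0 < η := by positivity
  have hηε : 39 * η ≤ ε := by
    have := min_le_left ε 1
    rw [hηdef]
    linarith
  have hη1 : 25 * η ≤ 1 := by
    have := min_le_right ε 1
    rw [hηdef]
    linarith
  obtain ⟨C, hC, hbound⟩ := exists_ncard_bounds η hη hη1
  refine ⟨8 * (2 * C + 378), by positivity, fun X Y hX hY s hs => ?_⟩
  obtain ⟨K, hK1, hK6, hK3⟩ := exists_nat_pow_six_near hX hY
  obtain ⟨⟨hf1, hc1⟩, hf2, hc2⟩ := hbound K hK1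
  have hred := ncard_reducible_le (K := K) (Q := ⌊X⌋₊)
  set S₁ := {t : ℤ × ℤ × ℤ × ℤ | InBox K t ∧ ∃ z : ℤ,
    z ^ 3 - 3 * Iform t.1 t.2.1 t.2.2.1 t.2.2.2 * z = Jform t.1 t.2.1 t.2.2.1 t.2.2.2}
  set S₂ := {t : ℤ × ℤ × ℤ × ℤ | InBox K t ∧ IsSquare (discForm t.1 t.2.1 t.2.2.1 t.2.2.2)}
  set S₃ := {t : ℤ × ℤ × ℤ × ℤ | InBox K t ∧
    |discForm t.1 t.2.1 t.2.2.1 t.2.2.2| ≤ (⌊X⌋₊ : ℤ) ∧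
    ∃ p r : ℤ, 0 < r ∧ IsCoprime p r ∧ t.1 * p ^ 3 + t.2.1 * p ^ 2 * r +
      t.2.2.1 * p * r ^ 2 + t.2.2.2 * r ^ 3 = 0}
  have h31 : S₃ ⊆ S₁ := fun t ⟨ht, _, p, r, hr, hpr, h⟩ => ⟨ht, exists_resolvent_root hr hpr h⟩
  have hK' : (1 : ℝ) ≤ K := by exact_mod_cast hK1
  have hXε : 1 ≤ X ^ ε := Real.one_le_rpow hX hε.le
  have hS₃ : (S₃.ncard : ℝ) ≤ (C + 378) * (K : ℝ) ^ 3 * X ^ ε := by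
    rcases le_or_gt (K : ℝ) (X ^ 3) with hKX | hKX
    · have h1 : (K : ℝ) ^ (13 * η) ≤ X ^ ε := by
        calc (K : ℝ) ^ (13 * η) ≤ (X ^ 3) ^ (13 * η) := by gcongr
          _ = X ^ (39 * η) := by
              rw [← Real.rpow_natCast, ← Real.rpow_mul (by positivity)]
              congr 1
              push_cast
              ring
          _ ≤ X ^ ε := Real.rpow_le_rpow_of_exponent_le hX hηε
      calc (S₃.ncard : ℝ) ≤ S₁.ncard := by exact_mod_cast Set.ncard_le_ncard h31 hf1
        _ ≤ C * (K : ℝ) ^ 3 * (K : ℝ) ^ (13 * η) := hc1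
        _ ≤ (C + 378) * (K : ℝ) ^ 3 * X ^ ε := by
            gcongr
            linarith
    · have hQ : (⌊X⌋₊ : ℝ) ≤ X := Nat.floor_le (by linarith)
      calc (S₃.ncard : ℝ) ≤ _ := Nat.cast_le.2 hred
        _ = (2 * (⌊X⌋₊ : ℝ) + 1) * ((2 * ⌊X⌋₊ + 1) * ((3 * K) * ((6 * K + 1) * (2 * ⌊X⌋₊)))) := by
            push_cast
            ring
        _ ≤ (3 * X) * ((3 * X) * ((3 * K) * ((7 * K) * (2 * X)))) := by
            gcongr <;> linarith
        _ = 378 * (K : ℝ) ^ 2 * X ^ 3 := by ring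
        _ ≤ 378 * (K : ℝ) ^ 2 * K := by gcongr
        _ = 378 * (K : ℝ) ^ 3 * 1 := by ring
        _ ≤ (C + 378) * (K : ℝ) ^ 3 * X ^ ε := by
            gcongr
            linarith
  have hS₂ : (S₂.ncard : ℝ) ≤ C * (K : ℝ) ^ 3 * X ^ ε :=
    hc2.trans (le_mul_of_one_le_right (by positivity) hXε)
  refine (Nat.cast_le.2 (Set.ncard_le_ncard (t := S₃ ∪ S₂) ?_
    ((hf1.subset h31).union hf2))).trans ?_
  · rintro t ⟨hΔ, ha, hb, hb3, -, haY, -, hht, hgen⟩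
    have hΔ0 : discForm t.1 t.2.1 t.2.2.1 t.2.2.2 ≠ 0 := by
      rintro h0
      rw [h0, mul_zero] at hΔ
      exact lt_irrefl _ hΔ
    have hbox := inBox_of_htForm_lt hX hY hK6 hΔ0 ha hb hb3 haY hht
    rcases root_or_isSquare_of_not_genericForm ha.ne' hgen with h | h
    · exact Or.inl ⟨hbox, abs_discForm_le_of_htForm_lt ha hht, h⟩
    · exact Or.inr ⟨hbox, h⟩
  · calc ((S₃ ∪ S₂).ncard : ℝ) ≤ S₃.ncard + S₂.ncard := by
          exact_mod_cast Set.ncard_union_le S₃ S₂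
      _ ≤ (C + 378) * (K : ℝ) ^ 3 * X ^ ε + C * (K : ℝ) ^ 3 * X ^ ε := add_le_add hS₃ hS₂
      _ = (2 * C + 378) * X ^ ε * (K : ℝ) ^ 3 := by ring
      _ ≤ (2 * C + 378) * X ^ ε * (8 * (X ^ ((1 : ℝ) / 2) * Y)) := by gcongr
      _ = 8 * (2 * C + 378) * X ^ ((1 : ℝ) / 2 + ε) * Y := by
          rw [Real.rpow_add (by linarith)]
          ring
end
end

section
/- Let (A, B) be a pair of real ternary quadratic forms such that the binary cubic form Res(A, B)(x, y) = 4·det(Ax − By) has nonzero discriminant. Then the stabilizer of (A, B) in SL₃(ℝ) is a group of order exactly 4 if Δ(Res(A, B)) > 0, and of order exactly 2 if Δ(Res(A, B)) < 0. -/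
open Matrix

noncomputable section

/-- A matrix commuting with a diagonal matrix with distinct diagonal entries is diagonal. -/
theorem Matrix.exists_eq_diagonal_of_commute {n K : Type*} [Fintype n] [DecidableEq n] [Field K]
    {μ : n → K} (hμ : Function.Injective μ) {M : Matrix n n K}
    (h : diagonal μ * M = M * diagonal μ) : ∃ δ : n → K, M = diagonal δ := by
  refine ⟨M.diag, ?_⟩
  ext i j
  by_cases hij : i = j
  · subst hij; simp
  · have h' := congrFun (congrFun h i) j
    rw [diagonal_mul, mul_diagonal] at h'
    rw [diagonal_apply_ne _ hij]
    have h0 : (μ i - μ j) * M i j = 0 := by linear_combination h'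
    exact (mul_eq_zero.mp h0).resolve_left (sub_ne_zero.mpr fun e => hij (hμ e))

/-- The rows of `Q` simultaneously diagonalize the pair of forms `(A, B)`: the form `A` becomes
the nondegenerate diagonal form `α`, and `B` becomes `μ * α`, with distinct ratios `μ`. -/
structure IsPencilDiagonalization {n K : Type*} [Fintype n] [DecidableEq n] [Field K]
    (A B Q : Matrix n n K) (μ α : n → K) : Prop where
  injective : Function.Injective μ
  isUnit : IsUnit Q.det
  ne_zero : ∀ i, α i ≠ 0
  fst : Q * A * Qᵀ = diagonal α
  snd : Q * B * Qᵀ = diagonal (μ * α)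

section Pencil

variable {n K : Type*} [Fintype n] [DecidableEq n] [Field K]

/-- The matrix whose rows are eigenvectors of a pencil of symmetric matrices, for distinct
eigenvalues, diagonalizes the pencil. -/
theorem isPencilDiagonalization_of_eigenvectors {A B : Matrix n n K} (hA : A.IsSymm)
    (hB : B.IsSymm) (hdet : A.det ≠ 0) {μ : n → K} (hμ : Function.Injective μ) {v : n → n → K}
    (hv0 : ∀ i, v i ≠ 0) (hv : ∀ i, v i ᵥ* (μ i • A - B) = 0) :
    ∃ α, IsPencilDiagonalization A B (of v) μ α := by
  have hAu : IsUnit A.det := hdet.isUnit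
  have hvB : ∀ i, v i ᵥ* B = μ i • (v i ᵥ* A) := fun i => by
    have := hv i
    rw [vecMul_sub, vecMul_smul, sub_eq_zero] at this
    exact this.symm
  have hlin : LinearIndependent K v :=
    Module.End.eigenvectors_linearIndependent' (B * A⁻¹).vecMulLinear μ hμ v fun i =>
      ⟨Module.End.mem_eigenspace_iff.mpr (by
        rw [vecMulLinear_apply, ← vecMul_vecMul, hvB, smul_vecMul, vecMul_vecMul,
          mul_nonsing_inv _ hAu, vecMul_one]), hv0 i⟩
  have hQ : IsUnit (of v) := linearIndependent_rows_iff_isUnit.mp hlin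
  have hQd : IsUnit (of v).det := (isUnit_iff_isUnit_det _).mp hQ
  have hQB : of v * B = diagonal μ * (of v * A) := by
    ext i j
    rw [diagonal_mul]
    exact congrFun (hvB i) j
  have hsymm : ∀ {C : Matrix n n K}, C.IsSymm → (of v * C * (of v)ᵀ)ᵀ = of v * C * (of v)ᵀ := by
    intro C hC
    rw [transpose_mul, transpose_mul, transpose_transpose, hC.eq, Matrix.mul_assoc]
  have hQBQ : of v * B * (of v)ᵀ = diagonal μ * (of v * A * (of v)ᵀ) := by
    rw [hQB, Matrix.mul_assoc]
  obtain ⟨α, hα⟩ : ∃ α, of v * A * (of v)ᵀ = diagonal α := by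
    refine exists_eq_diagonal_of_commute hμ ?_
    have h := hsymm hB
    rw [hQBQ, transpose_mul, hsymm hA, diagonal_transpose] at h
    exact h.symm
  refine ⟨α, hμ, hQd, fun i => ?_, hα, ?_⟩
  · have h := congrArg det hα
    rw [det_mul, det_mul, det_transpose, det_diagonal] at h
    have h0 : ∏ i, α i ≠ 0 := h ▸ mul_ne_zero (mul_ne_zero hQd.ne_zero hdet) hQd.ne_zero
    exact Finset.prod_ne_zero_iff.mp h0 i (Finset.mem_univ i)
  · rw [hQBQ, hα, diagonal_mul_diagonal]; rfl

theorem exists_isPencilDiagonalization {A B : Matrix n n K} (hA : A.IsSymm) (hB : B.IsSymm)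
    (hdet : A.det ≠ 0) {μ : n → K} (hμ : Function.Injective μ)
    (hroot : ∀ i, (μ i • A - B).det = 0) :
    ∃ Q α, IsPencilDiagonalization A B Q μ α := by
  choose v hv0 hv using fun i => exists_vecMul_eq_zero_iff.mpr (hroot i)
  exact ⟨of v, isPencilDiagonalization_of_eigenvectors hA hB hdet hμ hv0 hv⟩

namespace IsPencilDiagonalization

variable {A B Q : Matrix n n K} {μ α : n → K}

theorem congr_eq_iff (h : IsPencilDiagonalization A B Q μ α) {C D g k : Matrix n n K}
    (hC : Q * C * Qᵀ = D) (hk : Q * g = k * Q) : g * C * gᵀ = C ↔ k * D * kᵀ = D := by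
  have hQ : IsUnit Q := (isUnit_iff_isUnit_det _).mpr h.isUnit
  have hQt : IsUnit Qᵀ := (isUnit_iff_isUnit_det _).mpr (by rw [det_transpose]; exact h.isUnit)
  have hkt : gᵀ * Qᵀ = Qᵀ * kᵀ := by rw [← transpose_mul, hk, transpose_mul]
  have e : Q * (g * C * gᵀ) * Qᵀ = k * D * kᵀ := by
    calc Q * (g * C * gᵀ) * Qᵀ = (Q * g) * C * (gᵀ * Qᵀ) := by simp only [Matrix.mul_assoc]
      _ = k * D * kᵀ := by rw [hk, hkt, ← hC]; simp only [Matrix.mul_assoc]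
  rw [← e, ← hC, hQt.mul_left_inj, hQ.mul_right_inj]

/-- The special stabilizer of a diagonalizable pencil consists of the sign changes, of
determinant one, in a diagonalizing basis. -/
theorem stabilizer_iff [CharZero K] (h : IsPencilDiagonalization A B Q μ α) (g : Matrix n n K) :
    (g.det = 1 ∧ g * A * gᵀ = A ∧ g * B * gᵀ = B) ↔
      ∃ ε : n → ℤˣ, ∏ i, ε i = 1 ∧ Q * g = diagonal (fun i => ((ε i : ℤ) : K)) * Q := by
  have hQ : IsUnit Q := (isUnit_iff_isUnit_det _).mpr h.isUnit
  have hdetk : ∀ {k : Matrix n n K}, Q * g = k * Q → g.det = k.det := fun hk =>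
    mul_left_cancel₀ h.isUnit.ne_zero (by rw [← det_mul, hk, det_mul, mul_comm])
  constructor
  · rintro ⟨hdet, hgA, hgB⟩
    obtain ⟨k, hk⟩ : ∃ k, Q * g = k * Q :=
      ⟨Q * g * Q⁻¹, by rw [Matrix.mul_assoc (Q * g), nonsing_inv_mul _ h.isUnit, Matrix.mul_one]⟩
    have hkA := (h.congr_eq_iff h.fst hk).mp hgA
    have hkB := (h.congr_eq_iff h.snd hk).mp hgB
    have hsplit : diagonal (μ * α) = diagonal μ * diagonal α := by
      rw [diagonal_mul_diagonal]; rfl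
    have hu : IsUnit (diagonal α * kᵀ) := by
      rw [isUnit_iff_isUnit_det, det_mul, det_transpose, ← hdetk hk, hdet, mul_one, det_diagonal,
        isUnit_iff_ne_zero]
      exact Finset.prod_ne_zero_iff.mpr fun i _ => h.ne_zero i
    have hcomm : diagonal μ * k = k * diagonal μ := by
      refine hu.mul_left_injective ?_
      change diagonal μ * k * (diagonal α * kᵀ) = k * diagonal μ * (diagonal α * kᵀ)
      calc diagonal μ * k * (diagonal α * kᵀ) = diagonal μ * (k * diagonal α * kᵀ) := by
            simp only [Matrix.mul_assoc]
        _ = k * (diagonal μ * diagonal α) * kᵀ := by rw [hkA, ← hsplit, hkB]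
        _ = k * diagonal μ * (diagonal α * kᵀ) := by simp only [Matrix.mul_assoc]
    obtain ⟨δ, rfl⟩ := exists_eq_diagonal_of_commute h.injective hcomm
    have hδ : ∀ i, ∃ u : ℤˣ, δ i = ((u : ℤ) : K) := fun i => by
      rw [diagonal_transpose, diagonal_mul_diagonal, diagonal_mul_diagonal] at hkA
      have hi := congrFun (diagonal_injective hkA) i
      have hsq : δ i * δ i = 1 := mul_right_cancel₀ (h.ne_zero i) (by linear_combination hi)
      rcases mul_self_eq_one_iff.mp hsq with hi | hi
      · exact ⟨1, by simp [hi]⟩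
      · exact ⟨-1, by simp [hi]⟩
    choose ε hε using hδ
    obtain rfl : δ = fun i => ((ε i : ℤ) : K) := funext hε
    refine ⟨ε, ?_, hk⟩
    have hd := hdetk hk
    rw [hdet, det_diagonal] at hd
    ext
    rw [Units.coe_prod, Units.val_one]
    exact_mod_cast hd.symm
  · rintro ⟨ε, hε, hk⟩
    have hsq : ∀ i, ((ε i : ℤ) : K) * ((ε i : ℤ) : K) = 1 := fun i => by
      rw [← Int.cast_mul, ← Units.val_mul, Int.units_mul_self, Units.val_one, Int.cast_one]
    refine ⟨?_, (h.congr_eq_iff h.fst hk).mpr ?_, (h.congr_eq_iff h.snd hk).mpr ?_⟩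
    · rw [hdetk hk, det_diagonal]
      have := congrArg (fun u : ℤˣ => ((u : ℤ) : K)) hε
      simpa [Units.coe_prod] using this
    all_goals
      rw [diagonal_transpose, diagonal_mul_diagonal, diagonal_mul_diagonal]
      congr 1
      funext i
      rw [mul_right_comm, hsq, one_mul]

end IsPencilDiagonalization

end Pencil


theorem exists_root_monic_cubic (p q r : ℝ) : ∃ x : ℝ, x ^ 3 + p * x ^ 2 + q * x + r = 0 := by
  set M := 1 + |p| + |q| + |r| with hM
  have hp := abs_nonneg p
  have hq := abs_nonneg q
  have hr := abs_nonneg r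
  have hM1 : 1 ≤ M := by linarith
  have hM2 : M ≤ M ^ 2 := by nlinarith
  have e : M ^ 3 = M ^ 2 + |p| * M ^ 2 + |q| * M ^ 2 + |r| * M ^ 2 := by
    rw [pow_succ M 2]; nth_rewrite 2 [hM]; ring
  have h1 : |p * M ^ 2| ≤ |p| * M ^ 2 := by rw [abs_mul, abs_of_nonneg (sq_nonneg M)]
  have h2 : |q * M| ≤ |q| * M ^ 2 := by
    rw [abs_mul, abs_of_nonneg (by linarith : 0 ≤ M)]; gcongr
  have h3 : |r| ≤ |r| * M ^ 2 := le_mul_of_one_le_right hr (by linarith)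
  rw [abs_le] at h1 h2
  have h4 := neg_abs_le r
  have h5 := le_abs_self r
  have hcont : Continuous fun x : ℝ => x ^ 3 + p * x ^ 2 + q * x + r := by fun_prop
  exact mem_range_of_exists_le_of_exists_ge hcont
    ⟨-M, by nlinarith⟩ ⟨M, by nlinarith⟩

/-- A real cubic with positive discriminant has three distinct real roots. -/
theorem exists_three_roots_of_discr_pos {a b c d : ℝ} (ha : a ≠ 0)
    (hΔ : 0 < b ^ 2 * c ^ 2 - 4 * a * c ^ 3 - 4 * b ^ 3 * d - 27 * a ^ 2 * d ^ 2
        + 18 * a * b * c * d) :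
    ∃ μ : Fin 3 → ℝ, Function.Injective μ ∧
      ∀ i, a * μ i ^ 3 + b * μ i ^ 2 + c * μ i + d = 0 := by
  obtain ⟨x, hx⟩ := exists_root_monic_cubic (b / a) (c / a) (d / a)
  obtain ⟨p, q, rfl, rfl, rfl⟩ : ∃ p q, b = p - a * x ∧ c = q - p * x ∧ d = -(q * x) := by
    refine ⟨b + a * x, c + (b + a * x) * x, by ring, by ring, ?_⟩
    field_simp at hx
    linear_combination hx
  have hfac : 0 < (p ^ 2 - 4 * a * q) * (a * x ^ 2 + p * x + q) ^ 2 := by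
    linear_combination hΔ
  have hD : 0 < p ^ 2 - 4 * a * q := pos_of_mul_pos_left hfac (sq_nonneg _)
  have hqx : a * x ^ 2 + p * x + q ≠ 0 := fun h => by simp [h] at hfac
  set s := √(p ^ 2 - 4 * a * q)
  have hs : s ^ 2 = p ^ 2 - 4 * a * q := Real.sq_sqrt hD.le
  have hs0 : 0 < s := Real.sqrt_pos.mpr hD
  obtain ⟨y, hy⟩ : ∃ y, 2 * a * y = -p + s := ⟨(-p + s) / (2 * a), by field_simp⟩
  obtain ⟨z, hz⟩ : ∃ z, 2 * a * z = -p - s := ⟨(-p - s) / (2 * a), by field_simp⟩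
  have h4a : 4 * a ≠ 0 := by simpa using ha
  have hy0 : a * y ^ 2 + p * y + q = 0 := mul_left_cancel₀ h4a (by
    linear_combination (2 * a * y + p + s) * hy + hs)
  have hz0 : a * z ^ 2 + p * z + q = 0 := mul_left_cancel₀ h4a (by
    linear_combination (2 * a * z + p - s) * hz + hs)
  have hxy : x ≠ y := fun h => hqx (h ▸ hy0)
  have hxz : x ≠ z := fun h => hqx (h ▸ hz0)
  have hyz : y ≠ z := fun h => by rw [h] at hy; linarith
  refine ⟨![x, y, z], ?_, ?_⟩
  · intro i j
    fin_cases i <;> fin_cases j <;> simp [hxy, hxz, hyz, hxy.symm, hxz.symm, hyz.symm]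
  · intro i
    fin_cases i <;> simp only [Fin.zero_eta, Fin.mk_one, Fin.reduceFinMk, cons_val]
    · ring
    · linear_combination (y - x) * hy0
    · linear_combination (z - x) * hz0

/-- A real cubic with negative discriminant has a real root and a non-real root. -/
theorem exists_roots_of_discr_neg {a b c d : ℝ} (ha : a ≠ 0)
    (hΔ : b ^ 2 * c ^ 2 - 4 * a * c ^ 3 - 4 * b ^ 3 * d - 27 * a ^ 2 * d ^ 2
        + 18 * a * b * c * d < 0) :
    ∃ (x : ℝ) (z : ℂ), z.im ≠ 0 ∧ a * x ^ 3 + b * x ^ 2 + c * x + d = 0 ∧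
      a * z ^ 3 + b * z ^ 2 + c * z + d = 0 := by
  obtain ⟨x, hx⟩ := exists_root_monic_cubic (b / a) (c / a) (d / a)
  obtain ⟨p, q, rfl, rfl, rfl⟩ : ∃ p q, b = p - a * x ∧ c = q - p * x ∧ d = -(q * x) := by
    refine ⟨b + a * x, c + (b + a * x) * x, by ring, by ring, ?_⟩
    field_simp at hx
    linear_combination hx
  have hD : p ^ 2 - 4 * a * q < 0 := by
    by_contra! h
    nlinarith [mul_nonneg h (sq_nonneg (a * x ^ 2 + p * x + q))]
  set s := √(-(p ^ 2 - 4 * a * q))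
  have hs : s ^ 2 = -(p ^ 2 - 4 * a * q) := Real.sq_sqrt (by linarith)
  have hs0 : 0 < s := Real.sqrt_pos.mpr (by linarith)
  refine ⟨x, ⟨-p / (2 * a), s / (2 * a)⟩, by positivity, by ring, ?_⟩
  set z : ℂ := ⟨-p / (2 * a), s / (2 * a)⟩ with hzdef
  have hac : (a : ℂ) ≠ 0 := by exact_mod_cast ha
  have hz : 2 * a * z = -p + s * Complex.I := by
    have : z = ((-p / (2 * a) : ℝ) : ℂ) + ((s / (2 * a) : ℝ) : ℂ) * Complex.I := by
      rw [hzdef, Complex.mk_eq_add_mul_I]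
    rw [this]; push_cast; field_simp
  have hsc : (s : ℂ) ^ 2 = -(p ^ 2 - 4 * a * q) := by exact_mod_cast hs
  have hz0 : a * z ^ 2 + p * z + q = 0 :=
    mul_left_cancel₀ (by simpa using hac : (4 * a : ℂ) ≠ 0) (by
      linear_combination (2 * a * z + p + s * Complex.I) * hz - hsc + s ^ 2 * Complex.I_sq)
  push_cast
  linear_combination (z - x) * hz0

/-- If complex conjugation permutes the rows of `Q` by `σ`, then it permutes by `σ` the
eigenvalues of a matrix of which these rows are eigenvectors. -/
theorem mul_map_conj_eq_diagonal_mul {n : Type*} [Fintype n] [DecidableEq n]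
    {Q M : Matrix n n ℂ} {σ : Equiv.Perm n} {δ : n → ℂ}
    (hQ : ∀ i j, starRingEnd ℂ (Q i j) = Q (σ i) j) (hM : Q * M = diagonal δ * Q) :
    Q * M.map (starRingEnd ℂ) =
      diagonal (fun i => starRingEnd ℂ (δ (σ.symm i))) * Q := by
  ext i j
  have h := congrArg (starRingEnd ℂ) (congrFun (congrFun hM (σ.symm i)) j)
  rw [diagonal_mul, mul_apply, map_sum, map_mul, hQ, σ.apply_symm_apply] at h
  rw [diagonal_mul, mul_apply, ← h]
  exact Finset.sum_congr rfl fun k _ => by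
    rw [map_mul, hQ, σ.apply_symm_apply, map_apply]

theorem Matrix.exists_map_ofReal_eq {m n : Type*} {M : Matrix m n ℂ}
    (hM : M.map (starRingEnd ℂ) = M) : ∃ N : Matrix m n ℝ, N.map Complex.ofRealHom = M :=
  ⟨M.map Complex.re, by
    ext i j
    exact Complex.conj_eq_iff_re.mp (congrFun (congrFun hM i) j)⟩

/-- The condition on `g` of the special stabilizer of a pair of forms. -/
theorem stabilizer_map_iff {n K L : Type*} [Fintype n] [DecidableEq n] [Field K] [Field L]
    (φ : K →+* L) (A B g : Matrix n n K) :
    ((g.map φ).det = 1 ∧ g.map φ * A.map φ * (g.map φ)ᵀ = A.map φ ∧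
      g.map φ * B.map φ * (g.map φ)ᵀ = B.map φ) ↔
    (g.det = 1 ∧ g * A * gᵀ = A ∧ g * B * gᵀ = B) := by
  have hinj : Function.Injective fun M : Matrix n n K => M.map φ := map_injective φ.injective
  have hdet : (g.map φ).det = φ g.det := (RingHom.map_det φ g).symm
  have hconj : ∀ C : Matrix n n K, g.map φ * C.map φ * (g.map φ)ᵀ = C.map φ ↔
      g * C * gᵀ = C := fun C => by
    rw [← transpose_map, ← Matrix.map_mul, ← Matrix.map_mul]
    exact hinj.eq_iff
  rw [hdet, map_eq_one_iff φ φ.injective, hconj, hconj]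

theorem four_mul_det_pencil_map {K : Type*} [Field K] [CharZero K] (φ : ℝ →+* K)
    {A B : Matrix (Fin 3) (Fin 3) ℝ} {a b c d : ℝ}
    (hres : ∀ x y : ℝ, 4 * (x • A - y • B).det =
      a * x ^ 3 + b * x ^ 2 * y + c * x * y ^ 2 + d * y ^ 3) (x y : K) :
    4 * (x • A.map φ - y • B.map φ).det =
      φ a * x ^ 3 + φ b * x ^ 2 * y + φ c * x * y ^ 2 + φ d * y ^ 3 := by
  have h10 := congrArg φ (hres 1 0)
  have h01 := congrArg φ (hres 0 1)
  have h11 := congrArg φ (hres 1 1)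
  have h12 := congrArg φ (hres 1 (-1))
  simp only [det_fin_three, Matrix.sub_apply, Matrix.smul_apply, smul_eq_mul, map_apply, map_add, map_sub,
    map_mul, map_pow, map_neg, map_one, map_zero, map_ofNat] at *
  linear_combination h10 * (x ^ 3 - x * y ^ 2) + h01 * (y ^ 3 - x ^ 2 * y)
    + h11 * (x ^ 2 * y + x * y ^ 2) / 2 + h12 * (x * y ^ 2 - x ^ 2 * y) / 2

/-- The stabilizer in `SL₃(ℝ)` of a pair of ternary quadratic forms. -/
abbrev PairStabilizer (A B : Matrix (Fin 3) (Fin 3) ℝ) : Type :=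
  {g : Matrix.SpecialLinearGroup (Fin 3) ℝ //
    (g : Matrix (Fin 3) (Fin 3) ℝ) * A * (g : Matrix (Fin 3) (Fin 3) ℝ)ᵀ = A ∧
    (g : Matrix (Fin 3) (Fin 3) ℝ) * B * (g : Matrix (Fin 3) (Fin 3) ℝ)ᵀ = B}

theorem card_pairStabilizer_of_real_diagonalization {A B Q : Matrix (Fin 3) (Fin 3) ℝ}
    {μ α : Fin 3 → ℝ} (h : IsPencilDiagonalization A B Q μ α) :
    Nat.card (PairStabilizer A B) = 4 := by
  have hQ : IsUnit Q := (isUnit_iff_isUnit_det _).mpr h.isUnit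
  choose f hf1 hf using fun g : PairStabilizer A B => (h.stabilizer_iff g.1).mp ⟨g.1.2, g.2⟩
  have hbij : Function.Bijective
      fun g => (⟨f g, hf1 g⟩ : {ε : Fin 3 → ℤˣ // ∏ i, ε i = 1}) := by
    constructor
    · intro g g' hgg
      have hε : f g = f g' := congrArg Subtype.val hgg
      exact Subtype.ext (Subtype.ext (hQ.mul_right_injective ((hf g).trans (hε ▸ (hf g').symm))))
    · rintro ⟨ε, hε⟩
      set D : Matrix (Fin 3) (Fin 3) ℝ := diagonal fun i => ((ε i : ℤ) : ℝ)
      have hM : Q * (Q⁻¹ * D * Q) = D * Q := by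
        rw [← Matrix.mul_assoc, ← Matrix.mul_assoc, mul_nonsing_inv _ h.isUnit, Matrix.one_mul]
      obtain ⟨hdet, hstab⟩ := (h.stabilizer_iff _).mpr ⟨ε, hε, hM⟩
      refine ⟨⟨⟨_, hdet⟩, hstab⟩, Subtype.ext ?_⟩
      have hD := hQ.mul_left_injective ((hf ⟨⟨_, hdet⟩, hstab⟩).symm.trans hM)
      funext i
      have hi := congrFun (diagonal_injective hD) i
      exact Units.ext (by exact_mod_cast hi)
  rw [Nat.card_eq_of_bijective _ hbij, Nat.card_eq_fintype_card]
  decide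

theorem card_pairStabilizer_of_conj_diagonalization {A B : Matrix (Fin 3) (Fin 3) ℝ}
    {Q : Matrix (Fin 3) (Fin 3) ℂ} {μ α : Fin 3 → ℂ}
    (h : IsPencilDiagonalization (A.map Complex.ofRealHom) (B.map Complex.ofRealHom) Q μ α)
    (hconj : ∀ i j, starRingEnd ℂ (Q i j) = Q (Equiv.swap 1 2 i) j) :
    Nat.card (PairStabilizer A B) = 2 := by
  have hQ : IsUnit Q := (isUnit_iff_isUnit_det _).mpr h.isUnit
  have hinj : Function.Injective
      fun M : Matrix (Fin 3) (Fin 3) ℝ => M.map Complex.ofRealHom :=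
    map_injective Complex.ofRealHom.injective
  choose f hf1 hf using fun g : PairStabilizer A B =>
    (h.stabilizer_iff (g.1.1.map Complex.ofRealHom)).mp
      ((stabilizer_map_iff _ A B g.1.1).mpr ⟨g.1.2, g.2⟩)
  have hf12 : ∀ g, f g 1 = f g 2 := fun g => by
    have hreal : (g.1.1.map Complex.ofRealHom).map (starRingEnd ℂ) =
        g.1.1.map Complex.ofRealHom := by
      ext i j
      exact Complex.conj_ofReal _
    have hM := mul_map_conj_eq_diagonal_mul hconj (hf g)
    rw [hreal, hf g] at hM
    have h1 := congrFun (diagonal_injective (hQ.mul_left_injective hM)) 1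
    simp only [Equiv.symm_swap, Equiv.swap_apply_left, map_intCast] at h1
    exact Units.ext (by exact_mod_cast h1)
  have hf0 : ∀ g, f g 0 = 1 := fun g => by
    have h1 := hf1 g
    rwa [Fin.prod_univ_three, hf12, mul_assoc, Int.units_mul_self, mul_one] at h1
  have hbij : Function.Bijective fun g => f g 1 := by
    constructor
    · intro g g' hgg
      have hε : f g = f g' := by
        funext i
        fin_cases i
        · exact (hf0 g).trans (hf0 g').symm
        · exact hgg
        · exact ((hf12 g).symm.trans hgg).trans (hf12 g')
      exact Subtype.ext (Subtype.ext (hinj (hQ.mul_right_injective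
        ((hf g).trans (hε ▸ (hf g').symm)))))
    · intro u
      set ε : Fin 3 → ℤˣ := ![1, u, u] with hε_def
      have hε : ∏ i, ε i = 1 := by simp [hε_def, Fin.prod_univ_three]
      set D : Matrix (Fin 3) (Fin 3) ℂ := diagonal fun i => ((ε i : ℤ) : ℂ)
      have hM : Q * (Q⁻¹ * D * Q) = D * Q := by
        rw [← Matrix.mul_assoc, ← Matrix.mul_assoc, mul_nonsing_inv _ h.isUnit, Matrix.one_mul]
      have hσ : ∀ i, ε (Equiv.swap 1 2 i) = ε i := by
        intro i
        fin_cases i <;> rfl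
      obtain ⟨N, hN⟩ := exists_map_ofReal_eq (M := Q⁻¹ * D * Q) (hQ.mul_right_injective (by
        have := mul_map_conj_eq_diagonal_mul hconj hM
        simp only [Equiv.symm_swap, hσ, map_intCast] at this
        exact this.trans hM.symm))
      rw [← hN] at hM
      obtain ⟨hdet, hstab⟩ := (stabilizer_map_iff _ A B N).mp
        ((h.stabilizer_iff _).mpr ⟨ε, hε, hM⟩)
      refine ⟨⟨⟨N, hdet⟩, hstab⟩, ?_⟩
      have hD := hQ.mul_left_injective ((hf ⟨⟨N, hdet⟩, hstab⟩).symm.trans hM)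
      have h1 := congrFun (diagonal_injective hD) 1
      exact Units.ext (by exact_mod_cast h1)
  rw [Nat.card_eq_of_bijective _ hbij, Nat.card_eq_fintype_card]
  decide

theorem exists_conj_diagonalization {A B : Matrix (Fin 3) (Fin 3) ℝ} (hA : A.IsSymm)
    (hB : B.IsSymm) (hdet : A.det ≠ 0) {x : ℝ} {z : ℂ} (hz : z.im ≠ 0)
    (hx : (x • A - B).det = 0)
    (hzroot : (z • A.map Complex.ofRealHom - B.map Complex.ofRealHom).det = 0) :
    ∃ Q μ α, IsPencilDiagonalization (A.map Complex.ofRealHom) (B.map Complex.ofRealHom) Q μ α ∧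
      ∀ i j, starRingEnd ℂ (Q i j) = Q (Equiv.swap 1 2 i) j := by
  obtain ⟨v, hv0, hv⟩ := exists_vecMul_eq_zero_iff.mpr hx
  obtain ⟨w, hw0, hw⟩ := exists_vecMul_eq_zero_iff.mpr hzroot
  set v' : Fin 3 → ℂ := fun j => (v j : ℂ) with hv'
  set w' : Fin 3 → ℂ := fun j => starRingEnd ℂ (w j) with hw'
  have hdet' : (A.map Complex.ofRealHom).det ≠ 0 := by
    rw [← RingHom.mapMatrix_apply, ← RingHom.map_det]
    simpa using hdet
  have hμ : Function.Injective ![(x : ℂ), z, starRingEnd ℂ z] := by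
    have h1 : (x : ℂ) ≠ z := fun h => hz (by rw [← h, Complex.ofReal_im])
    have h2 : (x : ℂ) ≠ starRingEnd ℂ z := fun h => hz (by
      have := congrArg Complex.im h
      simpa using this)
    have h3 : z ≠ starRingEnd ℂ z := fun h => hz (Complex.conj_eq_iff_im.mp h.symm)
    intro i j
    fin_cases i <;> fin_cases j <;> simp [h1, h2, h3, h1.symm, h2.symm, h3.symm]
  have hv0' : v' ≠ 0 := fun h => hv0 (funext fun j => by
    have := congrFun h j
    simpa [hv'] using this)
  have hw0' : w' ≠ 0 := fun h => hw0 (funext fun j => by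
    have := congrFun h j
    simpa [hw'] using this)
  have hvv : v' ᵥ* ((x : ℂ) • A.map Complex.ofRealHom - B.map Complex.ofRealHom) = 0 := by
    funext j
    have := congrArg Complex.ofRealHom (congrFun hv j)
    simpa [vecMul, dotProduct, hv'] using this
  have hww : w' ᵥ* (starRingEnd ℂ z • A.map Complex.ofRealHom - B.map Complex.ofRealHom) = 0 := by
    funext j
    have := congrArg (starRingEnd ℂ) (congrFun hw j)
    simpa [vecMul, dotProduct, hw'] using this
  obtain ⟨α, hα⟩ := isPencilDiagonalization_of_eigenvectors (v := ![v', w, w'])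
    (hA.map _) (hB.map _) hdet' hμ
    (by intro i; fin_cases i; exacts [hv0', hw0, hw0'])
    (by intro i; fin_cases i; exacts [hvv, hw, hww])
  refine ⟨_, _, α, hα, fun i j => ?_⟩
  fin_cases i
  · exact Complex.conj_ofReal _
  · rfl
  · exact Complex.conj_conj _

theorem card_pairStabilizer_of_leadingCoeff_ne_zero
    {A B : Matrix (Fin 3) (Fin 3) ℝ} (hA : A.IsSymm) (hB : B.IsSymm) {a b c d : ℝ} (ha : a ≠ 0)
    (hres : ∀ x y : ℝ, 4 * (x • A - y • B).det =
      a * x ^ 3 + b * x ^ 2 * y + c * x * y ^ 2 + d * y ^ 3) :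
    (0 < b ^ 2 * c ^ 2 - 4 * a * c ^ 3 - 4 * b ^ 3 * d - 27 * a ^ 2 * d ^ 2
        + 18 * a * b * c * d → Nat.card (PairStabilizer A B) = 4) ∧
    (b ^ 2 * c ^ 2 - 4 * a * c ^ 3 - 4 * b ^ 3 * d - 27 * a ^ 2 * d ^ 2
        + 18 * a * b * c * d < 0 → Nat.card (PairStabilizer A B) = 2) := by
  have hdet : A.det ≠ 0 := fun h => ha (by
    have h1 := hres 1 0
    rw [one_smul, zero_smul, sub_zero, h] at h1
    linear_combination -h1)
  have hroot : ∀ {x : ℝ}, a * x ^ 3 + b * x ^ 2 + c * x + d = 0 → (x • A - B).det = 0 := by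
    intro x hx
    have h1 := hres x 1
    rw [one_smul] at h1
    linear_combination h1 / 4 + hx / 4
  refine ⟨fun hΔ => ?_, fun hΔ => ?_⟩
  · obtain ⟨μ, hμ, hμroot⟩ := exists_three_roots_of_discr_pos ha hΔ
    obtain ⟨Q, α, h⟩ := exists_isPencilDiagonalization hA hB hdet hμ fun i => hroot (hμroot i)
    exact card_pairStabilizer_of_real_diagonalization h
  · obtain ⟨x, z, hz, hx, hzroot⟩ := exists_roots_of_discr_neg ha hΔ
    have hzdet : (z • A.map Complex.ofRealHom - B.map Complex.ofRealHom).det = 0 := by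
      have h1 := four_mul_det_pencil_map Complex.ofRealHom hres z 1
      rw [one_smul] at h1
      simp only [Complex.ofRealHom_eq_coe] at h1
      linear_combination h1 / 4 + hzroot / 4
    obtain ⟨Q, μ, α, h, hconj⟩ := exists_conj_diagonalization hA hB hdet hz (hroot hx) hzdet
    exact card_pairStabilizer_of_conj_diagonalization h hconj

/-- A pencil and its translate have the same stabilizer. -/
theorem stabilizer_sub_smul_iff {n K : Type*} [Fintype n] [Field K] (A B g : Matrix n n K)
    (t : K) : (g * (A - t • B) * gᵀ = A - t • B ∧ g * B * gᵀ = B) ↔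
      (g * A * gᵀ = A ∧ g * B * gᵀ = B) :=
  and_congr_left fun h => by
    rw [Matrix.mul_sub, Matrix.sub_mul, Matrix.mul_smul, Matrix.smul_mul, h, sub_left_inj]

/-- Lemma 21 of the paper: let `(A, B)` be a pair of symmetric
real `3×3` matrices (Gram matrices of real ternary quadratic forms), and suppose the
cubic resolvent form `Res(A,B)(x,y) = 4·det(Ax - By) = ax³ + bx²y + cxy² + dy³` has
discriminant `Δ ≠ 0`.  Then the stabilizer of `(A, B)` under the action
`g·(A,B) = (gAgᵀ, gBgᵀ)` of SL₃(ℝ) has exactly 4 elements if `Δ > 0` and exactly 2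
elements if `Δ < 0`. -/
theorem stabilizer_card_of_pair_of_TQFs
    (A B : Matrix (Fin 3) (Fin 3) ℝ) (hA : A.IsSymm) (hB : B.IsSymm)
    (a b c d : ℝ)
    (hres : ∀ x y : ℝ, 4 * (x • A - y • B).det =
      a * x ^ 3 + b * x ^ 2 * y + c * x * y ^ 2 + d * y ^ 3) :
    (0 < b ^ 2 * c ^ 2 - 4 * a * c ^ 3 - 4 * b ^ 3 * d - 27 * a ^ 2 * d ^ 2
        + 18 * a * b * c * d →
      Nat.card {g : Matrix.SpecialLinearGroup (Fin 3) ℝ //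
        (g : Matrix (Fin 3) (Fin 3) ℝ) * A * (g : Matrix (Fin 3) (Fin 3) ℝ)ᵀ = A ∧
        (g : Matrix (Fin 3) (Fin 3) ℝ) * B * (g : Matrix (Fin 3) (Fin 3) ℝ)ᵀ = B} = 4) ∧
    (b ^ 2 * c ^ 2 - 4 * a * c ^ 3 - 4 * b ^ 3 * d - 27 * a ^ 2 * d ^ 2
        + 18 * a * b * c * d < 0 →
      Nat.card {g : Matrix.SpecialLinearGroup (Fin 3) ℝ //
        (g : Matrix (Fin 3) (Fin 3) ℝ) * A * (g : Matrix (Fin 3) (Fin 3) ℝ)ᵀ = A ∧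
        (g : Matrix (Fin 3) (Fin 3) ℝ) * B * (g : Matrix (Fin 3) (Fin 3) ℝ)ᵀ = B} = 2) := by
  obtain hΔ | hΔ := eq_or_ne (b ^ 2 * c ^ 2 - 4 * a * c ^ 3 - 4 * b ^ 3 * d - 27 * a ^ 2 * d ^ 2
      + 18 * a * b * c * d) 0
  · simp [hΔ]
  obtain ⟨t, ht⟩ : ∃ t : ℝ, a + b * t + c * t ^ 2 + d * t ^ 3 ≠ 0 := by
    by_contra! h
    have h0 := h 0
    have h1 := h 1
    have h2 := h (-1)
    have h3 := h 2
    have hc : c = 0 := by linarith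
    have hb : b = 0 := by linarith
    have ha : a = 0 := by linarith
    exact hΔ (by rw [ha, hb, hc]; ring)
  have key := card_pairStabilizer_of_leadingCoeff_ne_zero (A := A - t • B) (hA.sub (hB.smul t)) hB
    (b := b + 2 * c * t + 3 * d * t ^ 2) (c := c + 3 * d * t) (d := d) ht fun x y => by
      rw [show x • (A - t • B) - y • B = x • A - (x * t + y) • B by module, hres]
      ring
  simp only [PairStabilizer, stabilizer_sub_smul_iff] at key
  convert key using 3 <;> ring
end
end

section
/- Let f(x, y) be a real binary cubic form with Δ(f) ≠ 0 and positive x³-coefficient, and let W_f := {(A, B) ∈ V(ℝ) : det(A) > 0 and 4·det(Ax − By) = f(x, y)}. (a) If Δ(f) > 0, then W_f is the union of exactly four SL₃(ℝ)-orbits: exactly one orbit consists of pairs (A, B) for which the conics A = 0 and B = 0 have four common points in ℙ²(ℝ), and the other three orbits consist of pairs with no common zero in ℙ²(ℝ). (b) If Δ(f) < 0, then W_f is a single SL₃(ℝ)-orbit, consisting of pairs whose conics have exactly two common points in ℙ²(ℝ). -/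
/-!
Statement 12: SL₃(ℝ)-orbits on pairs of real ternary quadratic forms `(A, B)` with
`det A > 0` and fixed nondegenerate cubic resolvent `f` with positive leading
coefficient: four orbits when `Δ(f) > 0` (one with 4 common real projective zeros,
three with none), one orbit when `Δ(f) < 0` (with 2 common real projective zeros).
-/

open Matrix

noncomputable section

/-- The set `W_f` of pairs of symmetric real `3×3` Gram matrices `(A, B)` with
`det A > 0` and cubic resolvent `4·det(Ax - By) = ax³ + bx²y + cxy² + dy³`. -/
def Wf (a b c d : ℝ) : Set (Matrix (Fin 3) (Fin 3) ℝ × Matrix (Fin 3) (Fin 3) ℝ) :=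
  {p | p.1.IsSymm ∧ p.2.IsSymm ∧ 0 < p.1.det ∧
    ∀ x y : ℝ, 4 * (x • p.1 - y • p.2).det =
      a * x ^ 3 + b * x ^ 2 * y + c * x * y ^ 2 + d * y ^ 3}

/-- SL₃(ℝ)-equivalence on `W_f`: `g·(A, B) = (gAgᵀ, gBgᵀ)`. -/
def sl3RealRel (a b c d : ℝ) (p q : Wf a b c d) : Prop :=
  ∃ g : Matrix.SpecialLinearGroup (Fin 3) ℝ,
    (g : Matrix (Fin 3) (Fin 3) ℝ) * p.1.1 * (g : Matrix (Fin 3) (Fin 3) ℝ)ᵀ = q.1.1 ∧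
    (g : Matrix (Fin 3) (Fin 3) ℝ) * p.1.2 * (g : Matrix (Fin 3) (Fin 3) ℝ)ᵀ = q.1.2

/-- The number of common zeros in `ℙ²(ℝ)` of the two quadratic forms of the pair. -/
def numCommonProjZeros
    (p : Matrix (Fin 3) (Fin 3) ℝ × Matrix (Fin 3) (Fin 3) ℝ) : ℕ :=
  Set.ncard {v : Projectivization ℝ (Fin 3 → ℝ) |
    v.rep ⬝ᵥ p.1.mulVec v.rep = 0 ∧ v.rep ⬝ᵥ p.2.mulVec v.rep = 0}

theorem exists_real_root_of_cubic {a : ℝ} (ha : 0 < a) (b c d : ℝ) :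
    ∃ r : ℝ, a * r ^ 3 + b * r ^ 2 + c * r + d = 0 := by
  set S := |b| + |c| + |d| with hS
  have hb := abs_nonneg b
  have hc := abs_nonneg c
  have hd := abs_nonneg d
  set R := 1 + S / a with hR
  have haR : a * (R - 1) = S := by rw [hR]; field_simp; ring
  have hR1 : 1 ≤ R := by
    have : 0 ≤ S / a := by positivity
    linarith
  have key : |b| * R ^ 2 + |c| * R + |d| < a * R ^ 3 := by
    have h1 : a * R ^ 3 = S * R ^ 2 + a * R ^ 2 := by linear_combination R ^ 2 * haR
    have h2 : R ≤ R ^ 2 := by nlinarith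
    have h3 : |c| * R ≤ |c| * R ^ 2 := mul_le_mul_of_nonneg_left h2 hc
    have h4 : |d| * 1 ≤ |d| * R ^ 2 := mul_le_mul_of_nonneg_left (hR1.trans h2) hd
    have h5 : 0 < a * R ^ 2 := by positivity
    rw [h1, hS]
    nlinarith
  have hbR := abs_le.mp (le_of_eq (abs_mul b (R ^ 2)))
  have hcR := abs_le.mp (le_of_eq (abs_mul c R))
  rw [abs_of_nonneg (sq_nonneg R)] at hbR
  rw [abs_of_nonneg (by linarith : (0 : ℝ) ≤ R)] at hcR
  have hd' := abs_le.mp (le_refl |d|)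
  have hcont : ContinuousOn (fun r : ℝ => a * r ^ 3 + b * r ^ 2 + c * r + d)
      (Set.Icc (-R) R) := by fun_prop
  obtain ⟨r, -, hr⟩ := intermediate_value_Icc (by linarith : -R ≤ R) hcont
    (show (0 : ℝ) ∈ Set.Icc _ _ from ⟨by nlinarith, by nlinarith⟩)
  exact ⟨r, hr⟩

theorem discr_eq_of_root {a b c d r : ℝ} (hr : a * r ^ 3 + b * r ^ 2 + c * r + d = 0) :
    b ^ 2 * c ^ 2 - 4 * a * c ^ 3 - 4 * b ^ 3 * d - 27 * a ^ 2 * d ^ 2 + 18 * a * b * c * d =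
      ((b + a * r) ^ 2 - 4 * a * (c + b * r + a * r ^ 2)) *
        (3 * a * r ^ 2 + 2 * b * r + c) ^ 2 := by
  obtain rfl : d = -(a * r ^ 3 + b * r ^ 2 + c * r) := by linarith
  ring

theorem exists_three_real_roots {a b c d : ℝ} (ha : 0 < a)
    (hΔ : 0 < b ^ 2 * c ^ 2 - 4 * a * c ^ 3 - 4 * b ^ 3 * d - 27 * a ^ 2 * d ^ 2
      + 18 * a * b * c * d) :
    ∃ l₁ l₂ l₃ : ℝ, l₁ < l₂ ∧ l₂ < l₃ ∧ b = -a * (l₁ + l₂ + l₃) ∧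
      c = a * (l₁ * l₂ + l₁ * l₃ + l₂ * l₃) ∧ d = -a * (l₁ * l₂ * l₃) := by
  obtain ⟨r, hr⟩ := exists_real_root_of_cubic ha b c d
  rw [discr_eq_of_root hr] at hΔ
  set e := (b + a * r) ^ 2 - 4 * a * (c + b * r + a * r ^ 2) with he
  have he0 : 0 < e := pos_of_mul_pos_left hΔ (sq_nonneg _)
  have hne : 3 * a * r ^ 2 + 2 * b * r + c ≠ 0 := by
    rintro h
    rw [h] at hΔ
    simp at hΔ
  obtain ⟨s, hs0, hs⟩ : ∃ s : ℝ, 0 < s ∧ s ^ 2 = e :=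
    ⟨√e, Real.sqrt_pos.mpr he0, Real.sq_sqrt he0.le⟩
  obtain ⟨u, hu⟩ : ∃ u : ℝ, 2 * a * u = -(b + a * r) - s :=
    ⟨(-(b + a * r) - s) / (2 * a), by field_simp⟩
  obtain ⟨v, hv⟩ : ∃ v : ℝ, 2 * a * v = -(b + a * r) + s :=
    ⟨(-(b + a * r) + s) / (2 * a), by field_simp⟩
  have huv : u < v := by nlinarith
  have hb : b = -a * (r + u + v) := by linear_combination (1 / 2) * hu + (1 / 2) * hv
  have hc : c = a * (r * u + r * v + u * v) := by
    have h4 : 4 * a * c = 4 * a * (a * (r * u + r * v + u * v)) := by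
      linear_combination (-2 * a * r - 2 * a * v) * hu +
        (-2 * a * r + (b + a * r) + s) * hv + hs + he
    exact mul_left_cancel₀ (by positivity) h4
  have hd : d = -a * (r * u * v) := by
    linear_combination hr - r ^ 2 * hb - r * hc
  have hne' : a * ((r - u) * (r - v)) ≠ 0 := by
    intro h
    apply hne
    linear_combination h + 2 * r * hb + hc
  have hru : r ≠ u := by rintro rfl; simp at hne'
  have hrv : r ≠ v := by rintro rfl; simp at hne'
  rcases lt_or_gt_of_ne hru with h1 | h1
  · exact ⟨r, u, v, h1, huv, hb, hc, by linear_combination hd⟩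
  rcases lt_or_gt_of_ne hrv with h2 | h2
  · exact ⟨u, r, v, h1, h2, by linear_combination hb, by linear_combination hc,
      by linear_combination hd⟩
  · exact ⟨u, v, r, huv, h2, by linear_combination hb, by linear_combination hc,
      by linear_combination hd⟩

theorem exists_real_root_and_conjugate_roots {a b c d : ℝ} (ha : 0 < a)
    (hΔ : b ^ 2 * c ^ 2 - 4 * a * c ^ 3 - 4 * b ^ 3 * d - 27 * a ^ 2 * d ^ 2
      + 18 * a * b * c * d < 0) :
    ∃ l m n : ℝ, 0 < n ∧ b = -a * (l + 2 * m) ∧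
      c = a * (2 * m * l + (m ^ 2 + n ^ 2)) ∧ d = -a * (l * (m ^ 2 + n ^ 2)) := by
  obtain ⟨r, hr⟩ := exists_real_root_of_cubic ha b c d
  rw [discr_eq_of_root hr] at hΔ
  set e := (b + a * r) ^ 2 - 4 * a * (c + b * r + a * r ^ 2) with he
  have he0 : 0 < -e := by
    by_contra h
    exact absurd hΔ (not_lt.mpr (mul_nonneg (by linarith) (sq_nonneg _)))
  obtain ⟨s, hs0, hs⟩ : ∃ s : ℝ, 0 < s ∧ s ^ 2 = -e :=
    ⟨√(-e), Real.sqrt_pos.mpr he0, Real.sq_sqrt he0.le⟩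
  obtain ⟨m, hm⟩ : ∃ m : ℝ, 2 * a * m = -(b + a * r) := ⟨-(b + a * r) / (2 * a), by field_simp⟩
  obtain ⟨n, hn⟩ : ∃ n : ℝ, 2 * a * n = s := ⟨s / (2 * a), by field_simp⟩
  have hb : b = -a * (r + 2 * m) := by linear_combination hm
  have hc : c = a * (2 * m * r + (m ^ 2 + n ^ 2)) := by
    have h4 : 4 * a * c = 4 * a * (a * (2 * m * r + (m ^ 2 + n ^ 2))) := by
      linear_combination (-4 * a * r - (2 * a * m - (b + a * r))) * hm
        - (2 * a * n + s) * hn - hs + he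
    exact mul_left_cancel₀ (by positivity) h4
  refine ⟨r, m, n, by nlinarith, hb, hc, ?_⟩
  linear_combination hr - r ^ 2 * hb - r * hc

section Pencil

variable {K : Type*} [Field K] {n : Type*} [Fintype n]

/-- Generalized eigenvectors of a symmetric pencil for distinct eigenvalues are orthogonal. -/
theorem dotProduct_mulVec_eq_zero_of_pencil {A B : Matrix n n K} (hA : A.IsSymm) (hB : B.IsSymm)
    {v w : n → K} {l m : K} (hlm : l ≠ m) (hv : B *ᵥ v = l • A *ᵥ v) (hw : B *ᵥ w = m • A *ᵥ w) :
    v ⬝ᵥ A *ᵥ w = 0 := by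
  have symm : ∀ {M : Matrix n n K}, M.IsSymm → v ⬝ᵥ M *ᵥ w = w ⬝ᵥ M *ᵥ v := by
    intro M hM
    rw [dotProduct_mulVec, dotProduct_comm, ← mulVec_transpose, hM.eq]
  have h := symm hB
  rw [hv, hw, dotProduct_smul, dotProduct_smul, ← symm hA, smul_eq_mul, smul_eq_mul] at h
  have : (l - m) * (v ⬝ᵥ A *ᵥ w) = 0 := by linear_combination -h
  exact (mul_eq_zero.mp this).resolve_left (sub_ne_zero.mpr hlm)

/-- Generalized eigenvectors of a pencil for distinct eigenvalues are linearly independent. -/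
theorem det_ne_zero_of_pencil [DecidableEq n] {A B : Matrix n n K} (hA : A.det ≠ 0)
    {V : Matrix n n K} {l : n → K} (hl : Function.Injective l) (hV : ∀ i, V i ≠ 0)
    (h : ∀ i, B *ᵥ V i = l i • A *ᵥ V i) : V.det ≠ 0 := by
  have hA' : IsUnit A.det := isUnit_iff_ne_zero.mpr hA
  have hli : LinearIndependent K V.row := by
    refine Module.End.eigenvectors_linearIndependent' (toLin' (A⁻¹ * B)) l hl V fun i => ?_
    rw [Module.End.hasEigenvector_iff, Module.End.mem_eigenspace_iff]
    refine ⟨?_, hV i⟩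
    rw [toLin'_apply, ← mulVec_mulVec, h i, mulVec_smul, mulVec_mulVec, nonsing_inv_mul _ hA',
      one_mulVec]
  exact isUnit_iff_ne_zero.mp ((isUnit_iff_isUnit_det V).mp
    (linearIndependent_rows_iff_isUnit.mp hli))

theorem mul_mul_transpose_apply (V A : Matrix n n K) (i j : n) :
    (V * A * Vᵀ) i j = V i ⬝ᵥ A *ᵥ V j := by
  rw [mul_assoc, mul_apply]
  rfl

/-- Generalized eigenvectors of a symmetric nondegenerate pencil are not isotropic. -/
theorem dotProduct_mulVec_ne_zero_of_pencil [DecidableEq n] {A B : Matrix n n K} (hA : A.det ≠ 0)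
    (hAs : A.IsSymm) (hBs : B.IsSymm)
    {V : Matrix n n K} {l : n → K} (hl : Function.Injective l) (hV : ∀ i, V i ≠ 0)
    (h : ∀ i, B *ᵥ V i = l i • A *ᵥ V i) (i : n) : V i ⬝ᵥ A *ᵥ V i ≠ 0 := by
  intro h0
  have hdet : (V * A * Vᵀ).det ≠ 0 := by
    have := det_ne_zero_of_pencil hA hl hV h
    simp [this, hA]
  apply hdet
  apply det_eq_zero_of_row_eq_zero i
  intro j
  rw [mul_mul_transpose_apply]
  by_cases hij : i = j
  · rw [← hij, h0]
  · exact dotProduct_mulVec_eq_zero_of_pencil hAs hBs (hl.ne hij) (h i) (h j)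

theorem exists_eigenvector_of_pencil [DecidableEq n] {A B : Matrix n n K} {l : K}
    (h : (l • A - B).det = 0) : ∃ v : n → K, v ≠ 0 ∧ B *ᵥ v = l • A *ᵥ v := by
  obtain ⟨v, hv, hv0⟩ := exists_mulVec_eq_zero_iff.mpr h
  refine ⟨v, hv, ?_⟩
  rw [sub_mulVec, smul_mulVec, sub_eq_zero] at hv0
  exact hv0.symm

end Pencil

theorem sl3RealRel_iff {a b c d : ℝ} {p q : Wf a b c d} :
    sl3RealRel a b c d p q ↔ ∃ g : Matrix (Fin 3) (Fin 3) ℝ, g.det = 1 ∧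
      g * p.1.1 * gᵀ = q.1.1 ∧ g * p.1.2 * gᵀ = q.1.2 :=
  ⟨fun ⟨g, hA, hB⟩ => ⟨g, g.2, hA, hB⟩, fun ⟨g, hg, hA, hB⟩ => ⟨⟨g, hg⟩, hA, hB⟩⟩

theorem sl3RealRel_equivalence (a b c d : ℝ) : Equivalence (sl3RealRel a b c d) where
  refl p := sl3RealRel_iff.mpr ⟨1, by simp, by simp, by simp⟩
  symm := by
    intro p q hpq
    obtain ⟨g, hg, hA, hB⟩ := sl3RealRel_iff.mp hpq
    have hinv : g⁻¹ * g = 1 := nonsing_inv_mul _ (by simp [hg])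
    have key : ∀ M N : Matrix (Fin 3) (Fin 3) ℝ, g * M * gᵀ = N → g⁻¹ * N * g⁻¹ᵀ = M := by
      rintro M N rfl
      calc g⁻¹ * (g * M * gᵀ) * g⁻¹ᵀ
          = (g⁻¹ * g) * M * (g⁻¹ * g)ᵀ := by simp only [transpose_mul, mul_assoc]
        _ = M := by simp [hinv]
    exact sl3RealRel_iff.mpr ⟨g⁻¹, by simp [det_nonsing_inv, hg], key _ _ hA, key _ _ hB⟩
  trans := by
    intro p q r hpq hqr
    obtain ⟨g, hg, hA, hB⟩ := sl3RealRel_iff.mp hpq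
    obtain ⟨h, hh, hA', hB'⟩ := sl3RealRel_iff.mp hqr
    refine sl3RealRel_iff.mpr ⟨h * g, by simp [hg, hh], ?_, ?_⟩
    · rw [← hA', ← hA]
      simp only [transpose_mul, mul_assoc]
    · rw [← hB', ← hB]
      simp only [transpose_mul, mul_assoc]

theorem dotProduct_mulVec_mul_mul_transpose {n R : Type*} [Fintype n] [CommRing R]
    (g M : Matrix n n R) (v : n → R) :
    v ⬝ᵥ (g * M * gᵀ) *ᵥ v = (gᵀ *ᵥ v) ⬝ᵥ M *ᵥ (gᵀ *ᵥ v) := by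
  rw [← mulVec_mulVec, ← mulVec_mulVec, dotProduct_mulVec, ← mulVec_transpose]

/-- If every nonzero common zero of the two forms is proportional to exactly one of the
vectors `w i`, then the common zeros are counted by the index type. -/
theorem numCommonProjZeros_eq_card {p : Matrix (Fin 3) (Fin 3) ℝ × Matrix (Fin 3) (Fin 3) ℝ}
    {ι : Type*} [Fintype ι] (w : ι → Fin 3 → ℝ) (hw : ∀ i, w i ≠ 0)
    (hA : ∀ i, w i ⬝ᵥ p.1 *ᵥ w i = 0) (hB : ∀ i, w i ⬝ᵥ p.2 *ᵥ w i = 0)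
    (hinj : ∀ i j (t : ℝ), t • w j = w i → i = j)
    (hsurj : ∀ v : Fin 3 → ℝ, v ≠ 0 → v ⬝ᵥ p.1 *ᵥ v = 0 → v ⬝ᵥ p.2 *ᵥ v = 0 →
      ∃ i, ∃ t : ℝ, t • w i = v) :
    numCommonProjZeros p = Fintype.card ι := by
  have hset : {v : Projectivization ℝ (Fin 3 → ℝ) |
      v.rep ⬝ᵥ p.1.mulVec v.rep = 0 ∧ v.rep ⬝ᵥ p.2.mulVec v.rep = 0} =
      (fun i => Projectivization.mk ℝ (w i) (hw i)) '' Set.univ := by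
    ext v
    simp only [Set.mem_ofPred_eq, Set.image_univ, Set.mem_range]
    constructor
    · rintro ⟨h1, h2⟩
      obtain ⟨i, t, h⟩ := hsurj v.rep v.rep_nonzero h1 h2
      refine ⟨i, ?_⟩
      rw [← v.mk_rep, eq_comm, Projectivization.mk_eq_mk_iff']
      exact ⟨t, h⟩
    · rintro ⟨i, rfl⟩
      obtain ⟨t, ht⟩ := Projectivization.exists_smul_eq_mk_rep ℝ (w i) (hw i)
      rw [← ht, Units.smul_def]
      simp [mulVec_smul, hA, hB]
  rw [numCommonProjZeros, hset, Set.ncard_image_of_injective, Set.ncard_univ,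
    Nat.card_eq_fintype_card]
  intro i j hij
  obtain ⟨t, ht⟩ := (Projectivization.mk_eq_mk_iff' ℝ _ _ _ _).mp hij
  exact hinj i j t ht

/-- The number of common zeros is unchanged by invertible substitutions. -/
theorem numCommonProjZeros_mul_mul_transpose {g : Matrix (Fin 3) (Fin 3) ℝ} (hg : g.det ≠ 0)
    (A B : Matrix (Fin 3) (Fin 3) ℝ) :
    numCommonProjZeros (g * A * gᵀ, g * B * gᵀ) = numCommonProjZeros (A, B) := by
  have hunit : IsUnit gᵀ.det := by rw [det_transpose]; exact isUnit_iff_ne_zero.mpr hg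
  have hinj : Function.Injective (toLin' gᵀ) := by
    rw [toLin'_apply']
    exact mulVec_injective_iff_isUnit.mpr ((isUnit_iff_isUnit_det _).mpr hunit)
  have hzero : ∀ (M : Matrix (Fin 3) (Fin 3) ℝ) (v : Projectivization ℝ (Fin 3 → ℝ)),
      v.rep ⬝ᵥ (g * M * gᵀ) *ᵥ v.rep = 0 ↔
        (v.map (toLin' gᵀ) hinj).rep ⬝ᵥ M *ᵥ (v.map (toLin' gᵀ) hinj).rep = 0 := by
    intro M v
    have hv : toLin' gᵀ v.rep ≠ 0 := fun h => v.rep_nonzero (hinj (by rw [h, map_zero]))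
    have hmap : v.map (toLin' gᵀ) hinj = Projectivization.mk ℝ (toLin' gᵀ v.rep) hv := by
      conv_lhs => rw [← v.mk_rep]
      rw [Projectivization.map_mk]
    obtain ⟨t, ht⟩ := Projectivization.exists_smul_eq_mk_rep ℝ (toLin' gᵀ v.rep) hv
    rw [hmap, ← ht, dotProduct_mulVec_mul_mul_transpose, Units.smul_def, toLin'_apply]
    simp [mulVec_smul]
  have hsurj : Function.Surjective (Projectivization.map (toLin' gᵀ) hinj) := by
    intro u
    have hu : toLin' gᵀ (gᵀ⁻¹ *ᵥ u.rep) = u.rep := by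
      rw [toLin'_apply, mulVec_mulVec, mul_nonsing_inv _ hunit, one_mulVec]
    have hne : gᵀ⁻¹ *ᵥ u.rep ≠ 0 := by
      intro h
      rw [h, map_zero] at hu
      exact u.rep_nonzero hu.symm
    refine ⟨Projectivization.mk ℝ _ hne, ?_⟩
    rw [Projectivization.map_mk]
    conv_rhs => rw [← u.mk_rep]
    congr 1
  simp only [numCommonProjZeros, hzero]
  rw [← Set.ncard_image_of_injective _ (Projectivization.map_injective (toLin' gᵀ) hinj)]
  congr 1
  ext u
  constructor
  · rintro ⟨v, hv, rfl⟩
    exact hv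
  · intro hu
    obtain ⟨v, rfl⟩ := hsurj u
    exact ⟨v, hu, rfl⟩

theorem numCommonProjZeros_eq_of_rel {a b c d : ℝ} {p q : Wf a b c d}
    (h : sl3RealRel a b c d p q) : numCommonProjZeros p.1 = numCommonProjZeros q.1 := by
  obtain ⟨g, hg, hA, hB⟩ := sl3RealRel_iff.mp h
  have := numCommonProjZeros_mul_mul_transpose (g := g) (by simp [hg]) p.1.1 p.1.2
  rw [hA, hB] at this
  exact this.symm

/-- A congruence taking `A` to a matrix of determinant one can be rescaled to have
determinant one. -/
theorem exists_det_eq_one_of_congruence {k : ℝ} (hk : 0 < k)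
    {A B P D E : Matrix (Fin 3) (Fin 3) ℝ} (hA : A.det = k ^ 3) (hD : D.det = 1)
    (hPA : P * A * Pᵀ = D) (hPB : P * B * Pᵀ = E) :
    ∃ g : Matrix (Fin 3) (Fin 3) ℝ, g.det = 1 ∧ g * A * gᵀ = k • D ∧ g * B * gᵀ = k • E := by
  have hs : √k ^ 2 = k := Real.sq_sqrt hk.le
  have hdet : (√k ^ 3 * P.det) ^ 2 = 1 := by
    have h := congrArg det hPA
    rw [det_mul, det_mul, det_transpose, hA, hD] at h
    linear_combination h + P.det ^ 2 * (k ^ 2 + k * √k ^ 2 + √k ^ 4) * hs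
  obtain ⟨t, ht, htP⟩ : ∃ t : ℝ, t ^ 2 = k ∧ t ^ 3 * P.det = 1 := by
    rcases eq_or_eq_neg_of_sq_eq_sq _ _ (hdet.trans (one_pow 2).symm) with h | h
    · exact ⟨√k, hs, h⟩
    · exact ⟨-√k, by rw [neg_sq, hs], by linear_combination -h⟩
  refine ⟨t • P, by rw [det_smul]; simpa using htP, ?_, ?_⟩
  · rw [← hPA, ← ht]
    simp [smul_smul, sq]
  · rw [← hPB, ← ht]
    simp [smul_smul, sq]

/-- The resolvent identity of a pair in `W_f` persists over `ℂ`. -/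
theorem complex_resolvent {a b c d : ℝ} (p : Wf a b c d) (x y : ℂ) :
    4 * (x • p.1.1.map Complex.ofReal - y • p.1.2.map Complex.ofReal).det =
      a * x ^ 3 + b * x ^ 2 * y + c * x * y ^ 2 + d * y ^ 3 := by
  obtain ⟨⟨A, B⟩, -, -, -, h⟩ := p
  have h10 := congrArg (Complex.ofReal) (h 1 0)
  have h01 := congrArg (Complex.ofReal) (h 0 1)
  have h11 := congrArg (Complex.ofReal) (h 1 1)
  have h1n := congrArg (Complex.ofReal) (h 1 (-1))
  simp only [det_fin_three, Matrix.sub_apply, Matrix.smul_apply, smul_eq_mul,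
    Matrix.map_apply] at h10 h01 h11 h1n ⊢
  push_cast at h10 h01 h11 h1n
  linear_combination (x ^ 3 - x * y ^ 2) * h10 + (y ^ 3 - x ^ 2 * y) * h01 +
    ((x ^ 2 * y + x * y ^ 2) / 2) * h11 + ((x * y ^ 2 - x ^ 2 * y) / 2) * h1n

/-- The diagonal pair with Gram matrices `k·diag(e)` and `k·diag(l e)`. -/
def diagPair (k : ℝ) (l e : Fin 3 → ℝ) :
    Matrix (Fin 3) (Fin 3) ℝ × Matrix (Fin 3) (Fin 3) ℝ :=
  (k • diagonal e, k • diagonal fun i => l i * e i)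

/-- The four sign patterns with product one. -/
def signs : Fin 4 → Fin 3 → ℝ :=
  ![![1, 1, 1], ![1, -1, -1], ![-1, 1, -1], ![-1, -1, 1]]

theorem signs_prod (i : Fin 4) : signs i 0 * signs i 1 * signs i 2 = 1 := by
  fin_cases i <;> simp [signs]

theorem exists_signs_eq {e : Fin 3 → ℝ} (he : ∀ i, e i = 1 ∨ e i = -1)
    (hprod : 0 < e 0 * e 1 * e 2) : ∃ i, signs i = e := by
  rcases he 0 with h0 | h0 <;> rcases he 1 with h1 | h1 <;> rcases he 2 with h2 | h2 <;>
    rw [h0, h1, h2] at hprod <;> norm_num at hprod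
  · exact ⟨0, by ext j; fin_cases j <;> simp [signs, h0, h1, h2]⟩
  · exact ⟨1, by ext j; fin_cases j <;> simp [signs, h0, h1, h2]⟩
  · exact ⟨2, by ext j; fin_cases j <;> simp [signs, h0, h1, h2]⟩
  · exact ⟨3, by ext j; fin_cases j <;> simp [signs, h0, h1, h2]⟩

theorem diagPair_mem {k : ℝ} (hk : 0 < k) (l : Fin 3 → ℝ) {e : Fin 3 → ℝ}
    (he : e 0 * e 1 * e 2 = 1) :
    diagPair k l e ∈ Wf (4 * k ^ 3) (-(4 * k ^ 3) * (l 0 + l 1 + l 2))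
      (4 * k ^ 3 * (l 0 * l 1 + l 0 * l 2 + l 1 * l 2)) (-(4 * k ^ 3) * (l 0 * l 1 * l 2)) := by
  refine ⟨(isSymm_diagonal _).smul _, (isSymm_diagonal _).smul _, ?_, fun x y => ?_⟩
  · simp [diagPair, Fin.prod_univ_three, he, hk]
  · simp only [diagPair, ← diagonal_smul, diagonal_sub, det_diagonal, Fin.prod_univ_three,
      Pi.smul_apply, smul_eq_mul]
    linear_combination (4 * k ^ 3 * (x - l 0 * y) * (x - l 1 * y) * (x - l 2 * y)) * he

theorem exists_congruence_diagPair {k : ℝ} (hk : 0 < k) {l : Fin 3 → ℝ}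
    (hl : Function.Injective l)
    {p : Matrix (Fin 3) (Fin 3) ℝ × Matrix (Fin 3) (Fin 3) ℝ}
    (hp : p ∈ Wf (4 * k ^ 3) (-(4 * k ^ 3) * (l 0 + l 1 + l 2))
      (4 * k ^ 3 * (l 0 * l 1 + l 0 * l 2 + l 1 * l 2)) (-(4 * k ^ 3) * (l 0 * l 1 * l 2))) :
    ∃ i : Fin 4, ∃ g : Matrix (Fin 3) (Fin 3) ℝ, g.det = 1 ∧
      g * p.1 * gᵀ = (diagPair k l (signs i)).1 ∧ g * p.2 * gᵀ = (diagPair k l (signs i)).2 := by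
  obtain ⟨A, B⟩ := p
  obtain ⟨hA, hB, hpos, hres⟩ := hp
  simp only at hA hB hpos hres ⊢
  have hdetA : A.det = k ^ 3 := by
    have := hres 1 0
    simp only [one_smul, zero_smul, sub_zero] at this
    linarith
  have hroot : ∀ i, (l i • A - B).det = 0 := by
    intro i
    have := hres (l i) 1
    rw [one_smul] at this
    fin_cases i <;> simp at this ⊢ <;> linarith
  choose V hV0 hV using fun i => exists_eigenvector_of_pencil (hroot i)
  have hV' : ∀ i, V i ⬝ᵥ A *ᵥ V i ≠ 0 :=
    dotProduct_mulVec_ne_zero_of_pencil (V := V) hpos.ne' hA hB hl hV0 hV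
  set q : Fin 3 → ℝ := fun i => V i ⬝ᵥ A *ᵥ V i with hq
  set s : Fin 3 → ℝ := fun i => (√|q i|)⁻¹ with hs
  have hss : ∀ i, s i * s i * q i = q i / |q i| := by
    intro i
    have h : √|q i| * √|q i| = |q i| := Real.mul_self_sqrt (abs_nonneg _)
    rw [hs, ← mul_inv, h, div_eq_inv_mul]
  obtain ⟨P, hP⟩ : ∃ P : Matrix (Fin 3) (Fin 3) ℝ, ∀ i, P i = s i • V i :=
    ⟨of fun i => s i • V i, fun _ => rfl⟩
  set e : Fin 3 → ℝ := fun i => q i / |q i| with he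
  have hPA : P * A * Pᵀ = diagonal e := by
    ext i j
    rw [mul_mul_transpose_apply, diagonal_apply]
    rw [hP, hP, mulVec_smul, dotProduct_smul, smul_dotProduct, smul_eq_mul, smul_eq_mul]
    by_cases hij : i = j
    · subst hij
      rw [if_pos rfl, ← mul_assoc]
      exact hss i
    · rw [dotProduct_mulVec_eq_zero_of_pencil hA hB (hl.ne hij) (hV i) (hV j), if_neg hij,
        mul_zero, mul_zero]
  have hPB : P * B * Pᵀ = diagonal fun i => l i * e i := by
    ext i j
    have h := congrFun (congrFun hPA i) j
    rw [mul_mul_transpose_apply, diagonal_apply] at h ⊢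
    have hBV : B *ᵥ P j = l j • A *ᵥ P j := by
      rw [hP, mulVec_smul, mulVec_smul, hV j, smul_comm]
    rw [hBV, dotProduct_smul, h]
    split_ifs with hij
    · subst hij; rfl
    · simp
  have he1 : ∀ i, e i = 1 ∨ e i = -1 := by
    intro i
    rcases lt_or_gt_of_ne (hV' i) with h | h
    · right
      rw [he]
      simp only
      rw [abs_of_neg h, div_neg, div_self h.ne]
    · left
      rw [he]
      simp only
      rw [abs_of_pos h, div_self h.ne']
  have hprod : 0 < e 0 * e 1 * e 2 := by
    have h := congrArg det hPA
    rw [det_mul, det_mul, det_transpose, det_diagonal, Fin.prod_univ_three] at h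
    have hne : e 0 * e 1 * e 2 ≠ 0 := by
      rcases he1 0 with h0 | h0 <;> rcases he1 1 with h1 | h1 <;> rcases he1 2 with h2 | h2 <;>
        rw [h0, h1, h2] <;> norm_num
    refine lt_of_le_of_ne ?_ hne.symm
    rw [← h, mul_right_comm]
    exact mul_nonneg (mul_self_nonneg _) hpos.le
  obtain ⟨i, hi⟩ := exists_signs_eq he1 hprod
  obtain ⟨g, hg⟩ := exists_det_eq_one_of_congruence hk hdetA
    (by rw [← hi, det_diagonal, Fin.prod_univ_three, signs_prod]) hPA hPB
  exact ⟨i, g, by rw [hi]; exact hg⟩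

theorem signs_injective_of_congruence {k : ℝ} (hk : 0 < k) {l : Fin 3 → ℝ}
    (hl : Function.Injective l) {i j : Fin 4} {g : Matrix (Fin 3) (Fin 3) ℝ}
    (hg : g.det = 1)
    (hA : g * (diagPair k l (signs i)).1 * gᵀ = (diagPair k l (signs j)).1)
    (hB : g * (diagPair k l (signs i)).2 * gᵀ = (diagPair k l (signs j)).2) : i = j := by
  have hfac : ∀ i, (diagPair k l (signs i)).2 = (diagPair k l (signs i)).1 * diagonal l := by
    intro i
    simp [diagPair, diagonal_mul_diagonal, mul_comm]
  set A := (diagPair k l (signs i)).1 with hAdef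
  have hAdet : (g * A).det ≠ 0 := by
    rw [det_mul, hg, hAdef]
    simp [diagPair, Fin.prod_univ_three, signs_prod, hk.ne']
  have hcomm : diagonal l * gᵀ = gᵀ * diagonal l := by
    rw [hfac, hfac, ← hA] at hB
    have h : (g * A) * (diagonal l * gᵀ) = (g * A) * (gᵀ * diagonal l) := by
      simpa only [mul_assoc] using hB
    have hu : IsUnit (g * A).det := isUnit_iff_ne_zero.mpr hAdet
    simpa only [nonsing_inv_mul_cancel_left _ _ hu] using congrArg ((g * A)⁻¹ * ·) h
  have hoff : ∀ r s, r ≠ s → g r s = 0 := by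
    intro r s hrs
    have h := congrFun (congrFun hcomm s) r
    rw [diagonal_mul, mul_diagonal, transpose_apply] at h
    have h' : (l s - l r) * g r s = 0 := by linear_combination h
    exact (mul_eq_zero.mp h').resolve_left (sub_ne_zero.mpr (hl.ne hrs.symm))
  have hdiag : ∀ r, g r r * g r r * signs i r = signs j r := by
    intro r
    have h := congrFun (congrFun hA r) r
    rw [mul_mul_transpose_apply, hAdef] at h
    simp only [diagPair, smul_mulVec, dotProduct_smul, Matrix.smul_apply, smul_eq_mul,
      diagonal_apply_eq] at h
    have h2 := mul_left_cancel₀ hk.ne' h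
    rw [← h2, dotProduct, Finset.sum_eq_single r]
    · rw [mulVec_diagonal]; ring
    · intro s _ hs
      rw [hoff r s hs.symm, zero_mul]
    · simp
  have h0 := hdiag 0
  have h1 := hdiag 1
  have h2 := hdiag 2
  have q0 := mul_self_nonneg (g 0 0)
  have q1 := mul_self_nonneg (g 1 1)
  have q2 := mul_self_nonneg (g 2 2)
  fin_cases i <;> fin_cases j <;> first | rfl | (simp [signs] at h0 h1 h2; linarith)

theorem dotProduct_diagPair_fst (k : ℝ) (l e v : Fin 3 → ℝ) :
    v ⬝ᵥ (diagPair k l e).1 *ᵥ v =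
      k * (e 0 * v 0 ^ 2 + e 1 * v 1 ^ 2 + e 2 * v 2 ^ 2) := by
  simp only [diagPair, smul_mulVec, Pi.smul_apply, smul_eq_mul, dotProduct, mulVec_diagonal,
    Fin.sum_univ_three]
  ring

theorem dotProduct_diagPair_snd (k : ℝ) (l e v : Fin 3 → ℝ) :
    v ⬝ᵥ (diagPair k l e).2 *ᵥ v =
      k * (l 0 * e 0 * v 0 ^ 2 + l 1 * e 1 * v 1 ^ 2 + l 2 * e 2 * v 2 ^ 2) := by
  simp only [diagPair, smul_mulVec, Pi.smul_apply, smul_eq_mul, dotProduct, mulVec_diagonal,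
    Fin.sum_univ_three]
  ring

theorem eq_zero_of_coords {v : Fin 3 → ℝ} (h0 : v 0 ^ 2 = 0) (h1 : v 1 ^ 2 = 0)
    (h2 : v 2 ^ 2 = 0) : v = 0 := by
  ext j
  fin_cases j
  · simpa using h0
  · simpa using h1
  · simpa using h2

theorem numCommonProjZeros_diagPair_eq_zero {k : ℝ} (hk : 0 < k) {l : Fin 3 → ℝ}
    (h01 : l 0 < l 1) (h12 : l 1 < l 2) {i : Fin 4} (hi : i ≠ 2) :
    numCommonProjZeros (diagPair k l (signs i)) = 0 := by
  rw [numCommonProjZeros_eq_card (ι := Fin 0) (fun j => j.elim0) (fun j => j.elim0)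
    (fun j => j.elim0) (fun j => j.elim0) (fun j => j.elim0), Fintype.card_fin]
  intro v hv hA hB
  exfalso
  apply hv
  rw [dotProduct_diagPair_fst] at hA
  rw [dotProduct_diagPair_snd] at hB
  replace hA := (mul_eq_zero.mp hA).resolve_left hk.ne'
  replace hB := (mul_eq_zero.mp hB).resolve_left hk.ne'
  have q0 := sq_nonneg (v 0)
  have q1 := sq_nonneg (v 1)
  have q2 := sq_nonneg (v 2)
  have weighted : ∀ {x y p q : ℝ}, 0 < x → 0 < y → 0 ≤ p → 0 ≤ q → x * p + y * q = 0 →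
      p = 0 ∧ q = 0 := by
    intro x y p q hx hy hp hq h
    have hxp := mul_nonneg hx.le hp
    have hyq := mul_nonneg hy.le hq
    exact ⟨(mul_eq_zero.mp (by linarith : x * p = 0)).resolve_left hx.ne',
      (mul_eq_zero.mp (by linarith : y * q = 0)).resolve_left hy.ne'⟩
  fin_cases i
  · simp [signs] at hA
    exact eq_zero_of_coords (by linarith) (by linarith) (by linarith)
  · simp [signs] at hA hB
    obtain ⟨h1, h2⟩ := weighted (sub_pos.mpr h01) (sub_pos.mpr (h01.trans h12)) q1 q2
      (by linear_combination l 0 * hA - hB)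
    exact eq_zero_of_coords (by linarith) h1 h2
  · exact absurd rfl hi
  · simp [signs] at hA hB
    obtain ⟨h1, h2⟩ := weighted (sub_pos.mpr (h01.trans h12)) (sub_pos.mpr h12) q0 q1
      (by linear_combination hB - l 2 * hA)
    exact eq_zero_of_coords h1 h2 (by linarith)

theorem numCommonProjZeros_diagPair_eq_four {k : ℝ} (hk : 0 < k) {l : Fin 3 → ℝ}
    (h01 : l 0 < l 1) (h12 : l 1 < l 2) :
    numCommonProjZeros (diagPair k l (signs 2)) = 4 := by
  obtain ⟨x, hx, hx2⟩ : ∃ x : ℝ, 0 < x ∧ x ^ 2 = l 2 - l 1 :=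
    ⟨√(l 2 - l 1), Real.sqrt_pos.mpr (by linarith), Real.sq_sqrt (by linarith)⟩
  obtain ⟨y, hy, hy2⟩ : ∃ y : ℝ, 0 < y ∧ y ^ 2 = l 2 - l 0 :=
    ⟨√(l 2 - l 0), Real.sqrt_pos.mpr (by linarith), Real.sq_sqrt (by linarith)⟩
  obtain ⟨z, hz, hz2⟩ : ∃ z : ℝ, 0 < z ∧ z ^ 2 = l 1 - l 0 :=
    ⟨√(l 1 - l 0), Real.sqrt_pos.mpr (by linarith), Real.sq_sqrt (by linarith)⟩
  rw [numCommonProjZeros_eq_card (ι := Fin 4)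
    ![![x, y, z], ![x, -y, z], ![-x, y, z], ![-x, -y, z]], Fintype.card_fin]
  · intro i h
    have := congrFun h 2
    fin_cases i <;> simp [hz.ne'] at this
  · intro i
    rw [dotProduct_diagPair_fst]
    fin_cases i <;> simp [signs, hx2, hy2, hz2]
  · intro i
    rw [dotProduct_diagPair_snd]
    fin_cases i <;> simp [signs, hx2, hy2, hz2] <;> right <;> ring
  · intro i j t h
    have h2 := congrFun h 2
    obtain rfl : t = 1 := by
      fin_cases i <;> fin_cases j <;> simpa [hz.ne'] using h2
    have h0 := congrFun h 0
    have h1 := congrFun h 1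
    fin_cases i <;> fin_cases j <;> first | rfl | (simp at h0 h1; exfalso; linarith)
  · intro v hv hA hB
    rw [dotProduct_diagPair_fst] at hA
    rw [dotProduct_diagPair_snd] at hB
    replace hA := (mul_eq_zero.mp hA).resolve_left hk.ne'
    replace hB := (mul_eq_zero.mp hB).resolve_left hk.ne'
    simp [signs] at hA hB
    have hxz : (z * v 0) ^ 2 = (x * v 2) ^ 2 := by
      linear_combination hB - l 1 * hA + v 0 ^ 2 * hz2 - v 2 ^ 2 * hx2
    have hyz : (z * v 1) ^ 2 = (y * v 2) ^ 2 := by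
      linear_combination hB - l 0 * hA + v 1 ^ 2 * hz2 - v 2 ^ 2 * hy2
    have hcoord : ∀ {s r c : ℝ}, z * c = s * v 2 → r = s → v 2 / z * r = c := by
      rintro s r c h rfl
      rw [div_mul_eq_mul_div, div_eq_iff hz.ne']
      linarith
    have h2 : v 2 / z * z = v 2 := div_mul_cancel₀ _ hz.ne'
    have build : ∀ a b : ℝ, v 2 / z * a = v 0 → v 2 / z * b = v 1 →
        (v 2 / z) • ![a, b, z] = v := by
      intro a b ha hb
      ext j
      fin_cases j
      · simpa using ha
      · simpa using hb
      · simpa using h2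
    rcases sq_eq_sq_iff_eq_or_eq_neg.mp hxz with h0 | h0 <;>
      rcases sq_eq_sq_iff_eq_or_eq_neg.mp hyz with h1 | h1
    · exact ⟨0, v 2 / z, build _ _ (hcoord h0 rfl) (hcoord h1 rfl)⟩
    · exact ⟨1, v 2 / z, build _ _ (hcoord h0 rfl) (hcoord (h1.trans (neg_mul _ _).symm) rfl)⟩
    · exact ⟨2, v 2 / z, build _ _ (hcoord (h0.trans (neg_mul _ _).symm) rfl) (hcoord h1 rfl)⟩
    · exact ⟨3, v 2 / z, build _ _ (hcoord (h0.trans (neg_mul _ _).symm) rfl)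
        (hcoord (h1.trans (neg_mul _ _).symm) rfl)⟩

/-- Bookkeeping for a quotient whose classes are listed without repetition by `F`. -/
theorem quot_ncard_of_representatives {α ι : Type*} {r : α → α → Prop} (hr : Equivalence r)
    (F : ι → α) (hinj : ∀ i j, r (F i) (F j) → i = j) (hsurj : ∀ x, ∃ i, r x (F i))
    (N : α → ℕ) (hN : ∀ x y, r x y → N x = N y) (c : ℕ) :
    Nat.card (Quot r) = Nat.card ι ∧
      Set.ncard {q : Quot r | ∃ x, Quot.mk r x = q ∧ N x = c} = Set.ncard {i | N (F i) = c} := by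
  have hb : Function.Bijective fun i => Quot.mk r (F i) := by
    refine ⟨fun i j h => hinj i j ((hr.quot_mk_eq_iff _ _).mp h), fun q => ?_⟩
    obtain ⟨x, rfl⟩ := Quot.exists_rep q
    obtain ⟨i, hi⟩ := hsurj x
    exact ⟨i, (Quot.sound hi).symm⟩
  refine ⟨(Nat.card_eq_of_bijective _ hb).symm, ?_⟩
  rw [← Set.ncard_image_of_injective _ hb.1]
  congr 1
  ext q
  constructor
  · rintro ⟨x, rfl, hx⟩
    obtain ⟨i, hi⟩ := hsurj x
    exact ⟨i, (hN _ _ hi).symm.trans hx, (Quot.sound hi).symm⟩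
  · rintro ⟨i, hi, rfl⟩
    exact ⟨F i, rfl, hi⟩

theorem orbits_of_three_real_roots {k : ℝ} (hk : 0 < k) {l : Fin 3 → ℝ}
    (h01 : l 0 < l 1) (h12 : l 1 < l 2) {a b c d : ℝ} (ha : a = 4 * k ^ 3)
    (hb : b = -(4 * k ^ 3) * (l 0 + l 1 + l 2))
    (hc : c = 4 * k ^ 3 * (l 0 * l 1 + l 0 * l 2 + l 1 * l 2))
    (hd : d = -(4 * k ^ 3) * (l 0 * l 1 * l 2)) :
    Nat.card (Quot (sl3RealRel a b c d)) = 4 ∧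
      Set.ncard {q : Quot (sl3RealRel a b c d) | ∃ p : Wf a b c d,
        Quot.mk _ p = q ∧ numCommonProjZeros p.1 = 4} = 1 ∧
      Set.ncard {q : Quot (sl3RealRel a b c d) | ∃ p : Wf a b c d,
        Quot.mk _ p = q ∧ numCommonProjZeros p.1 = 0} = 3 := by
  subst ha hb hc hd
  have hl : Function.Injective l := by
    intro i j h
    fin_cases i <;> fin_cases j <;> first | rfl | (simp at h; exfalso; linarith)
  have key := quot_ncard_of_representatives (sl3RealRel_equivalence _ _ _ _)
    (fun i => ⟨_, diagPair_mem hk l (signs_prod i)⟩)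
    (fun i j h => by
      obtain ⟨g, hg, hA, hB⟩ := sl3RealRel_iff.mp h
      exact signs_injective_of_congruence hk hl hg hA hB)
    (fun p => by
      obtain ⟨i, g, hg⟩ := exists_congruence_diagPair hk hl p.2
      exact ⟨i, sl3RealRel_iff.mpr ⟨g, hg⟩⟩)
    (fun p => numCommonProjZeros p.1) (fun _ _ => numCommonProjZeros_eq_of_rel)
  have h4 : {i | numCommonProjZeros (diagPair k l (signs i)) = 4} = {2} := by
    ext i
    by_cases hi : i = 2
    · simp [hi, numCommonProjZeros_diagPair_eq_four hk h01 h12]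
    · simp [hi, numCommonProjZeros_diagPair_eq_zero hk h01 h12 hi]
  have h0 : {i | numCommonProjZeros (diagPair k l (signs i)) = 0} = {2}ᶜ := by
    ext i
    by_cases hi : i = 2
    · simp [hi, numCommonProjZeros_diagPair_eq_four hk h01 h12]
    · simp [hi, numCommonProjZeros_diagPair_eq_zero hk h01 h12 hi]
  refine ⟨by rw [(key 0).1, Nat.card_eq_fintype_card, Fintype.card_fin], ?_, ?_⟩
  · rw [(key 4).2, h4, Set.ncard_singleton]
  · rw [(key 0).2, h0, Set.ncard_compl, Set.ncard_singleton, Nat.card_eq_fintype_card,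
      Fintype.card_fin]

/-- The complex conjugate of an eigenvector of a real pencil is an eigenvector. -/
theorem mulVec_star_of_pencil {n : Type*} [Fintype n] {A B : Matrix n n ℝ} {w : n → ℂ} {μ : ℂ}
    (h : B.map Complex.ofReal *ᵥ w = μ • A.map Complex.ofReal *ᵥ w) :
    B.map Complex.ofReal *ᵥ star w = star μ • A.map Complex.ofReal *ᵥ star w := by
  ext i
  have hi := congrArg (starRingEnd ℂ) (congrFun h i)
  simpa [mulVec, dotProduct] using hi

theorem ofReal_mulVec {n : Type*} [Fintype n] (A : Matrix n n ℝ) (u : n → ℝ) :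
    (A.map Complex.ofReal *ᵥ fun i => (u i : ℂ)) = fun i => ((A *ᵥ u) i : ℂ) := by
  ext i
  simp [mulVec, dotProduct]

theorem ofReal_dotProduct {n : Type*} [Fintype n] (u v : n → ℝ) :
    ((fun i => (u i : ℂ)) ⬝ᵥ fun i => (v i : ℂ)) = ((u ⬝ᵥ v : ℝ) : ℂ) := by
  simp [dotProduct]

theorem exists_real_basis_of_conjugate_roots {A B : Matrix (Fin 3) (Fin 3) ℝ}
    (hA : A.IsSymm) (hB : B.IsSymm) (hdet : A.det ≠ 0) {l m n : ℝ} (hn : 0 < n)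
    (hl : (l • A - B).det = 0)
    (hmn : ((m + n * Complex.I) • A.map Complex.ofReal - B.map Complex.ofReal).det = 0) :
    ∃ x u v : Fin 3 → ℝ, B *ᵥ x = l • A *ᵥ x ∧ B *ᵥ u = m • A *ᵥ u - n • A *ᵥ v ∧
      B *ᵥ v = n • A *ᵥ u + m • A *ᵥ v ∧ x ⬝ᵥ A *ᵥ x ≠ 0 ∧ x ⬝ᵥ A *ᵥ u = 0 ∧
      x ⬝ᵥ A *ᵥ v = 0 ∧ u ⬝ᵥ A *ᵥ u = 0 ∧ u ⬝ᵥ A *ᵥ v = 1 ∧ v ⬝ᵥ A *ᵥ v = 0 := by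
  obtain ⟨x, hx0, hx⟩ := exists_eigenvector_of_pencil hl
  obtain ⟨w₀, hw₀0, hw₀⟩ := exists_eigenvector_of_pencil hmn
  set μ : ℂ := m + n * Complex.I with hμ
  have hμim : μ.im = n := by simp [hμ]
  have hμstar : (star μ).im = -n := by rw [← hμim]; rfl
  have hAc : (A.map Complex.ofReal).IsSymm := hA.map _
  have hBc : (B.map Complex.ofReal).IsSymm := hB.map _
  have hdetc : (A.map Complex.ofReal).det ≠ 0 := by
    have h : (A.map Complex.ofReal).det = (A.det : ℂ) :=
      (RingHom.map_det Complex.ofRealHom A).symm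
    rw [h]
    exact_mod_cast hdet
  set xc : Fin 3 → ℂ := fun i => (x i : ℂ) with hxc
  have hxc_eig : B.map Complex.ofReal *ᵥ xc = (l : ℂ) • A.map Complex.ofReal *ᵥ xc := by
    rw [hxc, ofReal_mulVec, ofReal_mulVec, hx]
    ext i
    simp
  have hxc0 : xc ≠ 0 := by
    intro h
    apply hx0
    ext i
    simpa [hxc] using congrFun h i
  have hlμ : (l : ℂ) ≠ μ := fun h => by
    have := congrArg Complex.im h
    rw [hμim, Complex.ofReal_im] at this
    linarith
  have hlμ' : (l : ℂ) ≠ star μ := fun h => by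
    have := congrArg Complex.im h
    rw [hμstar, Complex.ofReal_im] at this
    linarith
  have hμμ' : μ ≠ star μ := fun h => by
    have := congrArg Complex.im h
    rw [hμstar, hμim] at this
    linarith
  have hinj : Function.Injective ![(l : ℂ), μ, star μ] := by
    intro i j h
    fin_cases i <;> fin_cases j <;> first
      | rfl
      | exact absurd h hlμ
      | exact absurd h hlμ'
      | exact absurd h hμμ'
      | exact absurd h.symm hlμ
      | exact absurd h.symm hlμ'
      | exact absurd h.symm hμμ'
  have hne := dotProduct_mulVec_ne_zero_of_pencil (V := ![xc, w₀, star w₀])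
    hdetc hAc hBc hinj
    (by intro i; fin_cases i; exacts [hxc0, hw₀0, star_ne_zero.mpr hw₀0])
    (by intro i; fin_cases i; exacts [hxc_eig, hw₀, mulVec_star_of_pencil hw₀])
  have hxx : xc ⬝ᵥ A.map Complex.ofReal *ᵥ xc ≠ 0 := hne 0
  have hww₀ : w₀ ⬝ᵥ A.map Complex.ofReal *ᵥ w₀ ≠ 0 := hne 1
  obtain ⟨z, hz⟩ := IsAlgClosed.exists_pow_nat_eq
    (2 * Complex.I / (w₀ ⬝ᵥ A.map Complex.ofReal *ᵥ w₀)) (n := 2) (by norm_num)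
  obtain ⟨w, hw⟩ : ∃ w, w = z • w₀ := ⟨_, rfl⟩
  have hweig : B.map Complex.ofReal *ᵥ w = μ • A.map Complex.ofReal *ᵥ w := by
    rw [hw, mulVec_smul, mulVec_smul, hw₀, smul_comm]
  have hww : w ⬝ᵥ A.map Complex.ofReal *ᵥ w = 2 * Complex.I := by
    rw [hw, mulVec_smul, dotProduct_smul, smul_dotProduct, smul_eq_mul, smul_eq_mul, ← mul_assoc,
      ← sq, hz, div_mul_cancel₀ _ hww₀]
  have hwstar := dotProduct_mulVec_eq_zero_of_pencil hAc hBc hμμ' hweig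
    (mulVec_star_of_pencil hweig)
  have hxw := dotProduct_mulVec_eq_zero_of_pencil hAc hBc hlμ hxc_eig hweig
  obtain ⟨u, hu⟩ : ∃ u : Fin 3 → ℝ, u = fun i => (w i).re := ⟨_, rfl⟩
  obtain ⟨v, hv⟩ : ∃ v : Fin 3 → ℝ, v = fun i => (w i).im := ⟨_, rfl⟩
  have hwuv : w = (fun i => (u i : ℂ)) + Complex.I • fun i => (v i : ℂ) := by
    ext i
    simp [hu, hv, mul_comm Complex.I, Complex.re_add_im]
  have hwuv' : star w = (fun i => (u i : ℂ)) - Complex.I • fun i => (v i : ℂ) := by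
    ext i
    apply Complex.ext <;> simp [hu, hv]
  have hsymm : v ⬝ᵥ A *ᵥ u = u ⬝ᵥ A *ᵥ v := by
    rw [dotProduct_mulVec, dotProduct_comm, ← mulVec_transpose, hA.eq]
  rw [hwuv'] at hwstar
  rw [hwuv] at hweig hww hwstar hxw
  simp only [hxc, mulVec_add, mulVec_sub, mulVec_smul, dotProduct_add, dotProduct_sub,
    dotProduct_smul, add_dotProduct, smul_dotProduct, ofReal_mulVec, ofReal_dotProduct, smul_eq_mul,
    hsymm] at hww hwstar hxw hxx
  have hww_re := congrArg Complex.re hww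
  have hww_im := congrArg Complex.im hww
  have hwstar_re := congrArg Complex.re hwstar
  have hxw_re := congrArg Complex.re hxw
  have hxw_im := congrArg Complex.im hxw
  simp at hww_re hww_im hwstar_re hxw_re hxw_im
  simp only [mulVec_add, mulVec_smul, ofReal_mulVec] at hweig
  refine ⟨x, u, v, hx, ?_, ?_, by exact_mod_cast hxx, hxw_re, hxw_im, by linarith, by linarith,
    by linarith⟩
  · ext i
    have := congrArg Complex.re (congrFun hweig i)
    simp [hμ] at this ⊢
    linarith
  · ext i
    have := congrArg Complex.im (congrFun hweig i)
    simp [hμ] at this ⊢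
    linarith

/-- Gram matrices of the normal form for one real and two conjugate roots, up to scale. -/
def hyperbolicGram : Matrix (Fin 3) (Fin 3) ℝ := !![-1, 0, 0; 0, 0, 1; 0, 1, 0]

/-- The second Gram matrix of the normal form, for the roots `l` and `m ± ni`. -/
def conjugateGram (l m n : ℝ) : Matrix (Fin 3) (Fin 3) ℝ := !![-l, 0, 0; 0, -n, m; 0, m, n]

theorem conjugatePair_mem {k : ℝ} (hk : 0 < k) (l m n : ℝ) :
    (k • hyperbolicGram, k • conjugateGram l m n) ∈
      Wf (4 * k ^ 3) (-(4 * k ^ 3) * (l + 2 * m)) (4 * k ^ 3 * (2 * m * l + (m ^ 2 + n ^ 2)))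
        (-(4 * k ^ 3) * (l * (m ^ 2 + n ^ 2))) := by
  refine ⟨IsSymm.smul ?_ _, IsSymm.smul ?_ _, ?_, fun x y => ?_⟩
  · ext i j
    fin_cases i <;> fin_cases j <;> simp [hyperbolicGram]
  · ext i j
    fin_cases i <;> fin_cases j <;> simp [conjugateGram]
  · simp [hyperbolicGram, det_fin_three, hk]
  · simp [hyperbolicGram, conjugateGram, det_fin_three]
    ring

theorem exists_congruence_conjugatePair {k : ℝ} (hk : 0 < k) {l m n : ℝ} (hn : 0 < n)
    (p : Wf (4 * k ^ 3) (-(4 * k ^ 3) * (l + 2 * m)) (4 * k ^ 3 * (2 * m * l + (m ^ 2 + n ^ 2)))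
        (-(4 * k ^ 3) * (l * (m ^ 2 + n ^ 2)))) :
    ∃ g : Matrix (Fin 3) (Fin 3) ℝ, g.det = 1 ∧
      g * p.1.1 * gᵀ = k • hyperbolicGram ∧ g * p.1.2 * gᵀ = k • conjugateGram l m n := by
  have hmn := complex_resolvent p (m + n * Complex.I) 1
  obtain ⟨⟨A, B⟩, hA, hB, hpos, hres⟩ := p
  simp only at hA hB hpos hres hmn ⊢
  have hdetA : A.det = k ^ 3 := by
    have := hres 1 0
    simp only [one_smul, zero_smul, sub_zero] at this
    linarith
  have hl : (l • A - B).det = 0 := by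
    have := hres l 1
    rw [one_smul] at this
    linarith
  have hmn' : ((m + n * Complex.I) • A.map Complex.ofReal - B.map Complex.ofReal).det = 0 := by
    rw [one_smul] at hmn
    have h4 : (4 : ℂ) ≠ 0 := by norm_num
    refine (mul_eq_zero.mp (hmn.trans ?_)).resolve_left h4
    push_cast
    linear_combination (4 * (k : ℂ) ^ 3 * n ^ 2 * (m + n * Complex.I - l)) * Complex.I_sq
  obtain ⟨x, u, v, hx, hu, hv, hxx, hxu, hxv, huu, huv, hvv⟩ :=
    exists_real_basis_of_conjugate_roots hA hB hpos.ne' hn hl hmn'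
  have symm : ∀ y z : Fin 3 → ℝ, y ⬝ᵥ A *ᵥ z = z ⬝ᵥ A *ᵥ y := by
    intro y z
    rw [dotProduct_mulVec, dotProduct_comm, ← mulVec_transpose, hA.eq]
  have hux := (symm u x).trans hxu
  have hvx := (symm v x).trans hxv
  have hvu := (symm v u).trans huv
  have rows : ∀ p q r : Fin 3 → ℝ,
      ∃ P : Matrix (Fin 3) (Fin 3) ℝ, P 0 = p ∧ P 1 = q ∧ P 2 = r :=
    fun p q r => ⟨of ![p, q, r], rfl, rfl, rfl⟩
  have hneg : x ⬝ᵥ A *ᵥ x < 0 := by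
    obtain ⟨P, hP0, hP1, hP2⟩ := rows x u v
    have h : (P * A * Pᵀ).det = -(x ⬝ᵥ A *ᵥ x) := by
      rw [det_fin_three]
      simp only [mul_mul_transpose_apply, hP0, hP1, hP2]
      simp [hxu, hxv, huu, huv, hvv, hvu,
        hux, hvx]
    rw [det_mul, det_mul, det_transpose] at h
    have h0 : 0 ≤ -(x ⬝ᵥ A *ᵥ x) := by
      rw [← h, mul_right_comm]
      exact mul_nonneg (mul_self_nonneg _) hpos.le
    exact lt_of_le_of_ne (by linarith) hxx
  obtain ⟨s, hs⟩ : ∃ s : ℝ, s * (s * (x ⬝ᵥ A *ᵥ x)) = -1 := by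
    refine ⟨(√(-(x ⬝ᵥ A *ᵥ x)))⁻¹, ?_⟩
    rw [← mul_assoc, ← mul_inv, Real.mul_self_sqrt (by linarith), inv_mul_eq_div, div_neg,
      div_self hxx]
  obtain ⟨P, hP0, hP1, hP2⟩ := rows (s • x) u v
  refine exists_det_eq_one_of_congruence hk (P := P) hdetA
    (by simp [hyperbolicGram, det_fin_three]) ?_ ?_
  · ext i j
    rw [mul_mul_transpose_apply]
    fin_cases i <;> fin_cases j <;>
      simp [hP0, hP1, hP2, hyperbolicGram, mulVec_smul, hxu, hxv, huu, huv, hvv, hvu, hux, hvx, hs]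
  · ext i j
    rw [mul_mul_transpose_apply]
    fin_cases i <;> fin_cases j <;>
      simp [hP0, hP1, hP2, conjugateGram, mulVec_smul, hx, hu, hv, hxu, hxv, huu, huv, hvv, hvu,
        hux, hvx]
    linear_combination l * hs

theorem numCommonProjZeros_conjugatePair {k : ℝ} (hk : 0 < k) (l m : ℝ) {n : ℝ} (hn : 0 < n) :
    numCommonProjZeros (k • hyperbolicGram, k • conjugateGram l m n) = 2 := by
  have hA : ∀ v : Fin 3 → ℝ, v ⬝ᵥ (k • hyperbolicGram) *ᵥ v = k * (2 * v 1 * v 2 - v 0 ^ 2) := by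
    intro v
    simp [hyperbolicGram, dotProduct, mulVec, Fin.sum_univ_three]
    ring
  have hB : ∀ v : Fin 3 → ℝ, v ⬝ᵥ (k • conjugateGram l m n) *ᵥ v =
      k * (n * (v 2 ^ 2 - v 1 ^ 2) + 2 * m * v 1 * v 2 - l * v 0 ^ 2) := by
    intro v
    simp [conjugateGram, dotProduct, mulVec, Fin.sum_univ_three]
    ring
  set r := (m - l) / n with hr
  have hrn : n * r = m - l := by rw [hr]; field_simp
  obtain ⟨t, ht0, ht⟩ : ∃ t : ℝ, 0 < t ∧ t ^ 2 - 2 * r * t - 1 = 0 := by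
    have hsq : √(r ^ 2 + 1) ^ 2 = r ^ 2 + 1 := Real.sq_sqrt (by positivity)
    refine ⟨r + √(r ^ 2 + 1), ?_, by linear_combination hsq⟩
    have : |r| < √(r ^ 2 + 1) := by
      rw [← Real.sqrt_sq_eq_abs]
      exact Real.sqrt_lt_sqrt (sq_nonneg _) (by linarith)
    linarith [neg_abs_le r]
  obtain ⟨y, hy, hy2⟩ : ∃ y : ℝ, 0 < y ∧ y ^ 2 = 2 * t :=
    ⟨√(2 * t), Real.sqrt_pos.mpr (by linarith), Real.sq_sqrt (by linarith)⟩
  rw [numCommonProjZeros_eq_card (ι := Fin 2) ![![y, t, 1], ![-y, t, 1]], Fintype.card_fin]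
  · intro i h
    have := congrFun h 2
    fin_cases i <;> simp at this
  · intro i
    rw [hA]
    fin_cases i <;> simp [hy2]
  · intro i
    rw [hB]
    fin_cases i <;> simp [hy2] <;> right <;> linear_combination -n * ht - 2 * t * hrn
  · intro i j s h
    have h2 := congrFun h 2
    obtain rfl : s = 1 := by
      fin_cases i <;> fin_cases j <;> simpa using h2
    have h0 := congrFun h 0
    fin_cases i <;> fin_cases j <;> first | rfl | (simp at h0; exfalso; linarith)
  · intro v hv h1 h2
    rw [hA] at h1
    rw [hB] at h2
    replace h1 := (mul_eq_zero.mp h1).resolve_left hk.ne'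
    replace h2 := (mul_eq_zero.mp h2).resolve_left hk.ne'
    have h3 : (v 1 - t * v 2) * (t * v 1 + v 2) = 0 := by
      have h : n * ((v 1 - t * v 2) * (t * v 1 + v 2)) = 0 := by
        linear_combination -t * h2 + t * l * h1 - n * v 1 * v 2 * ht - 2 * t * v 1 * v 2 * hrn
      exact (mul_eq_zero.mp h).resolve_left hn.ne'
    have h4 : v 1 = t * v 2 := by
      rcases mul_eq_zero.mp h3 with h | h
      · linarith
      · have hv2 : v 2 = -(t * v 1) := by linarith
        have hv1 : v 1 = 0 := by
          have h5 : v 0 ^ 2 + 2 * t * v 1 ^ 2 = 0 := by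
            rw [hv2] at h1
            linear_combination -h1
          have h6 : 0 ≤ t * v 1 ^ 2 := by positivity
          have h7 : t * v 1 ^ 2 = 0 := by nlinarith [sq_nonneg (v 0)]
          simpa [ht0.ne'] using h7
        rw [hv2, hv1]
        simp
    have h5 : v 0 ^ 2 = (y * v 2) ^ 2 := by
      rw [h4] at h1
      linear_combination -h1 - v 2 ^ 2 * hy2
    rcases sq_eq_sq_iff_eq_or_eq_neg.mp h5 with h0 | h0
    · refine ⟨0, v 2, ?_⟩
      ext j
      fin_cases j <;> simp [h0, h4, mul_comm]
    · refine ⟨1, v 2, ?_⟩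
      ext j
      fin_cases j <;> simp [h0, h4, mul_comm]

theorem orbit_of_conjugate_roots {k : ℝ} (hk : 0 < k) {l m n : ℝ} (hn : 0 < n)
    {a b c d : ℝ} (ha : a = 4 * k ^ 3) (hb : b = -(4 * k ^ 3) * (l + 2 * m))
    (hc : c = 4 * k ^ 3 * (2 * m * l + (m ^ 2 + n ^ 2)))
    (hd : d = -(4 * k ^ 3) * (l * (m ^ 2 + n ^ 2))) :
    Nat.card (Quot (sl3RealRel a b c d)) = 1 ∧
      ∀ p : Wf a b c d, numCommonProjZeros p.1 = 2 := by
  subst ha hb hc hd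
  have hrel := fun p => sl3RealRel_iff (q := ⟨_, conjugatePair_mem hk l m n⟩).mpr
    (exists_congruence_conjugatePair hk hn p)
  refine ⟨?_, fun p => ?_⟩
  · have key := quot_ncard_of_representatives (sl3RealRel_equivalence _ _ _ _)
      (fun _ : Unit => ⟨_, conjugatePair_mem hk l m n⟩) (fun _ _ _ => rfl)
      (fun p => ⟨(), hrel p⟩) (fun _ => 0) (fun _ _ _ => rfl) 0
    rw [key.1, Nat.card_unique]
  · rw [numCommonProjZeros_eq_of_rel (hrel p)]
    exact numCommonProjZeros_conjugatePair hk l m hn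

/-- Lemma 22 and Remark 23 of the paper: let `f = (a, b, c, d)`
be a real binary cubic form with `a > 0` and `Δ(f) ≠ 0`.
(a) If `Δ(f) > 0` then `W_f` consists of exactly four SL₃(ℝ)-orbits: exactly one
orbit whose pairs have 4 common zeros in `ℙ²(ℝ)`, and exactly three orbits whose
pairs have no common zero in `ℙ²(ℝ)`.
(b) If `Δ(f) < 0` then `W_f` is a single SL₃(ℝ)-orbit, and every pair in it has
exactly 2 common zeros in `ℙ²(ℝ)`. -/
theorem orbits_of_SL3R_on_pairs_with_fixed_resolvent (a b c d : ℝ) (ha : 0 < a)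
    (hΔ : b ^ 2 * c ^ 2 - 4 * a * c ^ 3 - 4 * b ^ 3 * d - 27 * a ^ 2 * d ^ 2
      + 18 * a * b * c * d ≠ 0) :
    (0 < b ^ 2 * c ^ 2 - 4 * a * c ^ 3 - 4 * b ^ 3 * d - 27 * a ^ 2 * d ^ 2
        + 18 * a * b * c * d →
      Nat.card (Quot (sl3RealRel a b c d)) = 4 ∧
      Set.ncard {q : Quot (sl3RealRel a b c d) | ∃ p : Wf a b c d,
        Quot.mk _ p = q ∧ numCommonProjZeros p.1 = 4} = 1 ∧
      Set.ncard {q : Quot (sl3RealRel a b c d) | ∃ p : Wf a b c d,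
        Quot.mk _ p = q ∧ numCommonProjZeros p.1 = 0} = 3) ∧
    (b ^ 2 * c ^ 2 - 4 * a * c ^ 3 - 4 * b ^ 3 * d - 27 * a ^ 2 * d ^ 2
        + 18 * a * b * c * d < 0 →
      Nat.card (Quot (sl3RealRel a b c d)) = 1 ∧
      ∀ p : Wf a b c d, numCommonProjZeros p.1 = 2) := by
  obtain ⟨k, hk, hak⟩ : ∃ k : ℝ, 0 < k ∧ a = 4 * k ^ 3 := by
    refine ⟨(a / 4) ^ ((3 : ℕ) : ℝ)⁻¹, by positivity, ?_⟩
    rw [Real.rpow_inv_natCast_pow (by positivity) (by norm_num)]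
    ring
  refine ⟨fun h => ?_, fun h => ?_⟩
  · obtain ⟨l₁, l₂, l₃, h12, h23, hb, hc, hd⟩ := exists_three_real_roots ha h
    rw [hak] at hb hc hd
    exact orbits_of_three_real_roots hk (l := ![l₁, l₂, l₃]) h12 h23 hak hb hc hd
  · obtain ⟨l, m, n, hn, hb, hc, hd⟩ := exists_real_root_and_conjugate_roots ha h
    rw [hak] at hb hc hd
    exact orbit_of_conjugate_roots hk hn hak hb hc hd
end
end
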